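/- arXiv:2505.09797 — 3 statements merged into one kernel-verified Lean document; each statement's English description precedes it below -/
import Mathlib

section
/- Let q be an odd prime power, n ≥ 1, and let A ∈ GL_n(𝔽_q) be a matrix whose square A² is a scalar matrix. Let H = {g ∈ GL_n(𝔽_q) : gA = Ag} be the centralizer of A (equivalently, the fixed-point subgroup of the involution X ↦ AXA⁻¹). If π is an irreducible complex representation of GL_n(𝔽_q) possessing a nonzero H-fixed vector, then π is self-dual, i.e. its character χ_π satisfies χ_π(g) = χ_π(g⁻¹) for all g ∈ GL_n(𝔽_q). -/
open Matrix

/-- A representation is irreducible if the space is nonzero and the only invariant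
subspaces are `⊥` and `⊤`. -/
def IsIrred {G V : Type*} [Group G] [AddCommGroup V] [Module ℂ V]
    (ρ : Representation ℂ G V) : Prop :=
  (∃ v : V, v ≠ 0) ∧
    ∀ W : Submodule ℂ V, (∀ (g : G), ∀ v ∈ W, ρ g v ∈ W) → W = ⊥ ∨ W = ⊤

section Involution

open scoped Classical

theorem Finset.sum_filter_eq_of_inverse {α β M : Type*} [Fintype α] [Fintype β] [AddCommMonoid M]
    {P : α → Prop} {Q : β → Prop} [DecidablePred P] [DecidablePred Q] {k : α → M} {h : β → M}
    (f : α → β) (g : β → α) (hf : ∀ x, P x → Q (f x)) (hg : ∀ y, Q y → P (g y))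
    (hgf : ∀ x, P x → g (f x) = x) (hfg : ∀ y, Q y → f (g y) = y)
    (hk : ∀ x, P x → k x = h (f x)) :
    ∑ x with P x, k x = ∑ y with Q y, h y := by
  refine Finset.sum_nbij' f g ?_ ?_ ?_ ?_ ?_ <;> simp_all

theorem mul_mul_eq_of_mul_eq {M : Type*} [Semigroup M] {a b c : M} (h : a * b = c) (z : M) :
    a * (b * z) = c * z := by
  rw [← mul_assoc, h]

/-- Some positive power of an element of a finite monoid is idempotent. -/
theorem exists_pow_isIdempotent {M : Type*} [Monoid M] [Finite M] (s : M) :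
    ∃ k : ℕ, 1 ≤ k ∧ s ^ k * s ^ k = s ^ k := by
  obtain ⟨i, j, hij, h⟩ : ∃ i j : ℕ, i < j ∧ s ^ i = s ^ j := by
    obtain ⟨i, j, hne, h⟩ := Finite.exists_ne_map_eq_of_infinite (fun n : ℕ => s ^ n)
    rcases lt_or_gt_of_ne hne with h' | h'
    · exact ⟨i, j, h', h⟩
    · exact ⟨j, i, h', h.symm⟩
  obtain ⟨d, hd, rfl⟩ : ∃ d, 0 < d ∧ j = i + d := ⟨j - i, by omega, by omega⟩
  have step : ∀ m, i ≤ m → s ^ (m + d) = s ^ m := by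
    intro m hm
    obtain ⟨l, rfl⟩ := Nat.exists_eq_add_of_le hm
    rw [show i + l + d = (i + d) + l by ring, pow_add, ← h, ← pow_add]
  have steps : ∀ a m, i ≤ m → s ^ (m + a * d) = s ^ m := by
    intro a
    induction a with
    | zero => simp
    | succ a ih =>
      intro m hm
      rw [show m + (a + 1) * d = m + a * d + d by ring, step _ (by omega), ih m hm]
  refine ⟨(i + 1) * d, by nlinarith, ?_⟩
  rw [← pow_add, steps _ _ (by nlinarith)]

section block

variable {ι F : Type*} [Fintype ι] [DecidableEq ι] [Field F]

/-- `x` acts as the identity on the image of the idempotent `q` and preserves its kernel. -/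
def IsBlock (q x : Matrix ι ι F) : Prop := x * q = q ∧ q * x = q

theorem IsBlock.mul {q x y : Matrix ι ι F} (hx : IsBlock q x) (hy : IsBlock q y) :
    IsBlock q (x * y) :=
  ⟨by rw [Matrix.mul_assoc, hy.1, hx.1], by rw [← Matrix.mul_assoc, hx.2, hy.2]⟩

theorem IsBlock.inv {q x y : Matrix ι ι F} (hx : IsBlock q x) (h : x * y = 1) (h' : y * x = 1) :
    IsBlock q y :=
  ⟨by rw [← hx.1, ← Matrix.mul_assoc, h', Matrix.one_mul, hx.1],
    by rw [← hx.2, Matrix.mul_assoc, h, Matrix.mul_one, hx.2]⟩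

/-- Two square roots `A`, `X` of `c` agreeing on the image of `q`, together with a complementary pair
of idempotents `e`, `p` commuting with both, for which the intertwining equation is solvable. -/
structure RootPair (c : F) (q p e A X : Matrix ι ι F) : Prop where
  c_ne : c ≠ 0
  AA : A * A = c • 1
  XX : X * X = c • 1
  Aq : A * q = q * A
  Xq : X * q = A * q
  qX : q * X = q * A
  pp : p * p = p
  ee : e * e = e
  add : e + p = 1
  ep : e * p = 0
  pe : p * e = 0
  eq : e * q = q
  qe : q * e = q
  pq : p * q = 0
  qp : q * p = 0
  pA : p * A = A * p
  pX : p * X = X * p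
  eA : e * A = A * e
  eX : e * X = X * e
  split : ∀ y, p * y = y → y * e = y → y * q = 0 → ∃ α β,
    α + β = y ∧ (p * α = α ∧ α * e = α ∧ α * q = 0 ∧ α * A = A * α) ∧
      (p * β = β ∧ β * e = β ∧ β * q = 0 ∧ β * X = X * β)

theorem RootPair.symm {c : F} {q p e A X : Matrix ι ι F} (h : RootPair c q p e A X) :
    RootPair c q p e X A where
  c_ne := h.c_ne
  AA := h.XX
  XX := h.AA
  Aq := by rw [h.Xq, h.Aq, h.qX]
  Xq := h.Xq.symm
  qX := h.qX.symm
  pp := h.pp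
  ee := h.ee
  add := h.add
  ep := h.ep
  pe := h.pe
  eq := h.eq
  qe := h.qe
  pq := h.pq
  qp := h.qp
  pA := h.pX
  pX := h.pA
  eA := h.eX
  eX := h.eA
  split y h1 h2 h3 := by
    obtain ⟨α, β, h0, ha, hb⟩ := h.split y h1 h2 h3
    exact ⟨β, α, by rw [add_comm, h0], hb, ha⟩

theorem isUnit_of_mul_left_injective [Finite F] (t : Matrix ι ι F)
    (h : ∀ z : Matrix ι ι F, t * z = 0 → z = 0) : ∃ u, t * u = 1 ∧ u * t = 1 := by
  have inj : Function.Injective (fun z : Matrix ι ι F => t * z) := by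
    intro a b hab
    have := h (a - b) (by simpa [Matrix.mul_sub, sub_eq_zero] using hab)
    exact sub_eq_zero.mp this
  obtain ⟨u, hu⟩ := (Finite.injective_iff_surjective.mp inj) 1
  exact ⟨u, hu, mul_eq_one_comm.mp hu⟩

theorem exists_rootPair [Finite F] (h2 : (2 : F) ≠ 0) {c : F} (hc : c ≠ 0) {q A X : Matrix ι ι F}
    (hq : q * q = q) (AA : A * A = c • 1) (XX : X * X = c • 1) (Aq : A * q = q * A)
    (Xq : X * q = A * q) (qX : q * X = q * A) :
    ∃ p e, RootPair c q p e A X ∧ ∃ t u, t * u = 1 ∧ u * t = 1 ∧ t * A = X * (e - p) * t ∧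
      t * (X * (e - p)) = A * t ∧ IsBlock q t ∧ t * p = p * t := by
  obtain ⟨s, hs⟩ : ∃ s, s = (A + X) * (A + X) := ⟨_, rfl⟩
  have sA : Commute s A := by
    show s * A = A * s
    linear_combination (norm := (rw [hs]; noncomm_ring)) X * AA - AA * X + XX * A - A * XX
  have sX : Commute s X := by
    show s * X = X * s
    linear_combination (norm := (rw [hs]; noncomm_ring)) AA * X + A * XX - X * AA - XX * A
  have sq' : s * q = (4 * c) • q := by
    have : (4 * c) • q = 4 * ((c • 1) * q) := by
      rw [smul_mul_assoc, one_mul, mul_smul, ← Nat.cast_ofNat, Nat.cast_smul_eq_nsmul, nsmul_eq_mul]; rfl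
    rw [this]
    linear_combination (norm := (rw [hs]; noncomm_ring))
      (A + X) * Xq + 2 * (A + X) * Aq + 2 * Xq * A - 4 * A * Aq + 4 * AA * q
  have qs' : q * s = (4 * c) • q := by
    have hXA : X * (A * q) = A * (A * q) := by
      linear_combination (norm := noncomm_ring) X * Aq + Xq * A - A * Aq
    rw [← sq', hs]
    simp only [mul_add, add_mul, mul_assoc,
        Aq.symm, Xq, qX, hXA, mul_mul_eq_of_mul_eq Aq.symm, mul_mul_eq_of_mul_eq qX]
  obtain ⟨k, hk, hkk⟩ := exists_pow_isIdempotent s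
  have skq : ∀ k, s ^ k * q = (4 * c) ^ k • q := by
    intro k
    induction k with
    | zero => simp
    | succ k ih => rw [pow_succ, mul_assoc, sq', mul_smul_comm, ih, smul_smul, pow_succ]; ring_nf
  have qsk : ∀ k, q * s ^ k = (4 * c) ^ k • q := by
    intro k
    induction k with
    | zero => simp
    | succ k ih => rw [pow_succ, ← mul_assoc, ih, smul_mul_assoc, qs', smul_smul, pow_succ]
  have h4 : (4 * c) ≠ 0 := by
    refine mul_ne_zero ?_ hc
    have : (4 : F) = 2 * 2 := by norm_num
    rw [this]; exact mul_ne_zero h2 h2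
  obtain ⟨e, he⟩ : ∃ e, e = s ^ k := ⟨_, rfl⟩
  rw [← he] at hkk
  have eq' : e * q = q := by
    have h1 : e * (e * q) = e * q := by rw [← mul_assoc, hkk]
    rw [he, skq, mul_smul_comm, skq, smul_smul] at h1
    rw [he, skq]
    have := congrArg (fun z => ((4 * c) ^ k)⁻¹ • z) h1
    simpa [smul_smul, h4] using this
  have qe' : q * e = q := by
    rw [he, qsk, ← skq, ← he]; exact eq'
  have eA : e * A = A * e := he ▸ (sA.pow_left k).eq
  have eX : e * X = X * e := he ▸ (sX.pow_left k).eq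
  refine ⟨1 - e, e, ?_, ?_⟩
  · refine ⟨hc, AA, XX, Aq, Xq, qX, ?_, hkk, ?_, ?_, ?_, eq', qe', ?_, ?_, ?_, ?_, eA, eX, ?_⟩
    · simp [mul_sub, sub_mul, hkk]
    · abel
    · simp [mul_sub, hkk]
    · simp [sub_mul, hkk]
    · simp [sub_mul, eq']
    · simp [mul_sub, qe']
    · simp [mul_sub, sub_mul, eA]
    · simp [mul_sub, sub_mul, eX]
    · let S : AddSubgroup (Matrix ι ι F) :=
        { carrier := {z | (1 - e) * z = z ∧ z * e = z ∧ z * q = 0}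
          add_mem' := by
            rintro a b ⟨ha, hb, hc⟩ ⟨ha', hb', hc'⟩
            exact ⟨by rw [mul_add, ha, ha'], by rw [add_mul, hb, hb'], by rw [add_mul, hc, hc', add_zero]⟩
          zero_mem' := by simp
          neg_mem' := by
            rintro a ⟨ha, hb, hc⟩
            exact ⟨by rw [mul_neg, ha], by rw [neg_mul, hb], by rw [neg_mul, hc, neg_zero]⟩ }
      have clA : ∀ z ∈ S, A * z + z * A ∈ S := by
        rintro z ⟨h1, h2, h3⟩
        refine ⟨?_, ?_, ?_⟩
        · linear_combination (norm := noncomm_ring) A * h1 + h1 * A - eA * z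
        · linear_combination (norm := noncomm_ring) A * h2 + h2 * A - z * eA
        · linear_combination (norm := noncomm_ring) A * h3 + h3 * A + z * Aq
      have clX : ∀ z ∈ S, X * z + z * X ∈ S := by
        rintro z ⟨h1, h2, h3⟩
        refine ⟨?_, ?_, ?_⟩
        · linear_combination (norm := noncomm_ring) X * h1 + h1 * X - eX * z
        · linear_combination (norm := noncomm_ring) X * h2 + h2 * X - z * eX
        · linear_combination (norm := noncomm_ring) X * h3 + h3 * A + z * Aq + z * Xq
      let f : S → S := fun z => ⟨(A * z + z * A) + (X * z + z * X), S.add_mem (clA z z.2) (clX z z.2)⟩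
      have finj : Function.Injective f := by
        intro a b hab
        have hab' : (A * a.1 + a * A) + (X * a + a * X) = (A * b.1 + b * A) + (X * b + b * X) :=
          congrArg Subtype.val hab
        have hz := (a - b).2
        set z : Matrix ι ι F := ((a - b : S) : Matrix ι ι F) with hzdef
        have hz1 : z = a.1 - b.1 := rfl
        have hanti : (A + X) * z = - (z * (A + X)) := by
          rw [hz1]; linear_combination (norm := noncomm_ring) hab'
        have hcomm : Commute s z := by
          show s * z = z * s
          rw [hs]
          linear_combination (norm := noncomm_ring) (A + X) * hanti - hanti * (A + X)
        have h1 : e * z = z * e := he ▸ (hcomm.pow_left k).eq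
        obtain ⟨hp, hez, -⟩ := hz
        have : z = 0 := by
          have : e * z = 0 := by
            linear_combination (norm := noncomm_ring) -hp
          rw [← hez, ← h1, this]
        apply Subtype.ext
        rw [hz1] at this
        exact sub_eq_zero.mp this
      intro y hy1 hy2 hy3
      obtain ⟨z, hz⟩ := (Finite.injective_iff_surjective.mp finj) ⟨y, hy1, hy2, hy3⟩
      have hz' : (A * z.1 + z * A) + (X * z + z * X) = y := congrArg Subtype.val hz
      refine ⟨A * z + z * A, X * z + z * X, hz', ?_, ?_⟩
      · obtain ⟨h1, h2, h3⟩ := clA z z.2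
        refine ⟨h1, h2, h3, ?_⟩
        linear_combination (norm := noncomm_ring) z.1 * AA - AA * z.1
      · obtain ⟨h1, h2, h3⟩ := clX z z.2
        refine ⟨h1, h2, h3, ?_⟩
        linear_combination (norm := noncomm_ring) z.1 * XX - XX * z.1
  · obtain ⟨t', ht'⟩ : ∃ t', t' = (A + X) * e + (A - X) * (1 - e) := ⟨_, rfl⟩
    have t'q : t' * q = q * t' := by
      rw [ht']
      simp only [mul_add, add_mul, mul_sub, sub_mul, mul_one, mul_assoc,
        eq', qe', Aq.symm, Xq, qX, mul_mul_eq_of_mul_eq Aq.symm, mul_mul_eq_of_mul_eq qX]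
    have hA' : t' * A = X * (e - (1 - e)) * t' := by
      rw [ht']
      simp only [smul_mul_assoc, mul_add, add_mul, mul_sub, sub_mul, mul_one, one_mul, mul_assoc,
        eA, eX, hkk, AA, XX, mul_mul_eq_of_mul_eq eA, mul_mul_eq_of_mul_eq eX, mul_mul_eq_of_mul_eq AA, mul_mul_eq_of_mul_eq XX]
      abel
    have hX' : t' * (X * (e - (1 - e))) = A * t' := by
      rw [ht']
      simp only [smul_mul_assoc, mul_add, add_mul, mul_sub, sub_mul, mul_one, one_mul, mul_assoc,
        eX, hkk, AA, XX, mul_mul_eq_of_mul_eq eX, mul_mul_eq_of_mul_eq AA, mul_mul_eq_of_mul_eq XX]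
      abel
    obtain ⟨u, hu, hu'⟩ := isUnit_of_mul_left_injective (t' * (1 - q) + q) (by
      intro z hz
      have hqz : q * z = 0 := by
        have : q * (t' * (1 - q) + q) = q := by
          linear_combination (norm := noncomm_ring) hq - t'q * (1 - q) - t' * hq
        rw [← this, mul_assoc, hz, mul_zero]
      have htz : t' * z = 0 := by
        linear_combination (norm := noncomm_ring) hz + t' * hqz - hqz
      have hez : e * z = 0 := by
        have h1 : e * (t' * z) = 0 := by rw [htz, mul_zero]
        have h2 : (A + X) * e * z = 0 := by
          rw [← h1, ht']
          simp only [mul_add, add_mul, mul_sub, sub_mul, mul_one, mul_assoc,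
        mul_mul_eq_of_mul_eq eA, mul_mul_eq_of_mul_eq eX, mul_mul_eq_of_mul_eq hkk]
          abel
        have h3 : s * (e * z) = 0 := by
          rw [hs]; linear_combination (norm := noncomm_ring) (A + X) * h2
        have h4 : e * (e * z) = 0 := by
          obtain ⟨l, rfl⟩ := Nat.exists_eq_add_of_le' hk
          nth_rw 1 [he]
          rw [pow_succ, mul_assoc, h3, mul_zero]
        rwa [← mul_assoc, hkk] at h4
      have hsz : s * z = (4 * c) • z := by
        have : (4 * c) • z = 4 * ((c • 1) * z) := by
          rw [smul_mul_assoc, one_mul, mul_smul, ← Nat.cast_ofNat, Nat.cast_smul_eq_nsmul, nsmul_eq_mul]; rfl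
        rw [this]
        have h1 : (A - X) * z = 0 := by
          rw [ht'] at htz
          linear_combination (norm := noncomm_ring) htz - 2 * X * hez
        linear_combination (norm := (rw [hs]; noncomm_ring)) 2 * AA * z + 2 * XX * z - (A - X) * h1
      have : ∀ k, s ^ k * z = (4 * c) ^ k • z := by
        intro k
        induction k with
        | zero => simp
        | succ k ih => rw [pow_succ, mul_assoc, hsz, mul_smul_comm, ih, smul_smul, pow_succ]; ring_nf
      have h0 := this k
      rw [← he, hez] at h0
      simpa [h4] using h0.symm)
    refine ⟨t' * (1 - q) + q, u, hu, hu', ?_, ?_, ⟨?_, ?_⟩, ?_⟩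
    · linear_combination (norm := noncomm_ring) hA' * (1 - q) + t' * Aq - 2 * X * eq' - Xq - Aq
    · have h1 : q * (X * (e - (1 - e))) = A * q := by
        linear_combination (norm := noncomm_ring) 2 * qX * e - qX + 2 * A * qe' - Aq - 2 * Aq * e + 2 * Aq
      have h2 : X * (e - (1 - e)) * q = A * q := by
        linear_combination (norm := noncomm_ring) 2 * X * eq' + Xq
      linear_combination (norm := noncomm_ring) hX' * (1 - q) - t' * h1 + t' * h2 + h1
    · linear_combination (norm := noncomm_ring) hq - t' * hq
    · linear_combination (norm := noncomm_ring) hq - t'q * (1 - q) - t' * hq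
    · have h1 : t' * e = e * t' := by
        rw [ht']
        simp only [mul_add, add_mul, mul_sub, sub_mul, mul_one, mul_assoc,
        eA, eX, hkk, mul_mul_eq_of_mul_eq eA, mul_mul_eq_of_mul_eq eX]
      linear_combination (norm := noncomm_ring) -h1 * (1 - q) - t' * eq' + eq' - qe' + t' * qe'

variable {c : F} {q p e A X : Matrix ι ι F}

theorem RootPair.isBlock_add (h : RootPair c q p e A X) {r : Matrix ι ι F}
    (h1 : p * r = r) (h2 : r * q = 0) : IsBlock q (e + r) :=
  ⟨by rw [add_mul, h.eq, h2, add_zero],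
    by rw [mul_add, h.qe, ← h1, ← mul_assoc, h.qp, zero_mul, add_zero]⟩

theorem RootPair.exists_unit_one_add (h : RootPair c q p e A X) {α : Matrix ι ι F}
    (h1 : p * α = α) (h2 : α * e = α) (h3 : α * q = 0) :
    ∃ a : (Matrix ι ι F)ˣ, (a : Matrix ι ι F) = 1 + α ∧ IsBlock q (a : Matrix ι ι F) := by
  have hsq : α * α = 0 := by
    rw [← h2, mul_assoc, ← h1, ← mul_assoc e, ← mul_assoc e, h.ep]; simp
  refine ⟨⟨1 + α, 1 - α, ?_, ?_⟩, rfl, ?_, ?_⟩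
  · linear_combination (norm := noncomm_ring) -hsq
  · linear_combination (norm := noncomm_ring) -hsq
  · show (1 + α) * q = q
    rw [add_mul, one_mul, h3, add_zero]
  · show q * (1 + α) = q
    rw [mul_add, mul_one, ← h1, ← mul_assoc, h.qp, zero_mul, add_zero]

variable [Fintype F] {ψ : AddChar F ℂ} {φ : Matrix ι ι F → ℂ}

/-- The partial Fourier transform of `φ` along the block below the idempotent `p`. -/
noncomputable def cornerSum (ψ : AddChar F ℂ) (φ : Matrix ι ι F → ℂ) (q p e w x : Matrix ι ι F) : ℂ :=
  ∑ r with (p * r = r ∧ r * q = 0), ψ (r * w).trace * φ ((e + r) * x)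

/-- A function on matrices supported on units, central on blocks, and with vanishing sums along
all groups of transvections with a fixed centre outside the block of `q`. -/
structure IsCuspidal (q : Matrix ι ι F) (φ : Matrix ι ι F → ℂ) : Prop where
  map_of_not_isUnit : ∀ x, ¬ IsUnit x → φ x = 0
  map_mul_comm : ∀ x y, IsBlock q x → IsBlock q y → φ (x * y) = φ (y * x)
  sum_eq_zero : ∀ v : ι → F, v ≠ 0 → q *ᵥ v = 0 → ∀ x, IsBlock q x →
    ∑ l with l ᵥ* q = 0, φ ((1 + vecMulVec v l) * x) = 0

theorem cornerSum_eq_zero (h : RootPair c q p e A X) (hφ : IsCuspidal q φ) {w x : Matrix ι ι F}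
    (h1 : p * w = w) (hw : ¬ IsUnit (e + w)) (hx : IsBlock q x) :
    cornerSum ψ φ q p e w x = 0 := by
  have hdet : (e + w).det = 0 := by
    by_contra hne
    exact hw ((Matrix.isUnit_iff_isUnit_det _).mpr (isUnit_iff_ne_zero.mpr hne))
  obtain ⟨v, hv, hv0⟩ := Matrix.exists_mulVec_eq_zero_iff.mpr hdet
  have hev : e *ᵥ v = 0 := by
    have : e *ᵥ ((e + w) *ᵥ v) = 0 := by rw [hv0, mulVec_zero]
    rw [mulVec_mulVec, mul_add, h.ee, ← h1, ← mul_assoc, h.ep, zero_mul, add_zero] at this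
    exact this
  have hwv : w *ᵥ v = 0 := by
    rw [add_mulVec, hev, zero_add] at hv0
    exact hv0
  have hpv : p *ᵥ v = v := by
    have : (e + p) *ᵥ v = v := by rw [h.add, one_mulVec]
    rwa [add_mulVec, hev, zero_add] at this
  have hqv : q *ᵥ v = 0 := by
    rw [← hpv, mulVec_mulVec, h.qp, zero_mulVec]
  have key : ∀ l : ι → F, l ᵥ* q = 0 →
      ∑ r with (p * r = r ∧ r * q = 0), ψ (r * w).trace *
        φ ((1 + vecMulVec v l) * ((e + r) * x)) =
      if IsUnit (1 + vecMulVec v l) then cornerSum ψ φ q p e w x else 0 := by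
    intro l hl
    split_ifs with hu
    · obtain ⟨k, hk⟩ := hu
      rw [← hk]
      have hpk : p * ((k : Matrix ι ι F) * e - e) = (k : Matrix ι ι F) * e - e := by
        rw [hk, add_mul, one_mul, add_sub_cancel_left, vecMulVec_mul, mul_vecMulVec, hpv]
      have hkp : p * ((k : Matrix ι ι F) * p - p) = (k : Matrix ι ι F) * p - p := by
        rw [hk, add_mul, one_mul, add_sub_cancel_left, vecMulVec_mul, mul_vecMulVec, hpv]
      have hkq : (k : Matrix ι ι F) * q = q := by
        rw [hk, add_mul, one_mul, vecMulVec_mul, hl, vecMulVec_zero, add_zero]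
      have hwk : w * (k : Matrix ι ι F) = w := by
        rw [hk, mul_add, mul_one, mul_vecMulVec, hwv, zero_vecMulVec, add_zero]
      have hki : (k : Matrix ι ι F) * (↑k⁻¹ : Matrix ι ι F) = 1 := k.mul_inv
      have hik : (↑k⁻¹ : Matrix ι ι F) * (k : Matrix ι ι F) = 1 := k.inv_mul
      have hkr : ∀ r, p * r = r → r * q = 0 →
          p * ((k : Matrix ι ι F) * (e + r) - e) = (k : Matrix ι ι F) * (e + r) - e ∧
          ((k : Matrix ι ι F) * (e + r) - e) * q = 0 := by
        intro r hr1 hr2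
        constructor
        · linear_combination (norm := noncomm_ring) hpk + hkp * r - p * k * hr1 + k * hr1 + p * hr1
        · linear_combination (norm := noncomm_ring) k * h.eq + k * hr2 + hkq - h.eq
      have inj : Set.InjOn (fun r => (k : Matrix ι ι F) * (e + r) - e)
          (Finset.univ.filter fun r : Matrix ι ι F => p * r = r ∧ r * q = 0) := by
        intro r _ r' _ hrr
        have h3 : (k : Matrix ι ι F) * (e + r) = k * (e + r') := sub_left_injective hrr
        have h4 := congrArg (fun z => (↑k⁻¹ : Matrix ι ι F) * z) h3
        simp only [← mul_assoc, hik, one_mul] at h4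
        exact add_left_cancel h4
      have himg : (Finset.univ.filter fun r : Matrix ι ι F => p * r = r ∧ r * q = 0).image
          (fun r => (k : Matrix ι ι F) * (e + r) - e) =
          Finset.univ.filter fun r : Matrix ι ι F => p * r = r ∧ r * q = 0 := by
        apply Finset.eq_of_subset_of_card_le
        · intro r' hr'
          obtain ⟨r, hr, rfl⟩ := Finset.mem_image.mp hr'
          obtain ⟨-, hr1, hr2⟩ := Finset.mem_filter.mp hr
          exact Finset.mem_filter.mpr ⟨Finset.mem_univ _, hkr r hr1 hr2⟩
        · rw [Finset.card_image_of_injOn inj]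
      rw [cornerSum]
      conv_rhs => rw [← himg, Finset.sum_image inj]
      refine Finset.sum_congr rfl fun r hr => ?_
      obtain ⟨-, hr1, hr2⟩ := Finset.mem_filter.mp hr
      have t1 : (((k : Matrix ι ι F) * (e + r) - e) * w).trace = (r * w).trace := by
        have hew : e * w = 0 := by rw [← h1, ← mul_assoc, h.ep, zero_mul]
        have : ((k : Matrix ι ι F) * (e + r) - e) * w = k * (r * w) := by
          linear_combination (norm := noncomm_ring) k * hew - hew
        rw [this, Matrix.trace_mul_comm, mul_assoc, hwk]
      rw [t1, add_sub_cancel, mul_assoc]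
    · apply Finset.sum_eq_zero
      intro r _
      rw [hφ.map_of_not_isUnit, mul_zero]
      intro hu'
      exact hu ((Matrix.isUnit_iff_isUnit_det _).mpr
        (isUnit_of_mul_isUnit_left (by simpa only [det_mul] using (Matrix.isUnit_iff_isUnit_det _).mp hu')))
  have hsum : ∑ l : ι → F with l ᵥ* q = 0, (if IsUnit (1 + vecMulVec v l) then
      cornerSum ψ φ q p e w x else 0) = 0 := by
    rw [← Finset.sum_congr rfl fun l hl => key l (Finset.mem_filter.mp hl).2, Finset.sum_comm]
    apply Finset.sum_eq_zero
    intro r hr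
    obtain ⟨-, hr1, hr2⟩ := Finset.mem_filter.mp hr
    rw [← Finset.mul_sum, hφ.sum_eq_zero v hv hqv _ ((h.isBlock_add hr1 hr2).mul hx), mul_zero]
  rw [← Finset.sum_filter, Finset.sum_const, nsmul_eq_mul, mul_eq_zero] at hsum
  refine hsum.resolve_left ?_
  refine Nat.cast_ne_zero.mpr (Finset.card_ne_zero.mpr ?_)
  exact ⟨0, by simp⟩

theorem RootPair.unit_facts (h : RootPair c q p e A X) {w g : Matrix ι ι F} (h1 : p * w = w)
    (h2 : w * p = w) (hg : (e + w) * g = 1) (hg' : g * (e + w) = 1) :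
    p * g = g * p ∧ IsBlock q g := by
  have hb : IsBlock q (e + w) :=
    h.isBlock_add h1 (by rw [← h2, mul_assoc, h.pq, mul_zero])
  refine ⟨?_, hb.inv hg hg'⟩
  have : p * (e + w) = (e + w) * p := by rw [mul_add, add_mul, h.pe, h.ep, h1, h2]
  calc p * g = g * (e + w) * p * g := by rw [hg', one_mul]
    _ = g * p * ((e + w) * g) := by rw [mul_assoc g, ← this]; noncomm_ring
    _ = g * p := by rw [hg, mul_one]

theorem cornerSum_eq_mul_left (h : RootPair c q p e A X) {w g x : Matrix ι ι F}
    (h1 : p * w = w) (h2 : w * p = w) (hg : (e + w) * g = 1) (hg' : g * (e + w) = 1) :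
    cornerSum ψ φ q p e w x = cornerSum ψ φ q p e p (g * x) := by
  obtain ⟨hpg, hb⟩ := h.unit_facts h1 h2 hg hg'
  have hwq : w * q = 0 := by rw [← h2, mul_assoc, h.pq, mul_zero]
  unfold cornerSum
  refine Finset.sum_filter_eq_of_inverse (fun r => r * (e + w)) (fun r => r * g) ?_ ?_ ?_ ?_ ?_
  rotate_right
  · rintro r ⟨hr1, hr2⟩
    have t1 : r * (e + w) * p = r * w := by rw [mul_assoc, add_mul, h.ep, zero_add, h2]
    have t2 : (e + r * (e + w)) * (g * x) = (e + r) * x := by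
      have hew : e * w = 0 := by rw [← h1, ← mul_assoc, h.ep, zero_mul]
      have : (e + r * (e + w)) = (e + r) * (e + w) := by
        linear_combination (norm := noncomm_ring) -h.ee - hew
      rw [this, ← mul_assoc, mul_assoc (e + r), hg, mul_one]
    rw [t1, t2]
  · rintro r ⟨hr1, hr2⟩
    exact ⟨by rw [← mul_assoc, hr1], by rw [mul_assoc, add_mul, h.eq, hwq, add_zero, hr2]⟩
  · rintro r ⟨hr1, hr2⟩
    exact ⟨by rw [← mul_assoc, hr1], by rw [mul_assoc, hb.1, hr2]⟩
  · rintro r -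
    rw [mul_assoc, hg, mul_one]
  · rintro r -
    rw [mul_assoc, hg', mul_one]

theorem cornerSum_eq_mul_right (h : RootPair c q p e A X) (hφ : IsCuspidal q φ)
    {w g x : Matrix ι ι F} (hx : IsBlock q x)
    (h1 : p * w = w) (h2 : w * p = w) (hg : (e + w) * g = 1) (hg' : g * (e + w) = 1) :
    cornerSum ψ φ q p e w x = cornerSum ψ φ q p e p (x * g) := by
  obtain ⟨hpg, hb⟩ := h.unit_facts h1 h2 hg hg'
  have hwq : w * q = 0 := by rw [← h2, mul_assoc, h.pq, mul_zero]
  have hpw : p * (e + w) = (e + w) * p := by rw [mul_add, add_mul, h.pe, h.ep, h1, h2]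
  unfold cornerSum
  refine Finset.sum_filter_eq_of_inverse (fun r => (e + w) * r) (fun r => g * r) ?_ ?_ ?_ ?_ ?_
  rotate_right
  · rintro r ⟨hr1, hr2⟩
    have her : e * r = 0 := by rw [← hr1, ← mul_assoc, h.ep, zero_mul]
    have hwe : w * e = 0 := by rw [← h2, mul_assoc, h.pe, mul_zero]
    have t1 : ((e + w) * r * p).trace = (r * w).trace := by
      rw [add_mul, her, zero_add, Matrix.trace_mul_comm, ← mul_assoc, h1, Matrix.trace_mul_comm]
    have t2 : g * (e + (e + w) * r) = e + r := by
      have : (e + (e + w) * r) = (e + w) * (e + r) := by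
        linear_combination (norm := noncomm_ring) -h.ee - hwe
      rw [this, ← mul_assoc, hg', one_mul]
    have hb1 := h.isBlock_add hr1 hr2
    have hb2 : IsBlock q (e + (e + w) * r) := h.isBlock_add
      (by rw [← mul_assoc, hpw, mul_assoc, hr1]) (by rw [mul_assoc, hr2, mul_zero])
    rw [t1, hφ.map_mul_comm _ _ hb1 hx, hφ.map_mul_comm _ _ hb2 (hx.mul hb), mul_assoc, t2]
  · rintro r ⟨hr1, hr2⟩
    exact ⟨by rw [← mul_assoc, hpw, mul_assoc, hr1], by rw [mul_assoc, hr2, mul_zero]⟩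
  · rintro r ⟨hr1, hr2⟩
    exact ⟨by rw [← mul_assoc, hpg, mul_assoc, hr1], by rw [mul_assoc, hr2, mul_zero]⟩
  · rintro r -
    rw [← mul_assoc, hg', one_mul]
  · rintro r -
    rw [← mul_assoc, hg, one_mul]

theorem RootPair.sum_addChar_trace (h : RootPair c q p e A X) (h2 : (2 : F) ≠ 0) (hψ : ψ ≠ 1)
    {r : Matrix ι ι F} (hr : p * r = r) :
    ∑ w with (p * w = w ∧ w * p = w ∧ w * X = -(X * w)), ψ (r * w).trace =
      if r * p * X = X * (r * p) then
        ((Finset.univ.filter fun w : Matrix ι ι F =>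
          p * w = w ∧ w * p = w ∧ w * X = -(X * w)).card : ℂ) else 0 := by
  split_ifs with hc
  · rw [Finset.card_eq_sum_ones, Nat.cast_sum]
    refine Finset.sum_congr rfl fun w hw => ?_
    obtain ⟨-, h1, -, h3⟩ := Finset.mem_filter.mp hw
    have t1 : (r * p * w * (X * X)).trace = -(r * p * w * (X * X)).trace := by
      have : r * p * w * (X * X) = -(X * (r * p * w * X)) := by
        linear_combination (norm := noncomm_ring) r * p * h3 * X - hc * w * X
      conv_lhs => rw [this, Matrix.trace_neg, Matrix.trace_mul_comm, mul_assoc]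
    rw [h.XX, mul_smul_comm, mul_one, Matrix.trace_smul, mul_assoc, h1] at t1
    have t2 : (2 * c) * (r * w).trace = 0 := by
      rw [smul_eq_mul] at t1
      linear_combination t1
    have : (r * w).trace = 0 := by
      simpa [h2, h.c_ne] using t2
    rw [this, AddChar.map_zero_eq_one, Nat.cast_one]
  · obtain ⟨w1, hw1, hw2, hw3, hne⟩ : ∃ w, p * w = w ∧ w * p = w ∧ w * X = -(X * w) ∧
        (r * w).trace ≠ 0 := by
      by_contra! hall
      apply hc
      have hzero : ∀ W : Matrix ι ι F, ((r * p - c⁻¹ • (X * (r * p) * X)) * W).trace = 0 := by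
        intro W
        have hinv : (c⁻¹ • (1 : Matrix ι ι F)) * (X * X) = 1 := by
          rw [h.XX, smul_mul_assoc, one_mul, smul_smul, inv_mul_cancel₀ h.c_ne, one_smul]
        have := hall (p * W * p - c⁻¹ • (X * (p * W * p) * X)) ?_ ?_ ?_
        · rw [mul_sub, Matrix.trace_sub, mul_smul_comm, Matrix.trace_smul] at this
          rw [sub_mul, Matrix.trace_sub, smul_mul_assoc, Matrix.trace_smul]
          have e1 : (r * (p * W * p)).trace = (r * p * W).trace := by
            have : r * (p * W * p) = (r * p * W) * p := by noncomm_ring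
            rw [this, Matrix.trace_mul_comm, ← mul_assoc, ← mul_assoc, hr]
          have e2 : (r * (X * (p * W * p) * X)).trace = (X * (r * p) * X * W).trace := by
            have : r * (X * (p * W * p) * X) = (r * p * X * W) * (X * p) := by
              linear_combination (norm := noncomm_ring) -(r * h.pX * W * p * X) + r * p * X * W * h.pX
            have e3 : p * (r * p * X * W) = r * p * X * W := by
              linear_combination (norm := noncomm_ring) hr * p * X * W
            rw [this, Matrix.trace_mul_comm, mul_assoc, e3]
            congr 1
            noncomm_ring
          rw [← e1, ← e2]
          exact this
        · have f1 : p * (p * W * p) = p * W * p := by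
            linear_combination (norm := noncomm_ring) h.pp * W * p
          have f2 : p * (X * (p * W * p) * X) = X * (p * W * p) * X := by
            linear_combination (norm := noncomm_ring) h.pX * p * W * p * X + X * h.pp * W * p * X
          rw [mul_sub, mul_smul_comm, f1, f2]
        · have f1 : p * W * p * p = p * W * p := by
            linear_combination (norm := noncomm_ring) p * W * h.pp
          have f2 : X * (p * W * p) * X * p = X * (p * W * p) * X := by
            linear_combination (norm := noncomm_ring)
              -(X * p * W * p * h.pX) + X * p * W * h.pp * X
          rw [sub_mul, smul_mul_assoc, f1, f2]
        · have e1 : c⁻¹ • (X * (p * W * p) * X) * X = X * (p * W * p) := by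
            rw [smul_mul_assoc, mul_assoc _ X X, h.XX, mul_smul_comm, mul_one, smul_smul,
              inv_mul_cancel₀ h.c_ne, one_smul]
          have e2 : X * c⁻¹ • (X * (p * W * p) * X) = p * W * p * X := by
            rw [mul_smul_comm, ← mul_assoc, ← mul_assoc, h.XX, smul_mul_assoc, smul_mul_assoc,
              one_mul, smul_smul, inv_mul_cancel₀ h.c_ne, one_smul]
          rw [sub_mul, mul_sub, e1, e2]
          abel
      have h0 : r * p - c⁻¹ • (X * (r * p) * X) = 0 := by
        rw [Matrix.ext_iff_trace_mul_right]
        intro W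
        rw [hzero, zero_mul, Matrix.trace_zero]
      rw [sub_eq_zero] at h0
      conv_lhs => rw [h0]
      rw [smul_mul_assoc, mul_assoc _ X X, h.XX, mul_smul_comm, mul_one, smul_smul,
        inv_mul_cancel₀ h.c_ne, one_smul]
    obtain ⟨b, hb⟩ : ∃ b, ψ b ≠ 1 := by
      by_contra! hall
      exact hψ (by ext b; simp [hall b])
    set w2 := (b / (r * w1).trace) • w1 with hw2def
    have htr : (r * w2).trace = b := by
      rw [hw2def, mul_smul_comm, Matrix.trace_smul, smul_eq_mul, div_mul_cancel₀ _ hne]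
    have k1 : p * w2 = w2 := by rw [hw2def, mul_smul_comm, hw1]
    have k2 : w2 * p = w2 := by rw [hw2def, smul_mul_assoc, hw2]
    have k3 : w2 * X = -(X * w2) := by rw [hw2def, smul_mul_assoc, mul_smul_comm, hw3, smul_neg]
    have hshift : ∑ w with (p * w = w ∧ w * p = w ∧ w * X = -(X * w)), ψ (r * w).trace * ψ b =
        ∑ w with (p * w = w ∧ w * p = w ∧ w * X = -(X * w)), ψ (r * w).trace := by
      refine Finset.sum_filter_eq_of_inverse (fun w => w + w2) (fun w => w - w2) ?_ ?_ ?_ ?_ ?_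
      · rintro w ⟨l1, l2, l3⟩
        exact ⟨by rw [mul_add, l1, k1], by rw [add_mul, l2, k2],
          by rw [add_mul, mul_add, l3, k3, neg_add]⟩
      · rintro w ⟨l1, l2, l3⟩
        refine ⟨by rw [mul_sub, l1, k1], by rw [sub_mul, l2, k2], ?_⟩
        rw [sub_mul, mul_sub, l3, k3]; abel
      · intro w _; simp
      · intro w _; simp
      · intro w _
        rw [mul_add, Matrix.trace_add, htr, AddChar.map_add_eq_mul]
    rw [← Finset.sum_mul] at hshift
    exact (mul_right_eq_self₀.mp hshift).resolve_left hb

theorem sum_mul_mul_eq (hφ : IsCuspidal q φ) (a b : (Matrix ι ι F)ˣ)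
    (ha : IsBlock q (a : Matrix ι ι F)) (hb : IsBlock q (b : Matrix ι ι F))
    (haA : (a : Matrix ι ι F) * A = A * a) (hbX : (b : Matrix ι ι F) * X = X * b) :
    ∑ u with (IsBlock q u ∧ u * A = X * u), φ (a * b * u) =
      ∑ u with (IsBlock q u ∧ u * A = X * u), φ u := by
  have hb' : IsBlock q (↑b⁻¹ : Matrix ι ι F) := hb.inv b.mul_inv b.inv_mul
  have ha' : IsBlock q (↑a⁻¹ : Matrix ι ι F) := ha.inv a.mul_inv a.inv_mul
  have haA' : (↑a⁻¹ : Matrix ι ι F) * A = A * (↑a⁻¹ : Matrix ι ι F) :=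
    (Commute.units_inv_left (show Commute (a : Matrix ι ι F) A from haA)).eq
  have hbX' : (↑b⁻¹ : Matrix ι ι F) * X = X * (↑b⁻¹ : Matrix ι ι F) :=
    (Commute.units_inv_left (show Commute (b : Matrix ι ι F) X from hbX)).eq
  refine Finset.sum_filter_eq_of_inverse (fun u => (b : Matrix ι ι F) * u * a)
    (fun u => (↑b⁻¹ : Matrix ι ι F) * u * (↑a⁻¹ : Matrix ι ι F)) ?_ ?_ ?_ ?_ ?_
  · rintro u ⟨h1, h2⟩
    refine ⟨(hb.mul h1).mul ha, ?_⟩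
    linear_combination (norm := noncomm_ring) b * u * haA + b * h2 * a + hbX * u * a
  · rintro u ⟨h1, h2⟩
    refine ⟨(hb'.mul h1).mul ha', ?_⟩
    linear_combination (norm := noncomm_ring) (↑b⁻¹ : Matrix ι ι F) * u * haA' +
      (↑b⁻¹ : Matrix ι ι F) * h2 * (↑a⁻¹ : Matrix ι ι F) + hbX' * u * (↑a⁻¹ : Matrix ι ι F)
  · rintro u -
    simp [mul_assoc]
  · rintro u -
    simp [mul_assoc]
  · rintro u ⟨h1, -⟩
    rw [mul_assoc, hφ.map_mul_comm _ _ ha (hb.mul h1)]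

theorem RootPair.sum_add_mul (h : RootPair c q p e A X) (hφ : IsCuspidal q φ) {r : Matrix ι ι F}
    (hr1 : p * r = r) (hr2 : r * q = 0) (hr3 : r * p * X = X * (r * p)) (hu : IsUnit (e + r)) :
    ∑ u with (IsBlock q u ∧ u * A = X * u), φ ((e + r) * u) =
        ∑ u with (IsBlock q u ∧ u * A = X * u), φ u ∧
      ∑ u with (IsBlock q u ∧ u * X = A * u), φ ((e + r) * u) =
        ∑ u with (IsBlock q u ∧ u * X = A * u), φ u := by
  have her : e * r = 0 := by rw [← hr1, ← mul_assoc, h.ep, zero_mul]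
  obtain ⟨y, hy⟩ : ∃ y, y = r * e := ⟨_, rfl⟩
  have hpy : p * y = y := by rw [hy, ← mul_assoc, hr1]
  have hye : y * e = y := by rw [hy, mul_assoc, h.ee]
  have hyq : y * q = 0 := by rw [hy, mul_assoc, h.eq, hr2]
  have hey : e * y = 0 := by rw [hy, ← mul_assoc, her, zero_mul]
  obtain ⟨y1, hy1, -⟩ := h.exists_unit_one_add hpy hye hyq
  have hm0 : (1 + y) * (e + r * p) = e + r := by
    have t1 : r * e + r * p = r := by rw [← mul_add, h.add, mul_one]
    have t2 : y * (r * p) = 0 := by rw [hy, mul_assoc, ← mul_assoc e, her, zero_mul, mul_zero]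
    linear_combination (norm := noncomm_ring) hye + t2 + hy + t1
  obtain ⟨er, her'⟩ := hu
  obtain ⟨m, hm⟩ : ∃ m : (Matrix ι ι F)ˣ, (m : Matrix ι ι F) = e + r * p := by
    refine ⟨y1⁻¹ * er, ?_⟩
    rw [Units.val_mul, her', ← hm0, ← hy1, ← mul_assoc, Units.inv_mul, one_mul]
  have hmb : IsBlock q (m : Matrix ι ι F) := by
    rw [hm]
    exact h.isBlock_add (by rw [← mul_assoc, hr1]) (by rw [mul_assoc, h.pq, mul_zero])
  have hmX : (m : Matrix ι ι F) * X = X * m := by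
    rw [hm, add_mul, mul_add, h.eX, hr3]
  have hpm : p * (m : Matrix ι ι F) = m * p := by
    rw [hm, mul_add, add_mul, h.pe, h.ep, ← mul_assoc, hr1, mul_assoc, h.pp]
  constructor
  · obtain ⟨α, β, hy0, ⟨a1, a2, a3, a4⟩, ⟨b1, b2, b3, b4⟩⟩ := h.split y hpy hye hyq
    obtain ⟨a, ha, hab⟩ := h.exists_unit_one_add a1 a2 a3
    obtain ⟨b, hb, hbb⟩ := h.exists_unit_one_add b1 b2 b3
    have hαβ : α * β = 0 := by
      rw [← a2, mul_assoc, ← b1, ← mul_assoc e, h.ep, zero_mul, mul_zero]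
    have heq : e + r = a * ((b * m : (Matrix ι ι F)ˣ) : Matrix ι ι F) := by
      rw [← hm0, ← hm, Units.val_mul, ha, hb, ← mul_assoc, ← hy0]
      linear_combination (norm := noncomm_ring) -hαβ * m
    rw [heq]
    refine sum_mul_mul_eq hφ a (b * m) hab (hbb.mul hmb) ?_ ?_
    · rw [ha]; linear_combination (norm := noncomm_ring) a4
    · rw [Units.val_mul, hb]
      linear_combination (norm := noncomm_ring) b4 * m + (1 + β) * hmX
  · have hpm' : p * (↑m⁻¹ : Matrix ι ι F) = (↑m⁻¹ : Matrix ι ι F) * p :=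
      (Commute.units_inv_right (show Commute p (m : Matrix ι ι F) from hpm)).eq
    obtain ⟨α, β, hy0, ⟨a1, a2, a3, a4⟩, ⟨b1, b2, b3, b4⟩⟩ :=
      h.split ((↑m⁻¹ : Matrix ι ι F) * y) (by rw [← mul_assoc, hpm', mul_assoc, hpy])
        (by rw [mul_assoc, hye]) (by rw [mul_assoc, hyq, mul_zero])
    obtain ⟨a, ha, hab⟩ := h.exists_unit_one_add a1 a2 a3
    obtain ⟨b, hb, hbb⟩ := h.exists_unit_one_add b1 b2 b3
    have hβα : β * α = 0 := by
      rw [← b2, mul_assoc, ← a1, ← mul_assoc e, h.ep, zero_mul, mul_zero]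
    have hmy : (m : Matrix ι ι F) * ((↑m⁻¹ : Matrix ι ι F) * y) = y := by
      rw [← mul_assoc, Units.mul_inv, one_mul]
    have heq : e + r = ((m * b : (Matrix ι ι F)ˣ) : Matrix ι ι F) * a := by
      have t2 : y * (r * p) = 0 := by rw [hy, mul_assoc, ← mul_assoc e, her, zero_mul, mul_zero]
      have : e + r = m + y := by
        rw [← hm0, hm]
        linear_combination (norm := noncomm_ring) hye + t2
      rw [this, Units.val_mul, ha, hb, ← hmy, ← hy0]
      linear_combination (norm := noncomm_ring) -m * hβα
    rw [heq]
    refine sum_mul_mul_eq hφ (m * b) a (hmb.mul hbb) hab ?_ ?_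
    · rw [Units.val_mul, hb]
      linear_combination (norm := noncomm_ring) hmX * (1 + β) + m * b4
    · rw [ha]; linear_combination (norm := noncomm_ring) a4

theorem card_filter_and_mul {κ : Type*} [Fintype κ] (R Q : κ → Prop) [DecidablePred R]
    [DecidablePred Q] (S : ℂ) :
    ((Finset.univ.filter fun r => R r ∧ Q r).card : ℂ) * S =
      ∑ r with R r, if Q r then S else 0 := by
  rw [← Finset.sum_filter, Finset.sum_const, nsmul_eq_mul, Finset.filter_filter]

theorem RootPair.sum_cornerSum (h : RootPair c q p e A X) (hφ : IsCuspidal q φ) (h2 : (2 : F) ≠ 0)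
    (hψ : ψ ≠ 1) {P : Matrix ι ι F → Prop} [DecidablePred P] {S : ℂ}
    (hS : ∀ r, p * r = r → r * q = 0 → r * p * X = X * (r * p) → IsUnit (e + r) →
      ∑ u with P u, φ ((e + r) * u) = S) :
    ∑ w with (p * w = w ∧ w * p = w ∧ w * X = -(X * w)), ∑ u with P u, cornerSum ψ φ q p e w u =
      ((Finset.univ.filter fun w : Matrix ι ι F =>
          p * w = w ∧ w * p = w ∧ w * X = -(X * w)).card : ℂ) *
        ((Finset.univ.filter fun r : Matrix ι ι F =>
          (p * r = r ∧ r * q = 0) ∧ r * p * X = X * (r * p) ∧ IsUnit (e + r)).card : ℂ) * S := by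
  have e1 : ∑ w with (p * w = w ∧ w * p = w ∧ w * X = -(X * w)), ∑ u with P u,
      cornerSum ψ φ q p e w u =
      ∑ r with (p * r = r ∧ r * q = 0),
        (∑ w with (p * w = w ∧ w * p = w ∧ w * X = -(X * w)), ψ (r * w).trace) *
          ∑ u with P u, φ ((e + r) * u) := by
    simp only [cornerSum]
    rw [Finset.sum_congr rfl fun w _ => Finset.sum_comm, Finset.sum_comm]
    refine Finset.sum_congr rfl fun r _ => ?_
    rw [Finset.sum_mul]
    refine Finset.sum_congr rfl fun w _ => ?_
    rw [Finset.mul_sum]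
  rw [e1, mul_assoc, card_filter_and_mul (fun r : Matrix ι ι F => p * r = r ∧ r * q = 0),
    Finset.mul_sum]
  refine Finset.sum_congr rfl fun r hr => ?_
  obtain ⟨-, hr1, hr2⟩ := Finset.mem_filter.mp hr
  rw [h.sum_addChar_trace h2 hψ hr1]
  by_cases hX : r * p * X = X * (r * p)
  · by_cases hu : IsUnit (e + r)
    · rw [if_pos hX, if_pos ⟨hX, hu⟩, hS r hr1 hr2 hX hu]
    · rw [if_neg (c := _ ∧ _) (fun hh => hu hh.2), mul_zero, Finset.sum_eq_zero, mul_zero]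
      intro u _
      apply hφ.map_of_not_isUnit
      intro hu'
      exact hu ((Matrix.isUnit_iff_isUnit_det _).mpr
        (isUnit_of_mul_isUnit_left (by simpa only [det_mul] using (Matrix.isUnit_iff_isUnit_det _).mp hu')))
  · rw [if_neg hX, if_neg (c := _ ∧ _) (fun hh => hX hh.1), zero_mul, mul_zero]

theorem RootPair.sum_cornerSum_of_unit (h : RootPair c q p e A X) (hφ : IsCuspidal q φ)
    {P : Matrix ι ι F → Prop} [DecidablePred P] (hP : ∀ u, P u → IsBlock q u) {S : ℂ}
    (hS : ∀ w g, p * w = w → w * p = w → w * X = -(X * w) → (e + w) * g = 1 → g * (e + w) = 1 →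
      ∑ u with P u, cornerSum ψ φ q p e w u = S) :
    ∑ w with (p * w = w ∧ w * p = w ∧ w * X = -(X * w)), ∑ u with P u, cornerSum ψ φ q p e w u =
      ((Finset.univ.filter fun w : Matrix ι ι F =>
          (p * w = w ∧ w * p = w ∧ w * X = -(X * w)) ∧ IsUnit (e + w)).card : ℂ) * S := by
  rw [card_filter_and_mul (fun w : Matrix ι ι F => p * w = w ∧ w * p = w ∧ w * X = -(X * w))]
  refine Finset.sum_congr rfl fun w hw => ?_
  obtain ⟨-, h1, h2, h3⟩ := Finset.mem_filter.mp hw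
  split_ifs with hu
  · obtain ⟨g, hg⟩ := hu
    exact hS w (↑g⁻¹ : Matrix ι ι F) h1 h2 h3 (by rw [← hg, Units.mul_inv]) (by rw [← hg, Units.inv_mul])
  · exact Finset.sum_eq_zero fun u hu' =>
      cornerSum_eq_zero h hφ h1 hu (hP u (Finset.mem_filter.mp hu').2)

theorem sum_block_intertwiner_eq (h2 : (2 : F) ≠ 0) (hc : c ≠ 0)
    (hq : q * q = q) (AA : A * A = c • 1) (XX : X * X = c • 1) (Aq : A * q = q * A)
    (Xq : X * q = A * q) (qX : q * X = q * A) (hφ : IsCuspidal q φ) :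
    ∑ u with (IsBlock q u ∧ u * A = X * u), φ u = ∑ u with (IsBlock q u ∧ u * X = A * u), φ u := by
  obtain ⟨ψ, hψ⟩ : ∃ ψ : AddChar F ℂ, ψ ≠ 1 := by
    refine ⟨AddChar.FiniteField.primitiveChar_to_Complex F, fun hh => ?_⟩
    have := AddChar.FiniteField.primitiveChar_to_Complex_isPrimitive F (one_ne_zero)
    apply this
    rw [hh]
    ext; simp
  obtain ⟨p, e, h, t, ti, htt, htt', htA, htX, hbt, htp⟩ :=
    exists_rootPair h2 hc hq AA XX Aq Xq qX
  have a1 := h.sum_cornerSum (ψ := ψ) hφ h2 hψ (P := fun u => IsBlock q u ∧ u * A = X * u)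
    fun r h1 h2 h3 h4 => (h.sum_add_mul hφ h1 h2 h3 h4).1
  have a2 := h.sum_cornerSum (ψ := ψ) hφ h2 hψ (P := fun u => IsBlock q u ∧ u * X = A * u)
    fun r h1 h2 h3 h4 => (h.sum_add_mul hφ h1 h2 h3 h4).2
  have facts : ∀ w g, p * w = w → w * p = w → w * X = -(X * w) → (e + w) * g = 1 → g * (e + w) = 1 →
      (e + w) * (X * (e - p)) = X * (e + w) ∧ X * (e - p) * (e + w) = (e + w) * X ∧
      g * X = X * (e - p) * g ∧ X * g = g * (X * (e - p)) ∧ IsBlock q (e + w) ∧ IsBlock q g := by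
    intro w g h1 h2 h3 h4 h5
    have hew : e * w = 0 := by rw [← h1, ← mul_assoc, h.ep, zero_mul]
    have hwe : w * e = 0 := by rw [← h2, mul_assoc, h.pe, mul_zero]
    have k1 : (e + w) * (X * (e - p)) = X * (e + w) := by
      linear_combination (norm := noncomm_ring) h.eX * e - h.eX * p + X * h.ee - X * h.ep + h3 * e - h3 * p - X * hwe + X * h2
    have k2 : X * (e - p) * (e + w) = (e + w) * X := by
      linear_combination (norm := noncomm_ring) X * h.ee - X * h.pe + X * hew - X * h1 - h.eX - h3
    refine ⟨k1, k2, ?_, ?_, h.isBlock_add h1 (by rw [← h2, mul_assoc, h.pq, mul_zero]), (h.unit_facts h1 h2 h4 h5).2⟩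
    · linear_combination (norm := noncomm_ring) -(g * X * h4) + h5 * (X * (e - p)) * g - g * k1 * g
    · linear_combination (norm := noncomm_ring) -(h5 * X * g) + g * (X * (e - p)) * h4 - g * k2 * g
  have b1 := h.sum_cornerSum_of_unit (ψ := ψ) hφ (P := fun u => IsBlock q u ∧ u * A = X * u)
    (fun u hu => hu.1) (S := ∑ u with (IsBlock q u ∧ u * A = X * (e - p) * u), cornerSum ψ φ q p e p u)
    (by
      intro w g h1 h2 h3 h4 h5
      obtain ⟨k1, k2, k3, k4, k5, k6⟩ := facts w g h1 h2 h3 h4 h5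
      refine Finset.sum_filter_eq_of_inverse (fun u => g * u) (fun u => (e + w) * u) ?_ ?_ ?_ ?_ ?_
      · rintro u ⟨hu, hu'⟩
        refine ⟨k6.mul hu, ?_⟩
        linear_combination (norm := noncomm_ring) g * hu' + k3 * u
      · rintro u ⟨hu, hu'⟩
        refine ⟨k5.mul hu, ?_⟩
        linear_combination (norm := noncomm_ring) (e + w) * hu' + k1 * u
      · intro u _
        rw [← mul_assoc, h4, one_mul]
      · intro u _
        rw [← mul_assoc, h5, one_mul]
      · intro u _
        exact cornerSum_eq_mul_left h h1 h2 h4 h5)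
  have b2 := h.sum_cornerSum_of_unit (ψ := ψ) hφ (P := fun u => IsBlock q u ∧ u * X = A * u)
    (fun u hu => hu.1) (S := ∑ u with (IsBlock q u ∧ u * (X * (e - p)) = A * u), cornerSum ψ φ q p e p u)
    (by
      intro w g h1 h2 h3 h4 h5
      obtain ⟨k1, k2, k3, k4, k5, k6⟩ := facts w g h1 h2 h3 h4 h5
      refine Finset.sum_filter_eq_of_inverse (fun u => u * g) (fun u => u * (e + w)) ?_ ?_ ?_ ?_ ?_
      · rintro u ⟨hu, hu'⟩
        refine ⟨hu.mul k6, ?_⟩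
        linear_combination (norm := noncomm_ring) hu' * g - u * k4
      · rintro u ⟨hu, hu'⟩
        refine ⟨hu.mul k5, ?_⟩
        linear_combination (norm := noncomm_ring) hu' * (e + w) - u * k2
      · intro u _
        rw [mul_assoc, h5, mul_one]
      · intro u _
        rw [mul_assoc, h4, mul_one]
      · intro u hu
        exact cornerSum_eq_mul_right h hφ hu.1 h1 h2 h4 h5)
  have hti : IsBlock q ti := hbt.inv htt htt'
  have hpti : p * ti = ti * p := by
    linear_combination (norm := noncomm_ring) ti * htp * ti - htt' * p * ti + ti * p * htt
  have hep : e = 1 - p := by rw [← h.add]; abel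
  have hcent : ∀ t ti : Matrix ι ι F, t * ti = 1 → ti * t = 1 → IsBlock q t → IsBlock q ti → t * p = p * t →
      p * ti = ti * p → ∀ u, IsBlock q u →
      cornerSum ψ φ q p e p u = cornerSum ψ φ q p e p (t * u * ti) := by
    intro t ti htt htt' hbt hti htp hpti u hu
    unfold cornerSum
    refine Finset.sum_filter_eq_of_inverse (fun r => t * r * ti) (fun r => ti * r * t) ?_ ?_ ?_ ?_ ?_
    · rintro r ⟨hr1, hr2⟩
      refine ⟨by rw [← mul_assoc, ← mul_assoc, ← htp, mul_assoc t, hr1], ?_⟩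
      rw [mul_assoc, hti.1, mul_assoc, hr2, mul_zero]
    · rintro r ⟨hr1, hr2⟩
      refine ⟨by rw [← mul_assoc, ← mul_assoc, hpti, mul_assoc ti, hr1], ?_⟩
      rw [mul_assoc, hbt.1, mul_assoc, hr2, mul_zero]
    · intro r _
      linear_combination (norm := noncomm_ring) htt' * r * ti * t + r * htt'
    · intro r _
      linear_combination (norm := noncomm_ring) htt * r * t * ti + r * htt
    · rintro r ⟨hr1, hr2⟩
      have t1 : (t * r * ti * p).trace = (r * p).trace := by
        have : t * r * ti * p = t * (r * p * ti) := by
          linear_combination (norm := noncomm_ring) -(t * r * hpti)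
        rw [this, Matrix.trace_mul_comm, mul_assoc, htt', mul_one]
      have t2 : (e + t * r * ti) * (t * u * ti) = t * ((e + r) * u * ti) := by
        rw [hep]
        linear_combination (norm := noncomm_ring) t * r * htt' * u * ti + htp * u * ti
      have hb := (h.isBlock_add hr1 hr2).mul hu
      rw [t1, t2, hφ.map_mul_comm _ _ hbt (hb.mul hti), mul_assoc, htt', mul_one]
  have hG : ∑ u with (IsBlock q u ∧ u * A = X * (e - p) * u), cornerSum ψ φ q p e p u =
      ∑ u with (IsBlock q u ∧ u * (X * (e - p)) = A * u), cornerSum ψ φ q p e p u := by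
    have k1 : A * ti = ti * (X * (e - p)) := by
      linear_combination (norm := noncomm_ring) ti * htA * ti - htt' * A * ti + ti * (X * (e - p)) * htt
    have k2 : X * (e - p) * ti = ti * A := by
      linear_combination (norm := noncomm_ring) ti * htX * ti - htt' * (X * (e - p)) * ti + ti * A * htt
    refine Finset.sum_filter_eq_of_inverse (fun u => t * u * ti) (fun u => ti * u * t) ?_ ?_ ?_ ?_ ?_
    · rintro u ⟨hu, hu'⟩
      refine ⟨(hbt.mul hu).mul hti, ?_⟩
      linear_combination (norm := noncomm_ring) t * hu' * ti - t * u * k1 + htX * u * ti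
    · rintro u ⟨hu, hu'⟩
      refine ⟨(hti.mul hu).mul hbt, ?_⟩
      linear_combination (norm := noncomm_ring) ti * hu' * t + ti * u * htA - k2 * u * t
    · intro r _
      linear_combination (norm := noncomm_ring) htt' * r * ti * t + r * htt'
    · intro r _
      linear_combination (norm := noncomm_ring) htt * r * t * ti + r * htt
    · rintro u ⟨hu, -⟩
      exact hcent t ti htt htt' hbt hti htp hpti u hu
  rw [b1, hG, ← b2, a2] at a1
  refine (mul_left_cancel₀ ?_ a1).symm
  refine mul_ne_zero ?_ ?_
  · exact Nat.cast_ne_zero.mpr (Finset.card_ne_zero.mpr ⟨0, by simp⟩)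
  · refine Nat.cast_ne_zero.mpr (Finset.card_ne_zero.mpr ⟨p, ?_⟩)
    simp only [Finset.mem_filter, Finset.mem_univ, true_and]
    refine ⟨⟨h.pp, h.pq⟩, by rw [h.pp, h.pX], ?_⟩
    rw [h.add]; exact isUnit_one

end block

/-- The invertible matrices fixing the rows selected by `p` and the columns selected by `q`. -/
def blockStab {ι F : Type*} [Fintype ι] [DecidableEq ι] [Field F] (p q : Matrix ι ι F) :
    Subgroup (Matrix ι ι F)ˣ where
  carrier := {g | p * (g : Matrix ι ι F) = p ∧ (g : Matrix ι ι F) * q = q}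
  mul_mem' := by
    rintro a b ⟨ha, ha'⟩ ⟨hb, hb'⟩
    exact ⟨by rw [Units.val_mul, ← mul_assoc, ha, hb], by rw [Units.val_mul, mul_assoc, hb', ha']⟩
  one_mem' := ⟨mul_one p, one_mul q⟩
  inv_mem' := by
    rintro a ⟨ha, ha'⟩
    exact ⟨by rw [Units.mul_inv_eq_iff_eq_mul, ha], by rw [Units.inv_mul_eq_iff_eq_mul, ha']⟩

section lead

variable {n : ℕ} {F : Type*} [Field F]

/-- The projection onto the first `j` coordinates. -/
def leadProj (n : ℕ) (F : Type*) [Field F] (j : ℕ) : Matrix (Fin n) (Fin n) F :=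
  diagonal fun i => if i.val < j then 1 else 0

/-- The projection onto the coordinate `j`. -/
def coordProj (n : ℕ) (F : Type*) [Field F] (j : ℕ) : Matrix (Fin n) (Fin n) F :=
  diagonal fun i => if i.val = j then 1 else 0

theorem leadProj_succ (j : ℕ) : leadProj n F (j + 1) = leadProj n F j + coordProj n F j := by
  rw [leadProj, leadProj, coordProj, diagonal_add]
  congr 1
  funext i
  split_ifs <;> first | omega | simp

theorem leadProj_mul_leadProj {i j : ℕ} (h : i ≤ j) :
    leadProj n F i * leadProj n F j = leadProj n F i ∧
      leadProj n F j * leadProj n F i = leadProj n F i := by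
  simp only [leadProj, diagonal_mul_diagonal]
  constructor <;> · congr 1; funext k; split_ifs <;> first | omega | simp

theorem leadProj_mul_self (j : ℕ) : leadProj n F j * leadProj n F j = leadProj n F j :=
  (leadProj_mul_leadProj le_rfl).1

theorem coordProj_mul_self (j : ℕ) : coordProj n F j * coordProj n F j = coordProj n F j := by
  simp only [coordProj, diagonal_mul_diagonal]
  congr 1; funext k; split_ifs <;> simp

theorem coordProj_mul_leadProj {i j : ℕ} (h : i < j) :
    coordProj n F i * leadProj n F j = coordProj n F i ∧
      leadProj n F j * coordProj n F i = coordProj n F i := by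
  simp only [leadProj, coordProj, diagonal_mul_diagonal]
  constructor <;> · congr 1; funext k; split_ifs <;> first | omega | simp

theorem coordProj_mul_leadProj_of_le {i j : ℕ} (h : j ≤ i) :
    coordProj n F i * leadProj n F j = 0 ∧ leadProj n F j * coordProj n F i = 0 := by
  simp only [leadProj, coordProj, diagonal_mul_diagonal]
  rw [← diagonal_zero]
  constructor <;> · congr 1; funext k; split_ifs <;> first | omega | simp

theorem leadProj_zero : leadProj n F 0 = 0 := by
  simp [leadProj]

theorem leadProj_of_le {j : ℕ} (h : n ≤ j) : leadProj n F j = 1 := by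
  rw [leadProj, ← diagonal_one]
  congr 1; funext k; rw [if_pos]; omega

theorem coordProj_mulVec_single (i : Fin n) :
    coordProj n F i.val *ᵥ Pi.single i 1 = Pi.single i 1 := by
  rw [coordProj, diagonal_mulVec_single]
  simp

/-- The copy of `GL_{n-j}` acting on the last coordinates. -/
def tailGL (n : ℕ) (F : Type*) [Field F] (j : ℕ) : Subgroup (GL (Fin n) F) :=
  blockStab (leadProj n F j) (leadProj n F j)

/-- The invertible matrices differing from `1` only in the row `j`, from the column `j` on. -/
def rowGroup (n : ℕ) (F : Type*) [Field F] (j : ℕ) : Subgroup (GL (Fin n) F) :=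
  blockStab (1 - coordProj n F j) (leadProj n F j)

theorem mem_tailGL {j : ℕ} {g : GL (Fin n) F} :
    g ∈ tailGL n F j ↔ leadProj n F j * (g : Matrix (Fin n) (Fin n) F) = leadProj n F j ∧
      (g : Matrix (Fin n) (Fin n) F) * leadProj n F j = leadProj n F j := Iff.rfl

theorem mem_rowGroup {j : ℕ} {g : GL (Fin n) F} :
    g ∈ rowGroup n F j ↔
      (1 - coordProj n F j) * (g : Matrix (Fin n) (Fin n) F) = 1 - coordProj n F j ∧
      (g : Matrix (Fin n) (Fin n) F) * leadProj n F j = leadProj n F j := Iff.rfl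

theorem isBlock_of_mem_tailGL {j : ℕ} {g : GL (Fin n) F} (h : g ∈ tailGL n F j) :
    IsBlock (leadProj n F j) (g : Matrix (Fin n) (Fin n) F) := ⟨h.2, h.1⟩

theorem tailGL_le {i j : ℕ} (h : i ≤ j) : tailGL n F j ≤ tailGL n F i := by
  rintro g ⟨h1, h2⟩
  obtain ⟨h3, h4⟩ := leadProj_mul_leadProj (n := n) (F := F) h
  constructor
  · rw [← h3, mul_assoc, h1]
  · rw [← h4, ← mul_assoc, h2]

theorem rowGroup_le_tailGL (j : ℕ) : rowGroup n F j ≤ tailGL n F j := by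
  rintro g ⟨h1, h2⟩
  have h3 := (coordProj_mul_leadProj_of_le (n := n) (F := F) (le_refl j)).2
  have h4 : leadProj n F j = leadProj n F j * (1 - coordProj n F j) := by
    rw [mul_sub, mul_one, h3, sub_zero]
  refine ⟨?_, h2⟩
  rw [h4, mul_assoc, h1]

theorem tailGL_mul_coordProj {i j : ℕ} (h : i < j) {g : GL (Fin n) F} (hg : g ∈ tailGL n F j) :
    (g : Matrix (Fin n) (Fin n) F) * coordProj n F i = coordProj n F i ∧
      coordProj n F i * (g : Matrix (Fin n) (Fin n) F) = coordProj n F i := by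
  obtain ⟨h1, h2⟩ := hg
  obtain ⟨h3, h4⟩ := coordProj_mul_leadProj (n := n) (F := F) h
  constructor
  · rw [← h4, ← mul_assoc, h2]
  · rw [← h3, mul_assoc, h1]

theorem conj_mem_rowGroup {i j : ℕ} (h : i < j) {g k : GL (Fin n) F} (hg : g ∈ tailGL n F j)
    (hk : k ∈ rowGroup n F i) : g * k * g⁻¹ ∈ rowGroup n F i := by
  obtain ⟨h1, h2⟩ := tailGL_mul_coordProj h hg
  obtain ⟨h3, h4⟩ := tailGL_mul_coordProj h (inv_mem hg)
  obtain ⟨-, h5⟩ := tailGL_le h.le hg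
  obtain ⟨-, h6⟩ := tailGL_le h.le (inv_mem hg)
  obtain ⟨h7, h8⟩ := hk
  have h9 : (g : Matrix (Fin n) (Fin n) F) * (↑g⁻¹ : Matrix (Fin n) (Fin n) F) = 1 := g.mul_inv
  constructor
  · rw [Units.val_mul, Units.val_mul]
    linear_combination (norm := noncomm_ring) (g : Matrix (Fin n) (Fin n) F) * h7 *
      (↑g⁻¹ : Matrix (Fin n) (Fin n) F) + (h1 - h2) * (k : Matrix (Fin n) (Fin n) F) *
      (↑g⁻¹ : Matrix (Fin n) (Fin n) F) - h1 * (↑g⁻¹ : Matrix (Fin n) (Fin n) F) - h4 + h9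
  · rw [Units.val_mul, Units.val_mul, mul_assoc, h6, mul_assoc, h8, h5]

theorem tailGL_zero : tailGL n F 0 = ⊤ := by
  rw [eq_top_iff]
  intro g _
  rw [mem_tailGL, leadProj_zero]
  simp

theorem tailGL_of_le {j : ℕ} (h : n ≤ j) {g : GL (Fin n) F} (hg : g ∈ tailGL n F j) : g = 1 := by
  have := hg.1
  rw [leadProj_of_le h, one_mul] at this
  exact Units.ext this

theorem exists_mul_of_mulVec {j : ℕ} {g : GL (Fin n) F} (hg : g ∈ tailGL n F j) {d : F}
    (hj : j < n)
    (hd : (g : Matrix (Fin n) (Fin n) F) * coordProj n F j = d • coordProj n F j) :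
    ∃ g' ∈ tailGL n F (j + 1), ∃ k ∈ rowGroup n F j, g = g' * k := by
  obtain ⟨h1, h2⟩ := hg
  obtain ⟨h3, h4⟩ := coordProj_mul_leadProj_of_le (n := n) (F := F) (le_refl j)
  have EE := coordProj_mul_self (n := n) (F := F) j
  generalize hE : coordProj n F j = E at *
  generalize hQ : leadProj n F j = Q at *
  obtain ⟨D, hD⟩ : ∃ D : Matrix (Fin n) (Fin n) F, D = d • 1 := ⟨_, rfl⟩
  have hd0 : d ≠ 0 := by
    rintro rfl
    rw [zero_smul] at hd
    have : (↑g⁻¹ : Matrix (Fin n) (Fin n) F) * ((g : Matrix (Fin n) (Fin n) F) * E) = 0 := by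
      rw [hd, mul_zero]
    rw [Units.inv_mul_cancel_left] at this
    have h5 := congrFun (congrFun this ⟨j, hj⟩) ⟨j, hj⟩
    rw [← hE] at h5
    simp [coordProj] at h5
  obtain ⟨D', hD'⟩ : ∃ D : Matrix (Fin n) (Fin n) F, D = d⁻¹ • 1 := ⟨_, rfl⟩
  have hDD : D * D' = 1 := by rw [hD, hD']; simp [smul_smul, hd0]
  have cD : ∀ x, D * x = x * D := by intro x; rw [hD]; simp
  have cD' : ∀ x, D' * x = x * D' := by intro x; rw [hD']; simp
  have hd' : (g : Matrix (Fin n) (Fin n) F) * E = D * E := by rw [hd, hD]; simp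
  obtain ⟨γ, hγ⟩ : ∃ γ, γ = (g : Matrix (Fin n) (Fin n) F) := ⟨_, rfl⟩
  rw [← hγ] at h1 h2 hd'
  have k1 : (1 + E * (γ - 1)) * (1 - D' * (E * (γ - 1))) = 1 := by
    rw [cD' (E * (γ - 1))]
    have e1 : E * γ * E = E * D := by rw [mul_assoc, hd', cD, ← mul_assoc, EE]
    have : D * γ * D' = γ := by rw [cD, mul_assoc, hDD, mul_one]
    linear_combination (norm := noncomm_ring) -(e1 * γ * D') + e1 * D' + EE * (γ - 1) * D' - E * this + E * hDD
  let k : GL (Fin n) F := ⟨_, _, k1, mul_eq_one_comm.mp k1⟩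
  have hk : (k : Matrix (Fin n) (Fin n) F) = 1 + E * (γ - 1) := rfl
  have hkE : (k : Matrix (Fin n) (Fin n) F) * E = D * E := by
    rw [hk]
    have : E * D = D * E := (cD E).symm
    linear_combination (norm := noncomm_ring) E * hd' - EE + this * E + D * EE
  have hEk : E * (k : Matrix (Fin n) (Fin n) F) = E * γ := by
    rw [hk]
    linear_combination (norm := noncomm_ring) EE * (γ - 1)
  have hkQ : (k : Matrix (Fin n) (Fin n) F) * Q = Q := by
    rw [hk]
    linear_combination (norm := noncomm_ring) E * h2
  have hQk : Q * (k : Matrix (Fin n) (Fin n) F) = Q := by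
    rw [hk]
    linear_combination (norm := noncomm_ring) h4 * (γ - 1)
  have hki : (k : Matrix (Fin n) (Fin n) F) * (↑k⁻¹ : Matrix (Fin n) (Fin n) F) = 1 := k.mul_inv
  have hik : (↑k⁻¹ : Matrix (Fin n) (Fin n) F) * (k : Matrix (Fin n) (Fin n) F) = 1 := k.inv_mul
  obtain ⟨κ, hκ⟩ : ∃ κ, κ = (↑k⁻¹ : Matrix (Fin n) (Fin n) F) := ⟨_, rfl⟩
  rw [← hκ] at hki hik
  refine ⟨g * k⁻¹, ?_, k, ?_, by group⟩
  · rw [mem_tailGL, leadProj_succ, hE, hQ, Units.val_mul, ← hκ, ← hγ]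
    constructor
    · linear_combination (norm := noncomm_ring) h1 * κ - hQk * κ + Q * hki - hEk * κ + E * hki
    · have e2 : κ * E = D' * E := by
        have : κ * k * E * D' = κ * (D * E) * D' := by rw [mul_assoc κ, hkE]
        rw [hik, one_mul, ← cD', mul_assoc, mul_assoc D, ← cD' E, ← mul_assoc D, hDD, one_mul] at this
        exact this.symm
      have e3 : κ * Q = Q := by
        linear_combination (norm := noncomm_ring) hik * Q - κ * hkQ
      have e4 : γ * D' * E = E := by
        rw [← cD', mul_assoc, hd', ← mul_assoc, cD', hDD, one_mul]
      linear_combination (norm := noncomm_ring) γ * e2 + e4 + γ * e3 + h2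
  · rw [mem_rowGroup, hE, hQ]
    refine ⟨?_, hkQ⟩
    rw [hk]
    linear_combination (norm := noncomm_ring) -(EE * (γ - 1))

theorem isUnit_one_add_vecMulVec_iff {ι : Type*} [Fintype ι] [DecidableEq ι] (w l : ι → F) :
    IsUnit (1 + vecMulVec w l) ↔ 1 + l ⬝ᵥ w ≠ 0 := by
  rw [Matrix.isUnit_iff_isUnit_det, vecMulVec_eq Unit, det_one_add_replicateCol_mul_replicateRow,
    isUnit_iff_ne_zero]

theorem coordProj_eq_vecMulVec (i : Fin n) :
    coordProj n F i.val = vecMulVec (Pi.single i 1) (Pi.single i 1) := by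
  ext a b
  simp only [coordProj, diagonal_apply, vecMulVec_apply, Pi.single_apply, Fin.ext_iff]
  split_ifs <;> simp_all

theorem mul_coordProj (M : Matrix (Fin n) (Fin n) F) (i : Fin n) :
    M * coordProj n F i.val = vecMulVec (M *ᵥ Pi.single i 1) (Pi.single i 1) := by
  rw [coordProj_eq_vecMulVec, mul_vecMulVec]

theorem mem_tailGL_iff {j : ℕ} {g : GL (Fin n) F} :
    g ∈ tailGL n F j ↔ ∀ i : Fin n, i.val < j →
      (g : Matrix (Fin n) (Fin n) F) *ᵥ Pi.single i 1 = Pi.single i 1 ∧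
      Pi.single i 1 ᵥ* (g : Matrix (Fin n) (Fin n) F) = Pi.single i 1 := by
  simp only [mulVec_single_one, single_one_vecMul]
  rw [mem_tailGL]
  constructor
  · rintro ⟨h1, h2⟩ i hi
    constructor
    · funext a
      have := congrFun (congrFun h2 a) i
      rw [leadProj, mul_diagonal, if_pos hi, mul_one, diagonal_apply] at this
      rw [col_apply, this, Pi.single_apply]
      split_ifs <;> simp_all
    · funext a
      have := congrFun (congrFun h1 i) a
      rw [leadProj, diagonal_mul, if_pos hi, one_mul, diagonal_apply] at this
      rw [row_apply, this, Pi.single_apply]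
      by_cases hh : i = a
      · simp [hh, hh ▸ hi]
      · simp [hh, Ne.symm hh]
  · intro h
    constructor
    · ext i a
      rw [leadProj, diagonal_mul, diagonal_apply]
      by_cases hi : i.val < j
      · have := congrFun (h i hi).2 a
        rw [row_apply, Pi.single_apply] at this
        rw [if_pos hi, this, one_mul]
        by_cases hh : i = a
        · simp [hh]
        · simp [hh, Ne.symm hh]
      · simp [hi]
    · ext a i
      rw [leadProj, mul_diagonal, diagonal_apply]
      by_cases hi : i.val < j
      · have := congrFun (h i hi).1 a
        rw [col_apply, Pi.single_apply] at this
        rw [if_pos hi, this, mul_one]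
        by_cases hh : a = i
        · simp [hh, hi]
        · simp [hh]
      · simp [hi]
        rintro rfl
        exact not_lt.mp hi

theorem exists_mulVec_single_eq (D : Set (Fin n)) {b : Fin n} (hb : b ∈ D) {v : Fin n → F}
    (hv : ∃ c ∈ D, v c ≠ 0) :
    ∃ y : GL (Fin n) F, (y : Matrix (Fin n) (Fin n) F) *ᵥ Pi.single b 1 = v ∧
      (∀ i ∉ D, (y : Matrix (Fin n) (Fin n) F) *ᵥ Pi.single i 1 = Pi.single i 1) ∧
      ∀ i, i ≠ b → v i = 0 → Pi.single i 1 ᵥ* (y : Matrix (Fin n) (Fin n) F) = Pi.single i 1 := by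
  obtain ⟨l, hl, hlv, hlD⟩ : ∃ l : Fin n → F, l b = 1 ∧ l ⬝ᵥ v ≠ 0 ∧ ∀ i ∉ D, l i = 0 := by
    by_cases hvb : v b = 0
    · obtain ⟨c, hc, hvc⟩ := hv
      have hcb : c ≠ b := fun h => hvc (h ▸ hvb)
      refine ⟨Pi.single b 1 + Pi.single c 1, by simp [hcb.symm], ?_, ?_⟩
      · rwa [add_dotProduct, single_one_dotProduct, single_one_dotProduct, hvb, zero_add]
      · intro i hi
        have h1 : i ≠ b := fun h => hi (h ▸ hb)
        have h2 : i ≠ c := fun h => hi (h ▸ hc)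
        simp [h1, h2]
    · refine ⟨Pi.single b 1, by simp, by rwa [single_one_dotProduct], ?_⟩
      intro i hi
      have h1 : i ≠ b := fun h => hi (h ▸ hb)
      simp [h1]
  obtain ⟨y, hy⟩ := (isUnit_one_add_vecMulVec_iff (v - Pi.single b 1) l).mpr (by
    rw [dotProduct_sub, dotProduct_single_one, hl]
    simpa using hlv)
  refine ⟨y, ?_, ?_, ?_⟩
  · rw [hy, add_mulVec, one_mulVec, vecMulVec_mulVec, dotProduct_single_one, hl]
    simp
  · intro i hi
    rw [hy, add_mulVec, one_mulVec, vecMulVec_mulVec, dotProduct_single_one, hlD i hi]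
    simp
  · intro i hi hvi
    rw [hy, vecMul_add, vecMul_one, vecMul_vecMulVec, single_one_dotProduct]
    simp [hvi, hi]

theorem leadProj_mulVec_eq_zero {j : ℕ} {v : Fin n → F} :
    leadProj n F j *ᵥ v = 0 ↔ ∀ i : Fin n, i.val < j → v i = 0 := by
  rw [funext_iff]
  refine forall_congr' fun i => ?_
  rw [leadProj, mulVec_diagonal]
  by_cases hi : i.val < j <;> simp [hi]

theorem exists_mem_tailGL_mulVec_eq {j : Fin n} {v : Fin n → F} (hv : v ≠ 0)
    (hj : leadProj n F j.val *ᵥ v = 0) :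
    ∃ g ∈ tailGL n F j.val, (g : Matrix (Fin n) (Fin n) F) *ᵥ Pi.single j 1 = v := by
  rw [leadProj_mulVec_eq_zero] at hj
  obtain ⟨y, h1, h2, h3⟩ := exists_mulVec_single_eq {i : Fin n | j.val ≤ i.val} (b := j) (le_refl j.val) (v := v) (by
    by_contra! hcon
    apply hv
    funext i
    by_cases hi : i.val < j.val
    · exact hj i hi
    · exact hcon i (not_lt.mp hi))
  refine ⟨y, mem_tailGL_iff.mpr fun i hi => ⟨h2 i (not_le.mpr hi), h3 i ?_ (hj i hi)⟩, h1⟩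
  rintro rfl
  exact lt_irrefl _ hi

theorem mul_coordProj_eq_or {j : Fin n} {g : GL (Fin n) F} (hg : g ∈ tailGL n F j.val) :
    (∃ d : F, (g : Matrix (Fin n) (Fin n) F) * coordProj n F j.val = d • coordProj n F j.val) ∨
      ∃ c : Fin n, j.val < c.val ∧ ((g : Matrix (Fin n) (Fin n) F) *ᵥ Pi.single j 1) c ≠ 0 := by
  by_contra! hcon
  obtain ⟨h1, h2⟩ := hcon
  apply h1 (((g : Matrix (Fin n) (Fin n) F) *ᵥ Pi.single j 1) j)
  rw [mul_coordProj, coordProj_eq_vecMulVec, ← smul_vecMulVec]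
  congr 1
  funext i
  rcases lt_trichotomy i.val j.val with h | h | h
  · have := (mem_tailGL_iff.mp hg i h).2
    rw [mulVec_single_one, col_apply, Pi.smul_apply, Pi.single_apply, if_neg (by rintro rfl; exact lt_irrefl _ h),
      smul_zero]
    rw [single_one_vecMul] at this
    have := congrFun this j
    rw [row_apply] at this
    rw [this, Pi.single_apply, if_neg (by rintro rfl; exact lt_irrefl _ h)]
  · obtain rfl := Fin.ext h
    simp
  · rw [h2 i h]
    rw [Pi.smul_apply, Pi.single_apply, if_neg (by rintro rfl; exact lt_irrefl _ h), smul_zero]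

theorem exists_adjacent_swap {j : ℕ} (hj : j + 1 < n) :
    ∃ s : GL (Fin n) F, s * s = 1 ∧ s ∈ tailGL n F j ∧ (∀ g ∈ tailGL n F (j + 2), s * g = g * s) ∧
      (∀ k ∈ rowGroup n F (j + 1), s * k * s ∈ rowGroup n F j) ∧
      ∀ g ∈ tailGL n F j,
        (¬ ∃ d : F, (g : Matrix (Fin n) (Fin n) F) * coordProj n F j = d • coordProj n F j) →
        ∃ k₁ ∈ rowGroup n F j, ∃ g₁ ∈ tailGL n F (j + 1), ∃ g₂ ∈ tailGL n F (j + 1),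
          ∃ k₂ ∈ rowGroup n F j, g = k₁ * g₁ * s * g₂ * k₂ := by
  obtain ⟨a, ha⟩ : ∃ a : Fin n, a.val = j := ⟨⟨j, by omega⟩, rfl⟩
  obtain ⟨b, hb⟩ : ∃ b : Fin n, b.val = j + 1 := ⟨⟨j + 1, hj⟩, rfl⟩
  have hab : a ≠ b := by rintro rfl; omega
  obtain ⟨d, hd⟩ : ∃ d : Fin n → F, d = Pi.single a 1 - Pi.single b 1 := ⟨_, rfl⟩
  have hdd : d ⬝ᵥ d = 2 := by
    rw [hd, sub_dotProduct, single_one_dotProduct, single_one_dotProduct]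
    simp [hab, hab.symm]
    norm_num
  have hss : (1 - vecMulVec d d) * (1 - vecMulVec d d) = 1 := by
    have : vecMulVec d d * vecMulVec d d = 2 * vecMulVec d d := by
      rw [vecMulVec_mul_vecMulVec, hdd, vecMulVec_smul]
      ext; simp [two_mul]
    linear_combination (norm := noncomm_ring) this
  let s : GL (Fin n) F := ⟨_, _, hss, hss⟩
  have hs : (s : Matrix (Fin n) (Fin n) F) = 1 - vecMulVec d d := rfl
  have s2 : s * s = 1 := Units.ext hss
  have sa : (s : Matrix (Fin n) (Fin n) F) *ᵥ Pi.single a 1 = Pi.single b 1 := by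
    rw [hs, sub_mulVec, one_mulVec, vecMulVec_mulVec, dotProduct_single_one, hd]
    simp [hab]
  have sb : (s : Matrix (Fin n) (Fin n) F) *ᵥ Pi.single b 1 = Pi.single a 1 := by
    rw [← sa, mulVec_mulVec, hs, hss, one_mulVec]
  have bs : Pi.single b 1 ᵥ* (s : Matrix (Fin n) (Fin n) F) = Pi.single a 1 := by
    rw [hs, vecMul_sub, vecMul_one, vecMul_vecMulVec, single_one_dotProduct, hd]
    simp [hab.symm]
  have hsj : s ∈ tailGL n F j := by
    rw [mem_tailGL_iff]
    intro i hi
    have h1 : i ≠ a := by rintro rfl; omega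
    have h2 : i ≠ b := by rintro rfl; omega
    rw [hs, sub_mulVec, one_mulVec, vecMulVec_mulVec, dotProduct_single_one, vecMul_sub,
      vecMul_one, vecMul_vecMulVec, single_one_dotProduct, hd]
    simp [h1, h2]
  refine ⟨s, s2, hsj, ?_, ?_, ?_⟩
  · intro g hg
    rw [mem_tailGL_iff] at hg
    obtain ⟨h1, h2⟩ := hg a (by omega)
    obtain ⟨h3, h4⟩ := hg b (by omega)
    apply Units.ext
    rw [Units.val_mul, Units.val_mul, hs, sub_mul, mul_sub, vecMulVec_mul, mul_vecMulVec, hd,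
      sub_vecMul, mulVec_sub, h1, h2, h3, h4, one_mul, mul_one]
  · rintro k ⟨h1, h2⟩
    have e1 : (s : Matrix (Fin n) (Fin n) F) * coordProj n F (j + 1) * (s : Matrix (Fin n) (Fin n) F) =
        coordProj n F j := by
      rw [← hb, ← ha, mul_coordProj, vecMulVec_mul, sb, bs, ← coordProj_eq_vecMulVec]
    have h3 : (k : Matrix (Fin n) (Fin n) F) * leadProj n F j = leadProj n F j := by
      rw [← (leadProj_mul_leadProj (Nat.le_succ j)).2, ← mul_assoc, h2]
    have h4 : (s : Matrix (Fin n) (Fin n) F) * (s : Matrix (Fin n) (Fin n) F) = 1 := hss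
    constructor
    · rw [← e1, Units.val_mul, Units.val_mul]
      generalize (s : Matrix (Fin n) (Fin n) F) = σ at *
      linear_combination (norm := noncomm_ring) σ * h1 * σ - σ * coordProj n F (j + 1) * h4 * k * σ + h4
    · rw [Units.val_mul, Units.val_mul, mul_assoc, hsj.2, mul_assoc, h3, hsj.2]
  · intro g hg hgd
    subst ha
    obtain ⟨c, hc, hgc⟩ := (mul_coordProj_eq_or hg).resolve_left hgd
    have hg0 : ∀ i : Fin n, i.val < a.val → ((g : Matrix (Fin n) (Fin n) F) *ᵥ Pi.single a 1) i = 0 := by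
      rw [← leadProj_mulVec_eq_zero, mulVec_mulVec, hg.1, leadProj_mulVec_eq_zero]
      intro i hi
      rw [Pi.single_apply, if_neg (by rintro rfl; exact lt_irrefl _ hi)]
    obtain ⟨y, y1, y2, y3⟩ := exists_mulVec_single_eq {i : Fin n | a.val < i.val} (b := b)
      (show a.val < b.val by omega) ⟨c, hc, hgc⟩
    have ya : (y : Matrix (Fin n) (Fin n) F) *ᵥ Pi.single a 1 = Pi.single a 1 := y2 a (lt_irrefl a.val)
    have hy : y ∈ tailGL n F a.val :=
      mem_tailGL_iff.mpr fun i hi => ⟨y2 i (by simp; omega), y3 i (by rintro rfl; omega) (hg0 i hi)⟩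
    have hz : s * y⁻¹ * g ∈ tailGL n F a.val := mul_mem (mul_mem hsj (inv_mem hy)) hg
    have za : ((s * y⁻¹ * g : GL (Fin n) F) : Matrix (Fin n) (Fin n) F) *ᵥ Pi.single a 1 = Pi.single a 1 := by
      rw [Units.val_mul, Units.val_mul, ← mulVec_mulVec, ← y1, mulVec_mulVec, mul_assoc, Units.inv_mul,
        mul_one, sb]
    obtain ⟨g₁, hg₁, k₁, hk₁, e1⟩ := exists_mul_of_mulVec hy (d := 1) a.isLt (by
      rw [mul_coordProj, ya, coordProj_eq_vecMulVec, one_smul])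
    obtain ⟨g₂, hg₂, k₂, hk₂, e2⟩ := exists_mul_of_mulVec hz (d := 1) a.isLt (by
      rw [mul_coordProj, za, coordProj_eq_vecMulVec, one_smul])
    refine ⟨_, conj_mem_rowGroup (Nat.lt_succ_self _) hg₁ hk₁, g₁, hg₁, g₂, hg₂, k₂, hk₂, ?_⟩
    have e3 : g₁ * k₁ * g₁⁻¹ * g₁ * s * g₂ * k₂ = y * s * (s * y⁻¹ * g) := by
      rw [e2, e1]; group
    rw [e3, mul_assoc, mul_assoc s, ← mul_assoc s s, s2, one_mul, mul_inv_cancel_left]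

theorem mem_rowGroup_iff {j : Fin n} {k : GL (Fin n) F} :
    k ∈ rowGroup n F j.val ↔ ∃ l : Fin n → F, l ᵥ* leadProj n F j.val = 0 ∧
      (k : Matrix (Fin n) (Fin n) F) = 1 + vecMulVec (Pi.single j 1) l := by
  constructor
  · rintro ⟨h1, h2⟩
    refine ⟨Pi.single j 1 ᵥ* ((k : Matrix (Fin n) (Fin n) F) - 1), ?_, ?_⟩
    · rw [vecMul_vecMul, sub_mul, h2, one_mul, sub_self, vecMul_zero]
    · rw [← vecMulVec_mul, ← coordProj_eq_vecMulVec]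
      linear_combination (norm := noncomm_ring) h1
  · rintro ⟨l, h1, h2⟩
    constructor
    · rw [h2, mul_add, mul_one, mul_vecMulVec, sub_mulVec, coordProj_mulVec_single, one_mulVec,
        sub_self, zero_vecMulVec, add_zero]
    · rw [h2, add_mul, one_mul, vecMulVec_mul, h1, vecMulVec_zero, add_zero]

/-- Identity rows from `j` on and upper triangular rows before. -/
structure IsUpper (j : ℕ) (r : Matrix (Fin n) (Fin n) F) : Prop where
  tail : (1 - leadProj n F j) * r = 1 - leadProj n F j
  lead : ∀ i < j, coordProj n F i * r * leadProj n F i = 0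

variable {V : Type*} [AddCommGroup V] [Module ℂ V]

/-- The vectors fixed by the row groups of index less than `j`. -/
def rowFixed (ρ : Representation ℂ (GL (Fin n) F) V) (j : ℕ) : Submodule ℂ V where
  carrier := {v | ∀ i < j, ∀ k ∈ rowGroup n F i, ρ k v = v}
  add_mem' := by
    intro a b ha hb i hi k hk
    rw [map_add, ha i hi k hk, hb i hi k hk]
  zero_mem' := by
    intro i _ k _
    rw [map_zero]
  smul_mem' := by
    intro z a ha i hi k hk
    rw [map_smul, ha i hi k hk]

theorem apply_mem_rowFixed {ρ : Representation ℂ (GL (Fin n) F) V} {j : ℕ} {g : GL (Fin n) F}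
    (hg : g ∈ tailGL n F j) {v : V} (hv : v ∈ rowFixed ρ j) : ρ g v ∈ rowFixed ρ j := by
  intro i hi k hk
  have h1 := conj_mem_rowGroup hi (inv_mem hg) hk
  have h2 : k * g = g * (g⁻¹ * k * g⁻¹⁻¹) := by group
  rw [← Module.End.mul_apply, ← map_mul, h2, map_mul, Module.End.mul_apply, hv i hi _ h1]

theorem IsUpper.apply_eq {ρ : Representation ℂ (GL (Fin n) F) V} {j : ℕ} {g : GL (Fin n) F}
    (hg : IsUpper j (g : Matrix (Fin n) (Fin n) F)) {v : V} (hv : v ∈ rowFixed ρ j) :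
    ρ g v = v := by
  induction j generalizing g with
  | zero =>
    have : g = 1 := by
      apply Units.ext
      simpa [leadProj_zero] using hg.tail
    rw [this, map_one, Module.End.one_apply]
  | succ j ih =>
    have h1 := hg.tail
    have h2 := hg.lead j (Nat.lt_succ_self j)
    have hlead := hg.lead
    obtain ⟨h3, h4⟩ := coordProj_mul_leadProj_of_le (n := n) (F := F) (le_refl j)
    have EE := coordProj_mul_self (n := n) (F := F) j
    have hi : ∀ i < j, coordProj n F i * coordProj n F j = 0 := by
      intro i hi
      rw [← (coordProj_mul_leadProj (n := n) (F := F) hi).1, mul_assoc, h4, mul_zero]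
    rw [leadProj_succ] at h1
    obtain ⟨γ, hγ⟩ : ∃ γ, γ = (g : Matrix (Fin n) (Fin n) F) := ⟨_, rfl⟩
    rw [← hγ] at h1 h2
    have hgi : γ * (↑g⁻¹ : Matrix (Fin n) (Fin n) F) = 1 := by rw [hγ, g.mul_inv]
    generalize hE : coordProj n F j = E at *
    generalize hQ : leadProj n F j = Q at *
    obtain ⟨r, hr⟩ : ∃ r, r = (1 - E) * γ + E := ⟨_, rfl⟩
    have hEr : E * r = E := by
      rw [hr]
      linear_combination (norm := noncomm_ring) EE - EE * γ
    have hQr : (1 - (Q + E)) * r = 1 - (Q + E) := by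
      rw [hr]
      linear_combination (norm := noncomm_ring) h1 - EE + EE * γ - h4 + h4 * γ
    have hkr : (1 + E * (γ - 1)) * r = γ := by
      have : E * γ * r = E * γ := by
        linear_combination (norm := noncomm_ring) E * γ * hEr + E * γ * hQr + h2 * r - h2
      linear_combination (norm := noncomm_ring) this - hEr + hr
    have hk1 : (1 + E * (γ - 1)) * (r * (↑g⁻¹ : Matrix (Fin n) (Fin n) F)) = 1 := by
      rw [← mul_assoc, hkr, hgi]
    let k : GL (Fin n) F := ⟨_, _, hk1, mul_eq_one_comm.mp hk1⟩
    have hk : (k : Matrix (Fin n) (Fin n) F) = 1 + E * (γ - 1) := rfl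
    have hkm : k ∈ rowGroup n F j := by
      rw [mem_rowGroup, hE, hQ, hk]
      constructor
      · linear_combination (norm := noncomm_ring) -(EE * (γ - 1))
      · linear_combination (norm := noncomm_ring) h2 - h3
    have hr' : ((k⁻¹ * g : GL (Fin n) F) : Matrix (Fin n) (Fin n) F) = r := by
      rw [Units.val_mul, Units.inv_mul_eq_iff_eq_mul, hk, hkr, hγ]
    have hfix : ρ (k⁻¹ * g) v = v := by
      apply ih
      · constructor
        · rw [hr', hQ]
          linear_combination (norm := noncomm_ring) hQr + hEr
        · intro i hij
          rw [hr', hr]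
          have := hlead i (by omega)
          rw [← hγ] at this
          linear_combination (norm := noncomm_ring) this - hi i hij * γ * leadProj n F i + hi i hij * leadProj n F i
      · intro i hij
        exact hv i (by omega)
    rw [← mul_inv_cancel_left k g, map_mul, Module.End.mul_apply, hfix]
    exact hv j (Nat.lt_succ_self j) k hkm

variable {c : F} {X : Matrix (Fin n) (Fin n) F}

theorem exists_isUpper_mul_commute_of_eq_zero (h2 : (2 : F) ≠ 0) (hc : c ≠ 0) (XX : X * X = c • 1)
    {j : ℕ} (hX : (1 - leadProj n F j) * X * leadProj n F j = 0) {h : GL (Fin n) F}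
    (hh : h ∈ tailGL n F j)
    (hA : (h : Matrix (Fin n) (Fin n) F) * (leadProj n F j * X * leadProj n F j +
        (1 - leadProj n F j) * X * (1 - leadProj n F j)) =
      (leadProj n F j * X * leadProj n F j +
        (1 - leadProj n F j) * X * (1 - leadProj n F j)) * (h : Matrix (Fin n) (Fin n) F)) :
    ∃ r : GL (Fin n) F, IsUpper j (r : Matrix (Fin n) (Fin n) F) ∧
      ((r * h : GL (Fin n) F) : Matrix (Fin n) (Fin n) F) * X =
        X * ((r * h : GL (Fin n) F) : Matrix (Fin n) (Fin n) F) := by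
  have QQ := leadProj_mul_self (n := n) (F := F) j
  have hE : ∀ i < j, coordProj n F i * leadProj n F i = 0 ∧
      leadProj n F j * leadProj n F i = leadProj n F i := fun i hi =>
    ⟨(coordProj_mul_leadProj_of_le le_rfl).1, (leadProj_mul_leadProj hi.le).2⟩
  obtain ⟨a1, a2⟩ := hh
  generalize hQ : leadProj n F j = Q at *
  obtain ⟨C, hC⟩ : ∃ D : Matrix (Fin n) (Fin n) F, D = c • 1 := ⟨_, rfl⟩
  obtain ⟨Z, hZ⟩ : ∃ D : Matrix (Fin n) (Fin n) F, D = (2 * c)⁻¹ • 1 := ⟨_, rfl⟩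
  have cC : ∀ x, C * x = x * C := by intro x; rw [hC]; simp
  have cZ : ∀ x, Z * x = x * Z := by intro x; rw [hZ]; simp
  have hCZ : 2 * C * Z = 1 := by
    have : (2 : Matrix (Fin n) (Fin n) F) = (2 : F) • 1 := by
      rw [two_smul]; norm_num
    rw [hC, hZ, this]
    simp only [smul_smul, mul_smul_comm, mul_one]
    rw [show (2 * c)⁻¹ * (c * 2) = 1 by field_simp, one_smul]
  rw [← hC] at XX
  obtain ⟨η, hη⟩ : ∃ η, η = (h : Matrix (Fin n) (Fin n) F) := ⟨_, rfl⟩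
  rw [← hη] at a1 a2 hA
  have hi1 : η * (↑h⁻¹ : Matrix (Fin n) (Fin n) F) = 1 := by rw [hη, h.mul_inv]
  have hi2 : (↑h⁻¹ : Matrix (Fin n) (Fin n) F) * η = 1 := by rw [hη, h.inv_mul]
  obtain ⟨η', hη'⟩ : ∃ η', η' = (↑h⁻¹ : Matrix (Fin n) (Fin n) F) := ⟨_, rfl⟩
  rw [← hη'] at hi1 hi2
  have a3 : η' * Q = Q := by linear_combination (norm := noncomm_ring) hi2 * Q - η' * a2
  obtain ⟨P, hP⟩ : ∃ P, P = Q * X * Q := ⟨_, rfl⟩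
  obtain ⟨N, hN⟩ : ∃ N, N = Q * X * (1 - Q) := ⟨_, rfl⟩
  obtain ⟨R, hR⟩ : ∃ R, R = (1 - Q) * X * (1 - Q) := ⟨_, rfl⟩
  rw [← hP, ← hR] at hA
  have hXs : X = P + N + R := by
    rw [hP, hN, hR]
    linear_combination (norm := noncomm_ring) hX
  have QP : Q * P = P := by rw [hP]; linear_combination (norm := noncomm_ring) QQ * X * Q
  have PQ : P * Q = P := by rw [hP]; linear_combination (norm := noncomm_ring) Q * X * QQ
  have QN : Q * N = N := by rw [hN]; linear_combination (norm := noncomm_ring) QQ * X * (1 - Q)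
  have NQ : N * Q = 0 := by rw [hN]; linear_combination (norm := noncomm_ring) -(Q * X * QQ)
  have QR : Q * R = 0 := by rw [hR]; linear_combination (norm := noncomm_ring) -(QQ * X * (1 - Q))
  have RQ : R * Q = 0 := by rw [hR]; linear_combination (norm := noncomm_ring) -((1 - Q) * X * QQ)
  have XX' : (P + N + R) * (P + N + R) = C := by rw [← hXs, XX]
  have hPR : P * R = 0 := by rw [← PQ, mul_assoc, QR, mul_zero]
  have hRP : R * P = 0 := by rw [← QP, ← mul_assoc, RQ, zero_mul]
  have hRN : R * N = 0 := by rw [← QN, ← mul_assoc, RQ, zero_mul]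
  have hNP : N * P = 0 := by rw [← QP, ← mul_assoc, NQ, zero_mul]
  have hNN : N * N = 0 := by nth_rewrite 2 [← QN]; rw [← mul_assoc, NQ, zero_mul]
  have hPP : P * P = C * Q := by
    linear_combination (norm := noncomm_ring) XX' * Q - P * NQ - P * RQ - N * PQ - hNP - N * NQ - N * RQ -
      R * PQ - hRP - R * NQ - R * RQ - P * PQ
  have hNR : N * R = -(P * N) := by
    have e1 : Q * C = C * Q := (cC Q).symm
    linear_combination (norm := noncomm_ring) Q * XX' - Q * XX' * Q
      - QP * (P + N + R) - QN * (P + N + R) - QR * (P + N + R) + QP * (P + N + R) * Q + QN * (P + N + R) * Q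
      + QR * (P + N + R) * Q - hPR - hNN + P * PQ + P * NQ + P * RQ + N * PQ + N * NQ + N * RQ + e1
      - e1 * Q - C * QQ
  have hηP : η * P = P := by rw [← QP, ← mul_assoc, a2]
  have hPη : P * η = P := by rw [← PQ, mul_assoc, a1]
  have hηN : η * N = N := by rw [← QN, ← mul_assoc, a2]
  have hηR : η * R = R * η := by
    linear_combination (norm := noncomm_ring) hA - hηP + hPη
  obtain ⟨b, hb⟩ : ∃ b, b = Z * (P * N * (1 - η)) := ⟨_, rfl⟩
  have Qb : Q * b = b := by
    rw [hb, ← mul_assoc, ← cZ, mul_assoc, ← mul_assoc Q, ← mul_assoc Q, QP]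
  have bQ : b * Q = 0 := by
    rw [hb]
    linear_combination (norm := noncomm_ring) -(Z * P * N * a2)
  have key : N + b * R = N * η + P * b := by
    have e1 : 2 * (P * b) = N * (1 - η) := by
      rw [hb]
      have : P * Z = Z * P := (cZ P).symm
      have e2 : Z * C = C * Z := cZ C
      linear_combination (norm := noncomm_ring) 2 * (this * P * N * (1 - η)) + 2 * (Z * hPP * N * (1 - η)) +
        2 * (Z * C * QN * (1 - η)) + 2 * (e2 * N * (1 - η)) + hCZ * N * (1 - η)
    have e3 : b * R = - (P * b) := by
      rw [hb]
      have : P * Z = Z * P := (cZ P).symm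
      linear_combination (norm := noncomm_ring) this * P * N * (1 - η) - Z * P * N * hηR + Z * P * hNR * (1 - η)
    linear_combination (norm := noncomm_ring) e3 - e1
  have bb : b * η' * (b * η') = 0 := by
    linear_combination (norm := noncomm_ring) -(b * η' * Qb * η') + b * a3 * b * η' + bQ * b * η'
  have hr : (1 + b * η') * (1 - b * η') = 1 := by
    linear_combination (norm := noncomm_ring) -bb
  have hr' : (1 - b * η') * (1 + b * η') = 1 := by
    linear_combination (norm := noncomm_ring) -bb
  refine ⟨⟨_, _, hr, hr'⟩, ⟨?_, ?_⟩, ?_⟩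
  · show (1 - leadProj n F j) * (1 + b * η') = _
    rw [hQ]
    linear_combination (norm := noncomm_ring) -(Qb * η')
  · intro i hi
    obtain ⟨e1, e2⟩ := hE i hi
    show coordProj n F i * (1 + b * η') * _ = 0
    linear_combination (norm := noncomm_ring) e1 - coordProj n F i * b * η' * e2 +
      coordProj n F i * b * a3 * leadProj n F i + coordProj n F i * bQ * leadProj n F i
  · rw [Units.val_mul, ← hη]
    show (1 + b * η') * η * X = X * ((1 + b * η') * η)
    have e1 : (1 + b * η') * η = η + b := by
      linear_combination (norm := noncomm_ring) b * hi2
    rw [e1, hXs]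
    have b1 : b * P = 0 := by rw [← QP, ← mul_assoc, bQ, zero_mul]
    have b2 : b * N = 0 := by rw [← QN, ← mul_assoc, bQ, zero_mul]
    have b3 : N * b = 0 := by rw [← Qb, ← mul_assoc, NQ, zero_mul]
    have b4 : R * b = 0 := by rw [← Qb, ← mul_assoc, RQ, zero_mul]
    linear_combination (norm := noncomm_ring) key + hηP - hPη + hηN + hηR + b1 + b2 - b3 - b4

theorem exists_isUpper_mul_commute_of_vecMulVec (XX : X * X = c • 1)
    {j : ℕ} {a : Fin n} (ha : a.val < j) (hX : (1 - leadProj n F j) * X * leadProj n F a.val = 0)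
    {l : Fin n → F} (hl : l ᵥ* leadProj n F j = 0) {k : GL (Fin n) F}
    (hk : (k : Matrix (Fin n) (Fin n) F) =
      1 + vecMulVec (((1 - leadProj n F j) * X) *ᵥ Pi.single a 1) l) :
    ∃ r : GL (Fin n) F, IsUpper j (r : Matrix (Fin n) (Fin n) F) ∧
      ((k * r : GL (Fin n) F) : Matrix (Fin n) (Fin n) F) * X =
        X * ((k * r : GL (Fin n) F) : Matrix (Fin n) (Fin n) F) := by
  have QQ := leadProj_mul_self (n := n) (F := F) j
  obtain ⟨h3, h4⟩ := coordProj_mul_leadProj (n := n) (F := F) ha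
  have hE : ∀ i < j, coordProj n F i * leadProj n F i = 0 ∧
      leadProj n F j * leadProj n F i = leadProj n F i ∧
      coordProj n F i * leadProj n F j = coordProj n F i := fun i hi =>
    ⟨(coordProj_mul_leadProj_of_le le_rfl).1, (leadProj_mul_leadProj hi.le).2,
      (coordProj_mul_leadProj hi).1⟩
  have hEE : ∀ i, i ≠ a.val → coordProj n F i * coordProj n F a.val = 0 := by
    intro i hi
    rw [coordProj, coordProj, diagonal_mul_diagonal, ← diagonal_zero]
    congr 1
    funext z
    split_ifs <;> first | omega | simp
  obtain ⟨m, hm⟩ : ∃ m : F, m = l ⬝ᵥ (X *ᵥ Pi.single a 1) := ⟨_, rfl⟩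
  obtain ⟨R, hR⟩ : ∃ R : Matrix (Fin n) (Fin n) F, R = vecMulVec (Pi.single a 1) l := ⟨_, rfl⟩
  have hm1 : 1 + m ≠ 0 := by
    have := (isUnit_one_add_vecMulVec_iff (((1 - leadProj n F j) * X) *ᵥ Pi.single a 1) l).mp
      (hk ▸ k.isUnit)
    rwa [← mulVec_mulVec, dotProduct_mulVec, vecMul_sub, vecMul_one, hl, sub_zero, ← hm] at this
  have hk' : (k : Matrix (Fin n) (Fin n) F) = 1 + (1 - leadProj n F j) * X * R := by
    rw [hk, hR, mul_vecMulVec]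
  have hla : l a = 0 := by
    have : l ᵥ* leadProj n F j ⬝ᵥ Pi.single a 1 = 0 := by rw [hl, zero_dotProduct]
    rwa [← dotProduct_mulVec, ← coordProj_mulVec_single, mulVec_mulVec, h4,
      coordProj_mulVec_single, dotProduct_single_one] at this
  have hRR : R * R = 0 := by
    rw [hR, vecMulVec_mul_vecMulVec, dotProduct_single_one, hla, zero_smul, vecMulVec_zero]
  have hRXR : R * X * R = m • R := by
    rw [hR, vecMulVec_mul, vecMulVec_mul_vecMulVec, ← dotProduct_mulVec, ← hm, vecMulVec_smul]
  have hRQ : R * leadProj n F j = 0 := by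
    rw [hR, vecMulVec_mul, hl, vecMulVec_zero]
  have hER : coordProj n F a.val * R = R := by
    rw [hR, mul_vecMulVec, coordProj_mulVec_single]
  have hQR : leadProj n F j * R = R := by
    rw [← hER, ← mul_assoc, h4]
  generalize hQ : leadProj n F j = Q at *
  obtain ⟨C, hC⟩ : ∃ D : Matrix (Fin n) (Fin n) F, D = c • 1 := ⟨_, rfl⟩
  obtain ⟨μ, hμ⟩ : ∃ D : Matrix (Fin n) (Fin n) F, D = m • 1 := ⟨_, rfl⟩
  obtain ⟨Z, hZ⟩ : ∃ D : Matrix (Fin n) (Fin n) F, D = (1 + m)⁻¹ • 1 := ⟨_, rfl⟩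
  have cC : ∀ x, C * x = x * C := by intro x; rw [hC]; simp
  have cμ : ∀ x, μ * x = x * μ := by intro x; rw [hμ]; simp
  have hZμ : (1 + μ) * Z = 1 := by
    rw [hμ, hZ, ← one_smul F (1 : Matrix (Fin n) (Fin n) F), smul_smul, mul_one, ← add_smul]
    simp [smul_smul, hm1]
  have cZ : ∀ x, Z * x = x * Z := by intro x; rw [hZ]; simp
  rw [← hC] at XX
  have hRXR' : R * X * R = μ * R := by rw [hRXR, hμ]; simp
  obtain ⟨κ, hκ⟩ : ∃ κ, κ = X * R + R * X := ⟨_, rfl⟩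
  have κκ : κ * κ = κ * μ := by
    have e1 : X * μ = μ * X := (cμ X).symm
    have e2 : R * C = C * R := (cC R).symm
    rw [← cμ κ, hκ]
    linear_combination (norm := noncomm_ring) X * hRXR' + e1 * R + X * hRR * X + R * XX * R + e2 * R +
      C * hRR + hRXR' * X
  have κX : κ * X = X * κ := by
    rw [hκ]
    have e2 : R * C = C * R := (cC R).symm
    linear_combination (norm := noncomm_ring) R * XX - XX * R + e2
  have hy : (1 + κ) * (1 - κ * Z) = 1 := by
    linear_combination (norm := noncomm_ring) -κκ * Z - κ * hZμ
  let y : GL (Fin n) F := ⟨_, _, hy, mul_eq_one_comm.mp hy⟩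
  have hyv : (y : Matrix (Fin n) (Fin n) F) = 1 + κ := rfl
  have hi2 : (↑k⁻¹ : Matrix (Fin n) (Fin n) F) * (k : Matrix (Fin n) (Fin n) F) = 1 := k.inv_mul
  have hi1 : (k : Matrix (Fin n) (Fin n) F) * (↑k⁻¹ : Matrix (Fin n) (Fin n) F) = 1 := k.mul_inv
  obtain ⟨k', hkk⟩ : ∃ k', k' = (↑k⁻¹ : Matrix (Fin n) (Fin n) F) := ⟨_, rfl⟩
  rw [← hkk, hk'] at hi1 hi2
  have kQ : k' * Q = Q := by
    linear_combination (norm := noncomm_ring) hi2 * Q - k' * (1 - Q) * X * hRQ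
  have Qk : Q * k' = Q := by
    linear_combination (norm := noncomm_ring) Q * hi1 + QQ * X * R * k'
  have hval : ((k⁻¹ * y : GL (Fin n) F) : Matrix (Fin n) (Fin n) F) = k' * (1 + κ) := by
    rw [Units.val_mul, ← hkk, hyv]
  refine ⟨k⁻¹ * y, ⟨?_, ?_⟩, ?_⟩
  · rw [hval, hQ]
    have e1 : (1 - Q) * (1 + κ) = (1 - Q) + (1 - Q) * X * R := by
      rw [hκ]
      linear_combination (norm := noncomm_ring) -(hQR * X)
    have e2 : k' * ((1 - Q) * X * R) = 1 - k' := by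
      linear_combination (norm := noncomm_ring) hi2
    linear_combination (norm := noncomm_ring) k' * e1 - Qk * (1 + κ) + kQ * (1 + κ) + e2 - kQ
  · intro i hi
    obtain ⟨e1, e2, e3⟩ := hE i hi
    rw [hval]
    have e4 : coordProj n F i * R * X * leadProj n F i = 0 := by
      by_cases hia : i = a.val
      · rw [hia]
        linear_combination (norm := noncomm_ring) coordProj n F a.val * R * hX +
          coordProj n F a.val * hRQ * X * leadProj n F a.val
      · rw [← hER, ← mul_assoc, hEE i hia]
        simp
    have e5 : coordProj n F i * k' = coordProj n F i := by
      rw [← e3, mul_assoc, Qk]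
    rw [hκ]
    linear_combination (norm := noncomm_ring) e5 * (1 + (X * R + R * X)) * leadProj n F i + e1 + e4 +
      coordProj n F i * X * (hRQ * leadProj n F i - R * e2)
  · rw [mul_inv_cancel_left, hyv]
    linear_combination (norm := noncomm_ring) κX

end lead

/-- Extension by zero of a function on units. -/
noncomputable def extendByZero {R : Type*} [Monoid R] (f : Rˣ → ℂ) (x : R) : ℂ :=
  if h : IsUnit x then f h.unit else 0

theorem extendByZero_coe {R : Type*} [Monoid R] (f : Rˣ → ℂ) (x : Rˣ) :
    extendByZero f (x : R) = f x := by
  rw [extendByZero, dif_pos x.isUnit]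
  congr 1
  exact Units.ext rfl

theorem extendByZero_of_not_isUnit {R : Type*} [Monoid R] (f : Rˣ → ℂ) {x : R} (h : ¬ IsUnit x) :
    extendByZero f x = 0 := dif_neg h

theorem sum_filter_units {R : Type*} [Monoid R] [Fintype R] [Fintype Rˣ] (P : R → Prop)
    [DecidablePred P] {f : R → ℂ} (hf : ∀ x, ¬ IsUnit x → f x = 0) :
    ∑ x with P x, f x = ∑ g ∈ Finset.univ.filter (fun g : Rˣ => P (g : R)), f (g : R) := by
  symm
  refine Finset.sum_of_injOn (fun g : Rˣ => (g : R)) (fun x _ y _ h => Units.ext h) ?_ ?_ ?_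
  · intro g hg
    simpa using hg
  · intro x hx hx'
    apply hf
    rintro ⟨g, rfl⟩
    exact hx' ⟨g, by simpa using hx, rfl⟩
  · intro g _
    rfl

section lead

variable {n : ℕ} {F : Type*} [Field F] [Fintype F]

/-- A class function on `tailGL n F j`, odd under inversion, with vanishing sums along the cosets
of the row group. -/
structure IsOddCuspidal (j : ℕ) (Φ : GL (Fin n) F → ℂ) : Prop where
  map_mul_comm : ∀ x ∈ tailGL n F j, ∀ y ∈ tailGL n F j, Φ (x * y) = Φ (y * x)
  map_inv : ∀ x ∈ tailGL n F j, Φ x⁻¹ = -Φ x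
  sum_eq_zero : ∀ x ∈ tailGL n F j, ∑ k with k ∈ rowGroup n F j, Φ (k * x) = 0

variable {j : ℕ} {Φ : GL (Fin n) F → ℂ}

theorem IsOddCuspidal.sum_vecMulVec_eq_zero (hΦ : IsOddCuspidal j Φ) {v : Fin n → F} (hv : v ≠ 0)
    (hjv : leadProj n F j *ᵥ v = 0) {x : GL (Fin n) F} (hx : x ∈ tailGL n F j) :
    ∑ k ∈ Finset.univ.filter (fun k : GL (Fin n) F => ∃ l : Fin n → F, l ᵥ* leadProj n F j = 0 ∧
      (k : Matrix (Fin n) (Fin n) F) = 1 + vecMulVec v l), Φ (k * x) = 0 := by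
  have hjn : j < n := by
    by_contra hjn
    rw [leadProj_of_le (not_lt.mp hjn), one_mulVec] at hjv
    exact hv hjv
  obtain ⟨a, rfl⟩ : ∃ a : Fin n, a.val = j := ⟨⟨j, hjn⟩, rfl⟩
  obtain ⟨g, hg, hgv⟩ := exists_mem_tailGL_mulVec_eq hv hjv
  rw [← hΦ.sum_eq_zero (g⁻¹ * x * g) (mul_mem (mul_mem (inv_mem hg) hx) hg)]
  have hg' := inv_mem hg
  refine Finset.sum_filter_eq_of_inverse (fun k => g⁻¹ * k * g) (fun k => g * k * g⁻¹) ?_ ?_ ?_ ?_ ?_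
  · rintro k ⟨l, hl, hk⟩
    rw [mem_rowGroup_iff]
    refine ⟨l ᵥ* (g : Matrix (Fin n) (Fin n) F), ?_, ?_⟩
    · rw [vecMul_vecMul, hg.2, hl]
    · rw [Units.val_mul, Units.val_mul, hk, mul_add, add_mul, mul_one, Units.inv_mul,
        mul_vecMulVec, vecMulVec_mul, ← hgv, mulVec_mulVec, Units.inv_mul, one_mulVec]
  · intro k hk
    obtain ⟨l, hl, hk⟩ := mem_rowGroup_iff.mp hk
    refine ⟨l ᵥ* (↑g⁻¹ : Matrix (Fin n) (Fin n) F), ?_, ?_⟩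
    · rw [vecMul_vecMul, hg'.2, hl]
    · rw [Units.val_mul, Units.val_mul, hk, mul_add, add_mul, mul_one, Units.mul_inv,
        mul_vecMulVec, vecMulVec_mul, hgv]
  · intro k _
    group
  · intro k _
    group
  · rintro k ⟨l, hl, hk⟩
    have hkm : k ∈ tailGL n F a.val := by
      constructor
      · rw [hk, mul_add, mul_one, mul_vecMulVec, hjv, zero_vecMulVec, add_zero]
      · rw [hk, add_mul, one_mul, vecMulVec_mul, hl, vecMulVec_zero, add_zero]
    have e1 : k * x = g * (g⁻¹ * k * x) := by group
    rw [e1, hΦ.map_mul_comm _ hg _ (mul_mem (mul_mem hg' hkm) hx)]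
    congr 1
    group

theorem IsOddCuspidal.isCuspidal (hΦ : IsOddCuspidal j Φ) :
    IsCuspidal (leadProj n F j) (extendByZero Φ) := by
  have nu : ∀ x y : Matrix (Fin n) (Fin n) F, ¬ (IsUnit x ∧ IsUnit y) → ¬ IsUnit (x * y) := by
    intro x y h hxy
    rw [Matrix.isUnit_iff_isUnit_det, det_mul, IsUnit.mul_iff] at hxy
    exact h ⟨(Matrix.isUnit_iff_isUnit_det _).mpr hxy.1, (Matrix.isUnit_iff_isUnit_det _).mpr hxy.2⟩
  refine ⟨fun x hx => extendByZero_of_not_isUnit _ hx, ?_, ?_⟩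
  · intro x y hx hy
    by_cases h : IsUnit x ∧ IsUnit y
    · obtain ⟨⟨a, rfl⟩, ⟨b, rfl⟩⟩ := h
      rw [← Units.val_mul, ← Units.val_mul, extendByZero_coe, extendByZero_coe]
      exact hΦ.map_mul_comm _ ⟨hx.2, hx.1⟩ _ ⟨hy.2, hy.1⟩
    · rw [extendByZero_of_not_isUnit _ (nu _ _ h),
        extendByZero_of_not_isUnit _ (nu _ _ fun hh => h hh.symm)]
  · intro v hv hjv x hx
    by_cases hxu : IsUnit x
    · obtain ⟨g, rfl⟩ := hxu
      have h1 := hΦ.sum_vecMulVec_eq_zero hv hjv (x := g) ⟨hx.2, hx.1⟩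
      rw [← h1]
      have h2 : ∑ k ∈ Finset.univ.filter (fun k : GL (Fin n) F => ∃ l : Fin n → F,
          l ᵥ* leadProj n F j = 0 ∧ (k : Matrix (Fin n) (Fin n) F) = 1 + vecMulVec v l), Φ (k * g) =
          ∑ M : Matrix (Fin n) (Fin n) F with (∃ l : Fin n → F, l ᵥ* leadProj n F j = 0 ∧
            M = 1 + vecMulVec v l), extendByZero Φ (M * g) := by
        refine Eq.trans ?_ (sum_filter_units (f := fun M : Matrix (Fin n) (Fin n) F =>
          extendByZero Φ (M * (g : Matrix (Fin n) (Fin n) F))) _ ?_).symm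
        · refine Finset.sum_congr rfl fun k _ => ?_
          rw [← Units.val_mul, extendByZero_coe]
        · intro M hM
          exact extendByZero_of_not_isUnit _ (nu _ _ fun hh => hM hh.1)
      rw [h2]
      obtain ⟨i, hi⟩ := Function.ne_iff.mp hv
      refine Finset.sum_nbij (fun l => 1 + vecMulVec v l) ?_ ?_ ?_ ?_
      · intro l hl
        simp only [Finset.mem_filter, Finset.mem_univ, true_and] at hl ⊢
        exact ⟨l, hl, rfl⟩
      · intro l _ l' _ hll
        have h3 := add_left_cancel hll
        funext z
        have h4 := congrFun (congrFun h3 i) z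
        rw [vecMulVec_apply, vecMulVec_apply] at h4
        exact mul_left_cancel₀ hi h4
      · intro M hM
        simp only [Finset.coe_filter, Finset.mem_univ, true_and, Set.mem_ofPred_eq] at hM
        obtain ⟨l, hl, rfl⟩ := hM
        exact ⟨l, by simpa using hl, rfl⟩
      · intro l _
        rfl
    · exact Finset.sum_eq_zero fun l _ => extendByZero_of_not_isUnit _ (nu _ _ fun hh => hxu hh.2)

theorem IsOddCuspidal.sum_commute_eq_zero (hΦ : IsOddCuspidal j Φ) (h2 : (2 : F) ≠ 0) {c : F}
    (hc : c ≠ 0) {A : Matrix (Fin n) (Fin n) F} (AA : A * A = c • 1)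
    (Aq : A * leadProj n F j = leadProj n F j * A) {g : GL (Fin n) F} (hg : g ∈ tailGL n F j) :
    ∑ h ∈ Finset.univ.filter (fun h : GL (Fin n) F => h ∈ tailGL n F j ∧
        (h : Matrix (Fin n) (Fin n) F) * A = A * h), Φ (h * g) = 0 := by
  have hg' := inv_mem hg
  obtain ⟨X, hX⟩ : ∃ X, X = (g : Matrix (Fin n) (Fin n) F) * A *
    (↑g⁻¹ : Matrix (Fin n) (Fin n) F) := ⟨_, rfl⟩
  have hXg : X * (g : Matrix (Fin n) (Fin n) F) = g * A := by
    rw [hX, mul_assoc, Units.inv_mul, mul_one]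
  have hgX : (↑g⁻¹ : Matrix (Fin n) (Fin n) F) * X = A * (↑g⁻¹ : Matrix (Fin n) (Fin n) F) := by
    rw [hX, mul_assoc, Units.inv_mul_cancel_left]
  have XX : X * X = c • 1 := by
    have : X * X = (g : Matrix (Fin n) (Fin n) F) * (A * A) * (↑g⁻¹ : Matrix (Fin n) (Fin n) F) := by
      nth_rewrite 1 [hX]
      rw [mul_assoc, hgX]
      simp only [mul_assoc]
    rw [this, AA]
    simp
  have key := sum_block_intertwiner_eq h2 hc (leadProj_mul_self j) AA XX Aq
    (by rw [hX, mul_assoc, hg'.2, mul_assoc, Aq, ← mul_assoc, hg.2])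
    (by rw [hX, ← mul_assoc, ← mul_assoc, hg.1, ← Aq, mul_assoc, hg'.1]) hΦ.isCuspidal
  rw [sum_filter_units _ fun x hx => extendByZero_of_not_isUnit _ hx,
    sum_filter_units _ fun x hx => extendByZero_of_not_isUnit _ hx] at key
  simp only [extendByZero_coe] at key
  have mem : ∀ {u : GL (Fin n) F}, IsBlock (leadProj n F j) (u : Matrix (Fin n) (Fin n) F) →
    u ∈ tailGL n F j := fun hu => ⟨hu.2, hu.1⟩
  have s1 : ∑ u ∈ Finset.univ.filter (fun u : GL (Fin n) F =>
      IsBlock (leadProj n F j) (u : Matrix (Fin n) (Fin n) F) ∧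
      (u : Matrix (Fin n) (Fin n) F) * A = X * u), Φ u =
      ∑ h ∈ Finset.univ.filter (fun h : GL (Fin n) F => h ∈ tailGL n F j ∧
        (h : Matrix (Fin n) (Fin n) F) * A = A * h), Φ (h * g) := by
    refine Finset.sum_filter_eq_of_inverse (fun u => g⁻¹ * u) (fun u => g * u) ?_ ?_ ?_ ?_ ?_
    · rintro u ⟨hu, hu'⟩
      refine ⟨mul_mem hg' (mem hu), ?_⟩
      rw [Units.val_mul, mul_assoc, hu', ← mul_assoc, hgX, mul_assoc]
    · rintro u ⟨hu, hu'⟩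
      refine ⟨isBlock_of_mem_tailGL (mul_mem hg hu), ?_⟩
      rw [Units.val_mul, mul_assoc, hu', ← mul_assoc, ← hXg, mul_assoc]
    · intro u _
      exact mul_inv_cancel_left g u
    · intro u _
      exact inv_mul_cancel_left g u
    · rintro u ⟨hu, -⟩
      rw [hΦ.map_mul_comm _ (mul_mem hg' (mem hu)) _ hg, mul_inv_cancel_left]
  have s2 : ∑ u ∈ Finset.univ.filter (fun u : GL (Fin n) F =>
      IsBlock (leadProj n F j) (u : Matrix (Fin n) (Fin n) F) ∧
      (u : Matrix (Fin n) (Fin n) F) * X = A * u), Φ u =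
      ∑ h ∈ Finset.univ.filter (fun h : GL (Fin n) F => h ∈ tailGL n F j ∧
        (h : Matrix (Fin n) (Fin n) F) * A = A * h), -Φ (h * g) := by
    refine Finset.sum_filter_eq_of_inverse (fun u => g⁻¹ * u⁻¹) (fun h => (g * h)⁻¹) ?_ ?_ ?_ ?_ ?_
    · rintro u ⟨hu, hu'⟩
      refine ⟨mul_mem hg' (inv_mem (mem hu)), ?_⟩
      have e1 : (↑u⁻¹ : Matrix (Fin n) (Fin n) F) * A = X * (↑u⁻¹ : Matrix (Fin n) (Fin n) F) := by
        rw [Units.inv_mul_eq_iff_eq_mul, ← mul_assoc, hu', mul_assoc, Units.mul_inv, mul_one]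
      rw [Units.val_mul, mul_assoc, e1, ← mul_assoc, hgX, mul_assoc]
    · rintro u ⟨hu, hu'⟩
      refine ⟨isBlock_of_mem_tailGL (inv_mem (mul_mem hg hu)), ?_⟩
      rw [Units.inv_mul_eq_iff_eq_mul, ← mul_assoc, Units.val_mul, mul_assoc (g : Matrix (Fin n) (Fin n) F), hu',
        ← mul_assoc, ← hXg, mul_assoc X, ← Units.val_mul, mul_assoc X, Units.mul_inv, mul_one]
    · intro u _
      group
    · intro u _
      group
    · rintro u ⟨hu, -⟩
      rw [hΦ.map_mul_comm _ (mul_mem hg' (inv_mem (mem hu))) _ hg, mul_inv_cancel_left,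
        hΦ.map_inv _ (mem hu), neg_neg]
  rw [s1, s2, Finset.sum_neg_distrib] at key
  exact self_eq_neg.mp key

end lead

section distinguished

variable {G V : Type*} [Group G] [AddCommGroup V] [Module ℂ V] {ρ : Representation ℂ G V}

theorem IsIrred.exists_dual [Finite G] (hρ : IsIrred ρ) {H : Subgroup G} {v : V} (hv : v ≠ 0)
    (hfix : ∀ h ∈ H, ρ h v = v) :
    ∃ ℓ : V →ₗ[ℂ] ℂ, (∀ h ∈ H, ∀ w, ℓ (ρ h w) = ℓ w) ∧ ∀ w, (∀ g, ℓ (ρ g w) = 0) → w = 0 := by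
  have := Fintype.ofFinite H
  obtain ⟨f, hf⟩ : ∃ f : V →ₗ[ℂ] ℂ, f v ≠ 0 := by
    by_contra! h
    exact hv ((Module.forall_dual_apply_eq_zero_iff ℂ v).mp h)
  obtain ⟨ℓ, hℓ⟩ : ∃ ℓ : V →ₗ[ℂ] ℂ, ℓ = ∑ h : H, f ∘ₗ ρ h := ⟨_, rfl⟩
  have happ : ∀ w, ℓ w = ∑ h : H, f (ρ h w) := by
    intro w
    rw [hℓ, LinearMap.sum_apply]
    rfl
  have hℓv : ℓ v ≠ 0 := by
    rw [happ, Finset.sum_congr rfl fun h _ => by rw [hfix h h.2], Finset.sum_const, nsmul_eq_mul]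
    exact mul_ne_zero (Nat.cast_ne_zero.mpr (Finset.card_pos.mpr Finset.univ_nonempty).ne') hf
  refine ⟨ℓ, ?_, ?_⟩
  · intro h hh w
    rw [happ, happ]
    refine Fintype.sum_equiv (Equiv.mulRight (⟨h, hh⟩ : H)) _ _ fun x => ?_
    rw [← Module.End.mul_apply, ← map_mul]
    rfl
  · let W : Submodule ℂ V :=
      { carrier := {w | ∀ g, ℓ (ρ g w) = 0}
        add_mem' := fun ha hb g => by rw [map_add, map_add, ha g, hb g, add_zero]
        zero_mem' := fun g => by rw [map_zero, map_zero]
        smul_mem' := fun z a ha g => by rw [map_smul, map_smul, ha g, smul_zero] }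
    rcases hρ.2 W (fun g w hw x => by
      rw [← Module.End.mul_apply, ← map_mul]
      exact hw (x * g)) with h | h
    · intro w hw
      have : w ∈ W := hw
      rwa [h, Submodule.mem_bot] at this
    · have : v ∈ W := h ▸ Submodule.mem_top
      have h1 := this 1
      rw [map_one, Module.End.one_apply] at h1
      exact absurd h1 hℓv

theorem sum_mul_eq_zero_of_translates [Fintype G] {M : Subgroup G} {Φ ψ : G → ℂ} {T : Finset G}
    (hT : T.Nonempty) (hTM : ∀ h ∈ T, h ∈ M) (hψ : ∀ h ∈ T, ∀ y ∈ M, ψ (h * y) = ψ y)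
    (hΦ : ∀ z ∈ M, ∑ h ∈ T, Φ (h * z) = 0) : ∑ y with y ∈ M, Φ y * ψ y = 0 := by
  have h1 : ∀ h ∈ T, ∑ y with y ∈ M, Φ y * ψ y = ∑ y with y ∈ M, Φ (h * y) * ψ y := by
    intro h hh
    refine Finset.sum_filter_eq_of_inverse (fun y => h⁻¹ * y) (fun y => h * y) ?_ ?_ ?_ ?_ ?_
    · exact fun y hy => mul_mem (inv_mem (hTM h hh)) hy
    · exact fun y hy => mul_mem (hTM h hh) hy
    · exact fun y _ => mul_inv_cancel_left h y
    · exact fun y _ => inv_mul_cancel_left h y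
    · intro y hy
      rw [mul_inv_cancel_left, ← hψ h hh _ (mul_mem (inv_mem (hTM h hh)) hy), mul_inv_cancel_left]
  have h2 : (T.card : ℂ) * ∑ y with y ∈ M, Φ y * ψ y = 0 := by
    rw [← nsmul_eq_mul, ← Finset.sum_const, Finset.sum_congr rfl h1, Finset.sum_comm]
    refine Finset.sum_eq_zero fun y hy => ?_
    rw [← Finset.sum_mul, hΦ y (Finset.mem_filter.mp hy).2, zero_mul]
  exact (mul_eq_zero.mp h2).resolve_left (Nat.cast_ne_zero.mpr (Finset.card_pos.mpr hT).ne')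

end distinguished

section lead

variable {n : ℕ} {F : Type*} [Field F] [Fintype F] {V : Type*} [AddCommGroup V] [Module ℂ V]
  {ρ : Representation ℂ (GL (Fin n) F) V}

theorem IsOddCuspidal.sum_mul_apply_eq_zero {j : ℕ} {Φ : GL (Fin n) F → ℂ}
    (hΦ : IsOddCuspidal j Φ) (h2 : (2 : F) ≠ 0) {c : F} (hc : c ≠ 0)
    {X : Matrix (Fin n) (Fin n) F} (XX : X * X = c • 1) {ℓ : V →ₗ[ℂ] ℂ}
    (hℓ : ∀ h : GL (Fin n) F, (h : Matrix (Fin n) (Fin n) F) * X = X * h →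
      ∀ w, ℓ (ρ h w) = ℓ w) {u : V} (hu : u ∈ rowFixed ρ j) :
    ∑ y with y ∈ tailGL n F j, Φ y * ℓ (ρ y u) = 0 := by
  have QQ := leadProj_mul_self (n := n) (F := F) j
  by_cases hX : (1 - leadProj n F j) * X * leadProj n F j = 0
  · obtain ⟨A, hA⟩ : ∃ A, A = leadProj n F j * X * leadProj n F j +
        (1 - leadProj n F j) * X * (1 - leadProj n F j) := ⟨_, rfl⟩
    have AQ : A * leadProj n F j = leadProj n F j * A := by
      rw [hA]
      linear_combination (norm := noncomm_ring) leadProj n F j * X * QQ - QQ * X * leadProj n F j -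
        (1 - leadProj n F j) * X * QQ + QQ * X * (1 - leadProj n F j)
    have AA : A * A = c • 1 := by
      obtain ⟨C, hC⟩ : ∃ C : Matrix (Fin n) (Fin n) F, C = c • 1 := ⟨_, rfl⟩
      have hCQ : C * leadProj n F j = leadProj n F j * C := by
        rw [hC]
        simp
      rw [← hC] at XX ⊢
      rw [hA]
      generalize leadProj n F j = Q at *
      linear_combination (norm := noncomm_ring) Q * X * QQ * X * Q - Q * X * QQ * X * (1 - Q) -
        (1 - Q) * X * QQ * X * Q + (1 - Q) * X * QQ * X * (1 - Q) -
        Q * X * hX - hX * X * (1 - Q) + Q * XX * Q + (1 - Q) * XX * (1 - Q) -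
        2 * hCQ * Q + hCQ + 2 * C * QQ
    refine sum_mul_eq_zero_of_translates
      (T := Finset.univ.filter fun h : GL (Fin n) F => h ∈ tailGL n F j ∧
        (h : Matrix (Fin n) (Fin n) F) * A = A * h) ⟨1, ?_⟩ ?_ ?_ ?_
    · simp [one_mem]
    · exact fun h hh => (Finset.mem_filter.mp hh).2.1
    · intro h hh y hy
      obtain ⟨-, hh, hh'⟩ := Finset.mem_filter.mp hh
      rw [hA] at hh'
      obtain ⟨r, hr, hrX⟩ := exists_isUpper_mul_commute_of_eq_zero h2 hc XX hX hh hh'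
      have hy' := apply_mem_rowFixed (mul_mem hh hy) hu
      rw [← hr.apply_eq hy', ← Module.End.mul_apply, ← map_mul, ← mul_assoc, map_mul,
        Module.End.mul_apply, hℓ _ hrX]
    · exact fun z hz => hΦ.sum_commute_eq_zero h2 hc AA AQ hz
  · have hex : ∃ m, (1 - leadProj n F j) * X * leadProj n F m ≠ 0 := ⟨j, hX⟩
    obtain ⟨m, hm, hmin⟩ : ∃ m, (1 - leadProj n F j) * X * leadProj n F m ≠ 0 ∧
        ∀ i < m, (1 - leadProj n F j) * X * leadProj n F i = 0 :=
      ⟨Nat.find hex, Nat.find_spec hex, fun i hi => not_not.mp (Nat.find_min hex hi)⟩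
    have hmj : m ≤ j := by
      by_contra h
      exact hX (hmin j (not_le.mp h))
    obtain ⟨a, rfl⟩ : ∃ a, m = a + 1 := by
      refine Nat.exists_eq_succ_of_ne_zero ?_
      rintro rfl
      rw [leadProj_zero, mul_zero] at hm
      exact hm rfl
    have ha := hmin a (Nat.lt_succ_self a)
    have han : a < n := by
      by_contra h
      rw [leadProj_of_le (j := j) (by omega), sub_self, zero_mul, zero_mul] at hm
      exact hm rfl
    obtain ⟨a, rfl⟩ : ∃ b : Fin n, b.val = a := ⟨⟨a, han⟩, rfl⟩
    rw [leadProj_succ, mul_add, ha, zero_add, mul_coordProj] at hm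
    obtain ⟨e, he⟩ : ∃ e, e = ((1 - leadProj n F j) * X) *ᵥ Pi.single a 1 := ⟨_, rfl⟩
    rw [← he] at hm
    have he0 : e ≠ 0 := by
      rintro rfl
      exact hm (zero_vecMulVec _)
    have hQe : leadProj n F j *ᵥ e = 0 := by
      rw [he, mulVec_mulVec, ← mul_assoc, mul_sub, mul_one, QQ, sub_self, zero_mul, zero_mulVec]
    have mem : ∀ {k : GL (Fin n) F}, k ∈ Finset.univ.filter (fun k : GL (Fin n) F =>
        ∃ l : Fin n → F, l ᵥ* leadProj n F j = 0 ∧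
        (k : Matrix (Fin n) (Fin n) F) = 1 + vecMulVec e l) → k ∈ tailGL n F j := by
      intro k hk
      obtain ⟨-, l, hl, hk⟩ := Finset.mem_filter.mp hk
      constructor
      · rw [hk, mul_add, mul_one, mul_vecMulVec, hQe, zero_vecMulVec, add_zero]
      · rw [hk, add_mul, one_mul, vecMulVec_mul, hl, vecMulVec_zero, add_zero]
    refine sum_mul_eq_zero_of_translates
      (T := Finset.univ.filter fun k : GL (Fin n) F => ∃ l : Fin n → F, l ᵥ* leadProj n F j = 0 ∧
      (k : Matrix (Fin n) (Fin n) F) = 1 + vecMulVec e l) ⟨1, ?_⟩ (fun _ => mem) ?_ ?_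
    · rw [Finset.mem_filter]
      refine ⟨Finset.mem_univ _, 0, zero_vecMul _, ?_⟩
      rw [vecMulVec_zero, add_zero, Units.val_one]
    · intro k hk y hy
      have hkm := mem hk
      obtain ⟨-, l, hl, hk⟩ := Finset.mem_filter.mp hk
      rw [he] at hk
      obtain ⟨r, hr, hrX⟩ := exists_isUpper_mul_commute_of_vecMulVec XX hmj ha hl hk
      have hy' := apply_mem_rowFixed hy hu
      rw [map_mul, Module.End.mul_apply]
      nth_rewrite 1 [← hr.apply_eq hy']
      rw [← Module.End.mul_apply, ← map_mul, hℓ _ hrX]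
    · exact fun z hz => hΦ.sum_vecMulVec_eq_zero he0 hQe hz

theorem IsOddCuspidal.sum_smul_apply_eq_zero {j : ℕ} {Φ : GL (Fin n) F → ℂ}
    (hΦ : IsOddCuspidal j Φ) (h2 : (2 : F) ≠ 0) {c : F} (hc : c ≠ 0) {A : GL (Fin n) F}
    (hA : (A : Matrix (Fin n) (Fin n) F) * (A : Matrix (Fin n) (Fin n) F) = c • 1)
    (hρ : IsIrred ρ) {v : V} (hv : v ≠ 0) (hfix : ∀ g, g * A = A * g → ρ g v = v)
    {u : V} (hu : u ∈ rowFixed ρ j) : ∑ y with y ∈ tailGL n F j, Φ y • ρ y u = 0 := by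
  obtain ⟨ℓ, hℓ, hinj⟩ := hρ.exists_dual (H := Subgroup.centralizer {A}) hv fun h hh =>
    hfix h (Subgroup.mem_centralizer_singleton_iff.mp hh)
  refine hinj _ fun g => ?_
  have XX : ((g⁻¹ * A * g : GL (Fin n) F) : Matrix (Fin n) (Fin n) F) *
      ((g⁻¹ * A * g : GL (Fin n) F) : Matrix (Fin n) (Fin n) F) = c • 1 := by
    have e : g⁻¹ * A * g * (g⁻¹ * A * g) = g⁻¹ * (A * A) * g := by group
    rw [← Units.val_mul, e, Units.val_mul, Units.val_mul, Units.val_mul A, hA]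
    simp
  rw [← hΦ.sum_mul_apply_eq_zero (ρ := ρ) h2 hc XX (ℓ := ℓ ∘ₗ ρ g) ?_ hu, map_sum, map_sum]
  · refine Finset.sum_congr rfl fun y _ => ?_
    rw [map_smul, map_smul, smul_eq_mul, LinearMap.comp_apply]
  · intro h hh w
    rw [← Units.val_mul, ← Units.val_mul] at hh
    have hh := Units.ext hh
    rw [LinearMap.comp_apply, LinearMap.comp_apply, ← hℓ (g * h * g⁻¹) ?_ (ρ g w),
      ← Module.End.mul_apply, ← Module.End.mul_apply, ← map_mul, ← map_mul, inv_mul_cancel_right]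
    rw [Subgroup.mem_centralizer_singleton_iff]
    have e1 : g * h * g⁻¹ * A = g * (h * (g⁻¹ * A * g)) * g⁻¹ := by group
    rw [e1, hh]
    group

end lead

section average

variable {G V : Type*} [Group G] [Fintype G] [AddCommGroup V] [Module ℂ V]

/-- The average of a representation over a subgroup. -/
noncomputable def subgroupAverage (ρ : Representation ℂ G V) (K : Subgroup G) : Module.End ℂ V :=
  ((Finset.univ.filter (· ∈ K)).card : ℂ)⁻¹ • ∑ k with k ∈ K, ρ k

variable {ρ : Representation ℂ G V} {K : Subgroup G}

theorem card_filter_mem_subgroup_ne_zero (K : Subgroup G) :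
    ((Finset.univ.filter (· ∈ K)).card : ℂ) ≠ 0 :=
  Nat.cast_ne_zero.mpr (Finset.card_pos.mpr ⟨1, by simp [one_mem]⟩).ne'

theorem sum_eq_card_smul_subgroupAverage (ρ : Representation ℂ G V) (K : Subgroup G) :
    ∑ k with k ∈ K, ρ k = ((Finset.univ.filter (· ∈ K)).card : ℂ) • subgroupAverage ρ K := by
  rw [subgroupAverage, smul_inv_smul₀ (card_filter_mem_subgroup_ne_zero K)]

theorem subgroupAverage_mul_of_forall {T : Module.End ℂ V} (hT : ∀ k ∈ K, ρ k * T = T) :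
    subgroupAverage ρ K * T = T := by
  rw [subgroupAverage, smul_mul_assoc, Finset.sum_mul,
    Finset.sum_congr rfl fun k hk => hT k (Finset.mem_filter.mp hk).2, Finset.sum_const,
    ← Nat.cast_smul_eq_nsmul ℂ, inv_smul_smul₀ (card_filter_mem_subgroup_ne_zero K)]

theorem mul_subgroupAverage_of_forall {T : Module.End ℂ V} (hT : ∀ k ∈ K, T * ρ k = T) :
    T * subgroupAverage ρ K = T := by
  rw [subgroupAverage, mul_smul_comm, Finset.mul_sum,
    Finset.sum_congr rfl fun k hk => hT k (Finset.mem_filter.mp hk).2, Finset.sum_const,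
    ← Nat.cast_smul_eq_nsmul ℂ, inv_smul_smul₀ (card_filter_mem_subgroup_ne_zero K)]

theorem mul_subgroupAverage {k : G} (hk : k ∈ K) :
    ρ k * subgroupAverage ρ K = subgroupAverage ρ K := by
  rw [subgroupAverage, mul_smul_comm, Finset.mul_sum]
  congr 1
  refine Finset.sum_filter_eq_of_inverse (fun x => k * x) (fun x => k⁻¹ * x) ?_ ?_ ?_ ?_ ?_
  · exact fun x hx => mul_mem hk hx
  · exact fun x hx => mul_mem (inv_mem hk) hx
  · exact fun x _ => inv_mul_cancel_left k x
  · exact fun x _ => mul_inv_cancel_left k x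
  · exact fun x _ => (map_mul ρ k x).symm

theorem subgroupAverage_mul {k : G} (hk : k ∈ K) :
    subgroupAverage ρ K * ρ k = subgroupAverage ρ K := by
  rw [subgroupAverage, smul_mul_assoc, Finset.sum_mul]
  congr 1
  refine Finset.sum_filter_eq_of_inverse (fun x => x * k) (fun x => x * k⁻¹) ?_ ?_ ?_ ?_ ?_
  · exact fun x hx => mul_mem hx hk
  · exact fun x hx => mul_mem hx (inv_mem hk)
  · exact fun x _ => mul_inv_cancel_right x k
  · exact fun x _ => inv_mul_cancel_right x k
  · exact fun x _ => (map_mul ρ x k).symm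

theorem subgroupAverage_commute {g : G} (hg : ∀ k ∈ K, g * k * g⁻¹ ∈ K)
    (hg' : ∀ k ∈ K, g⁻¹ * k * g⁻¹⁻¹ ∈ K) :
    Commute (ρ g) (subgroupAverage ρ K) := by
  rw [commute_iff_eq, subgroupAverage, mul_smul_comm, smul_mul_assoc, Finset.mul_sum,
    Finset.sum_mul]
  congr 1
  refine Finset.sum_filter_eq_of_inverse (fun x => g * x * g⁻¹) (fun x => g⁻¹ * x * g⁻¹⁻¹)
    hg hg' ?_ ?_ ?_
  · intro x _
    group
  · intro x _
    group
  · intro x _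
    rw [← map_mul, ← map_mul, inv_mul_cancel_right]

theorem subgroupAverage_apply_mem {W : Submodule ℂ V} {w : V} (hw : ∀ k ∈ K, ρ k w ∈ W) :
    subgroupAverage ρ K w ∈ W := by
  rw [subgroupAverage, LinearMap.smul_apply, LinearMap.sum_apply]
  exact W.smul_mem _ (W.sum_mem fun k hk => hw k (Finset.mem_filter.mp hk).2)

theorem subgroupAverage_commute_of_forall {T : Module.End ℂ V}
    (hT : ∀ k ∈ K, Commute (ρ k) T) : Commute (subgroupAverage ρ K) T := by
  rw [subgroupAverage]
  exact (Commute.sum_left _ _ _ fun k hk => hT k (Finset.mem_filter.mp hk).2).smul_left _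

end average

section lead

variable {n : ℕ} {F : Type*} [Field F] {V : Type*} [AddCommGroup V] [Module ℂ V]

/-- Traces of `tailGL n F j` on its equivariant images inside `rowFixed ρ j` are invariant under
inversion. -/
def TraceInvariant (ρ : Representation ℂ (GL (Fin n) F) V) (j : ℕ) : Prop :=
  ∀ E : Module.End ℂ V, (∀ g ∈ tailGL n F j, Commute (ρ g) E) → (∀ w, E w ∈ rowFixed ρ j) →
    ∀ y ∈ tailGL n F j, LinearMap.trace ℂ V (ρ y * E) = LinearMap.trace ℂ V (ρ y⁻¹ * E)

/-- The variant of `TraceInvariant` twisted by a `rowGroup n F j`-biinvariant operator. -/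
def TwistedTraceInvariant (ρ : Representation ℂ (GL (Fin n) F) V) (j : ℕ) : Prop :=
  ∀ E T : Module.End ℂ V, (∀ g ∈ tailGL n F j, Commute (ρ g) E) →
    (∀ g ∈ tailGL n F (j + 1), Commute (ρ g) T) →
    (∀ k ∈ rowGroup n F j, ρ k * T = T) → (∀ k ∈ rowGroup n F j, T * ρ k = T) →
    (∀ w, T (E w) ∈ rowFixed ρ j) →
    ∀ y ∈ tailGL n F j, LinearMap.trace ℂ V (ρ y * T * E) = LinearMap.trace ℂ V (ρ y⁻¹ * T * E)

variable {ρ : Representation ℂ (GL (Fin n) F) V} {j : ℕ}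

theorem traceInvariant_of_le (hj : n ≤ j) : TraceInvariant ρ j := by
  intro E _ _ y hy
  rw [tailGL_of_le hj hy, inv_one]

theorem twistedTraceInvariant_of_le (hj : n ≤ j) : TwistedTraceInvariant ρ j := by
  intro E T _ _ _ _ _ y hy
  rw [tailGL_of_le hj hy, inv_one]

theorem mem_rowFixed_succ {w : V} (hw : w ∈ rowFixed ρ j)
    (hk : ∀ k ∈ rowGroup n F j, ρ k w = w) : w ∈ rowFixed ρ (j + 1) := by
  intro i hi k hk'
  rcases Nat.lt_succ_iff_lt_or_eq.mp hi with h | rfl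
  · exact hw i h k hk'
  · exact hk k hk'

variable [Fintype F]

theorem commute_subgroupAverage_rowGroup {g : GL (Fin n) F} (hg : g ∈ tailGL n F (j + 1)) :
    Commute (ρ g) (subgroupAverage ρ (rowGroup n F j)) :=
  subgroupAverage_commute (fun _ hk => conj_mem_rowGroup (Nat.lt_succ_self j) hg hk)
    fun _ hk => conj_mem_rowGroup (Nat.lt_succ_self j) (inv_mem hg) hk

theorem trace_mul_mul_eq_of_swap {E T S : Module.End ℂ V} {k₁ k₂ g₁ g₂ : GL (Fin n) F}
    (hE : ∀ g ∈ tailGL n F j, Commute (ρ g) E) (hT : ∀ g ∈ tailGL n F (j + 1), Commute (ρ g) T)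
    (hkT : ∀ k ∈ rowGroup n F j, ρ k * T = T) (hTk : ∀ k ∈ rowGroup n F j, T * ρ k = T)
    (hk₁ : k₁ ∈ rowGroup n F j) (hk₂ : k₂ ∈ rowGroup n F j)
    (hg₁ : g₁ ∈ tailGL n F (j + 1)) (hg₂ : g₂ ∈ tailGL n F (j + 1)) :
    LinearMap.trace ℂ V (ρ k₁ * ρ g₁ * S * ρ g₂ * ρ k₂ * T * E) =
      LinearMap.trace ℂ V (ρ (g₂ * g₁) * (subgroupAverage ρ (rowGroup n F j) * S *
        subgroupAverage ρ (rowGroup n F j)) * (T * E)) := by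
  have hK : rowGroup n F j ≤ tailGL n F j := rowGroup_le_tailGL j
  have hM : tailGL n F (j + 1) ≤ tailGL n F j := tailGL_le (Nat.le_succ j)
  obtain ⟨P, hP⟩ : ∃ P, P = subgroupAverage ρ (rowGroup n F j) := ⟨_, rfl⟩
  have hPT : P * T = T := hP ▸ subgroupAverage_mul_of_forall hkT
  have hTP : T * P = T := hP ▸ mul_subgroupAverage_of_forall hTk
  have hPE : P * E = E * P := hP ▸ subgroupAverage_commute_of_forall fun k hk => hE k (hK hk)
  have hP₁ : ρ g₁ * P = P * ρ g₁ := hP ▸ commute_subgroupAverage_rowGroup hg₁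
  have hP₂ : ρ g₂ * P = P * ρ g₂ := hP ▸ commute_subgroupAverage_rowGroup hg₂
  have hE₁ : ρ g₁ * E = E * ρ g₁ := hE _ (hM hg₁)
  have hEk : ρ k₁ * E = E * ρ k₁ := hE _ (hK hk₁)
  have hE₂ : ρ g₂ * E = E * ρ g₂ := hE _ (hM hg₂)
  have hT₂ : ρ g₂ * T = T * ρ g₂ := hT _ hg₂
  have hT₁ : ρ g₁ * T = T * ρ g₁ := hT _ hg₁
  have hkT₂ := hkT _ hk₂
  have hTk₁ := hTk _ hk₁
  rw [← hP, map_mul ρ]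
  generalize ρ k₁ = a at *
  generalize ρ k₂ = b at *
  generalize ρ g₁ = x at *
  generalize ρ g₂ = y at *
  calc LinearMap.trace ℂ V (a * x * S * y * b * T * E)
      = LinearMap.trace ℂ V (a * (x * S * y * T * E)) := by
        congr 1
        simp only [mul_assoc]
        rw [← mul_assoc b T, hkT₂]
    _ = LinearMap.trace ℂ V (x * S * y * T * E * a) := LinearMap.trace_mul_comm ℂ _ _
    _ = LinearMap.trace ℂ V (P * (x * S * P * y * T * E)) := by
        rw [LinearMap.trace_mul_comm ℂ P]
        congr 1
        have e1 : T * E * a = T * E := by rw [mul_assoc, ← hEk, ← mul_assoc, hTk₁]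
        have e2 : P * y * T * E * P = y * T * E := by
          rw [mul_assoc, ← hPE, ← hP₂]
          simp only [mul_assoc]
          rw [← mul_assoc T P, hTP, ← mul_assoc P T, hPT]
        calc x * S * y * T * E * a = x * S * y * (T * E * a) := by simp only [mul_assoc]
          _ = x * S * (P * y * T * E * P) := by rw [e1, e2]; simp only [mul_assoc]
          _ = _ := by simp only [mul_assoc]
    _ = LinearMap.trace ℂ V (x * (P * S * P * y * T * E)) := by
        congr 1
        simp only [← mul_assoc]
        rw [hP₁]
    _ = LinearMap.trace ℂ V (P * S * P * y * T * E * x) := LinearMap.trace_mul_comm ℂ _ _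
    _ = LinearMap.trace ℂ V (P * S * P * (y * x * (T * E))) := by
        congr 1
        have e1 : T * E * x = x * (T * E) := by
          rw [mul_assoc, ← hE₁, ← mul_assoc, ← hT₁, mul_assoc]
        calc P * S * P * y * T * E * x = P * S * P * y * (T * E * x) := by simp only [mul_assoc]
          _ = _ := by rw [e1]; simp only [mul_assoc]
    _ = LinearMap.trace ℂ V (P * S * P * (T * E * (y * x))) := by
        have e1 : x * (T * E) = T * E * x := by
          rw [mul_assoc, ← hE₁, ← mul_assoc, hT₁, mul_assoc]
        have e2 : y * (T * E) = T * E * y := by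
          rw [mul_assoc, ← hE₂, ← mul_assoc, hT₂, mul_assoc]
        rw [mul_assoc y x, e1, ← mul_assoc y, e2, mul_assoc (T * E)]
    _ = LinearMap.trace ℂ V (y * x * (P * S * P) * (T * E)) := by
        rw [← mul_assoc, LinearMap.trace_mul_comm ℂ, mul_assoc (y * x)]

theorem TwistedTraceInvariant.of_succ (h₁ : TraceInvariant ρ (j + 1))
    (h₂ : TwistedTraceInvariant ρ (j + 1)) : TwistedTraceInvariant ρ j := by
  rcases le_or_gt n j with hjn | hjn
  · exact twistedTraceInvariant_of_le hjn
  intro E T hE hT hkT hTk hTE y hy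
  have hK : rowGroup n F j ≤ tailGL n F j := rowGroup_le_tailGL j
  have hM : tailGL n F (j + 1) ≤ tailGL n F j := tailGL_le (Nat.le_succ j)
  have hTE' : ∀ w, (T * E) w ∈ rowFixed ρ (j + 1) := by
    intro w
    refine mem_rowFixed_succ (hTE w) fun k hk => ?_
    rw [← Module.End.mul_apply, ← mul_assoc, hkT k hk]
  have hTEc : ∀ g ∈ tailGL n F (j + 1), Commute (ρ g) (T * E) := fun g hg =>
    (hT g hg).mul_right (hE g (hM hg))
  by_cases hd : ∃ d : F, (y : Matrix (Fin n) (Fin n) F) * coordProj n F j = d • coordProj n F j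
  · obtain ⟨d, hd⟩ := hd
    obtain ⟨g, hg, k, hk, rfl⟩ := exists_mul_of_mulVec hy hjn hd
    have e1 : ρ (g * k) * T * E = ρ g * (T * E) := by
      rw [map_mul, mul_assoc (ρ g), hkT k hk, mul_assoc]
    have e2 : LinearMap.trace ℂ V (ρ (g * k)⁻¹ * T * E) =
        LinearMap.trace ℂ V (ρ g⁻¹ * (T * E)) := by
      have hk' := inv_mem hk
      rw [_root_.mul_inv_rev, map_mul ρ, mul_assoc, mul_assoc, LinearMap.trace_mul_comm ℂ, mul_assoc,
        mul_assoc, ← (hE _ (hK hk')).eq, ← mul_assoc T, hTk _ hk']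
    rw [e1, e2]
    exact h₁ _ hTEc hTE' g hg
  · have hjn' : j + 1 < n := by
      by_contra hjn'
      obtain ⟨a, rfl⟩ : ∃ a : Fin n, a.val = j := ⟨⟨j, hjn⟩, rfl⟩
      rcases mul_coordProj_eq_or hy with h | ⟨c, hc, -⟩
      · exact hd h
      · have := c.isLt
        omega
    obtain ⟨s, ss, hs, hsg, hsk, hdec⟩ := exists_adjacent_swap (F := F) hjn'
    obtain ⟨k₁, hk₁, g₁, hg₁, g₂, hg₂, k₂, hk₂, rfl⟩ := hdec y hy hd
    have hinv : (k₁ * g₁ * s * g₂ * k₂)⁻¹ = k₂⁻¹ * g₂⁻¹ * s * g₁⁻¹ * k₁⁻¹ := by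
      have : s⁻¹ = s := inv_eq_of_mul_eq_one_left ss
      simp only [_root_.mul_inv_rev, this, mul_assoc]
    rw [hinv]
    simp only [map_mul ρ]
    rw [trace_mul_mul_eq_of_swap hE hT hkT hTk hk₁ hk₂ hg₁ hg₂,
      trace_mul_mul_eq_of_swap hE hT hkT hTk (inv_mem hk₂) (inv_mem hk₁) (inv_mem hg₂)
        (inv_mem hg₁), ← _root_.mul_inv_rev]
    have hP : ∀ {g}, g ∈ tailGL n F (j + 1) →
      Commute (ρ g) (subgroupAverage ρ (rowGroup n F j)) := commute_subgroupAverage_rowGroup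
    refine h₂ _ _ hTEc ?_ ?_ ?_ ?_ _ (mul_mem hg₂ hg₁)
    · intro g hg
      have hg' : g ∈ tailGL n F (j + 1) := tailGL_le (Nat.le_succ _) hg
      refine ((hP hg').mul_right ?_).mul_right (hP hg')
      rw [commute_iff_eq, ← map_mul, ← map_mul, hsg g hg]
    · intro k hk
      have hk' : k ∈ tailGL n F (j + 1) := rowGroup_le_tailGL _ hk
      have e : k * s = s * (s * k * s) := by
        simp only [← mul_assoc]
        rw [ss, one_mul]
      rw [← mul_assoc, ← mul_assoc, (hP hk').eq, mul_assoc _ (ρ k), ← map_mul, e, map_mul,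
        ← mul_assoc, mul_assoc, mul_subgroupAverage (hsk k hk)]
    · intro k hk
      have hk' : k ∈ tailGL n F (j + 1) := rowGroup_le_tailGL _ hk
      have e : s * k = s * k * s * s := by
        rw [mul_assoc _ s s, ss, mul_one]
      rw [mul_assoc, ← (hP hk').eq, mul_assoc, ← mul_assoc (ρ s), ← map_mul, e, map_mul,
        ← mul_assoc, ← mul_assoc, subgroupAverage_mul (hsk k hk)]
    · intro w
      simp only [Module.End.mul_apply]
      have hp : ∀ {w}, w ∈ rowFixed ρ j →
        subgroupAverage ρ (rowGroup n F j) w ∈ rowFixed ρ j := fun hw =>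
          subgroupAverage_apply_mem fun k hk => apply_mem_rowFixed (hK hk) hw
      refine mem_rowFixed_succ (hp (apply_mem_rowFixed hs (hp (hTE w)))) fun k hk => ?_
      rw [← Module.End.mul_apply, mul_subgroupAverage hk]

theorem TraceInvariant.of_twisted (h : TwistedTraceInvariant ρ j)
    (hρ : ∀ Φ : GL (Fin n) F → ℂ, IsOddCuspidal j Φ → ∀ u ∈ rowFixed ρ j,
      ∑ y with y ∈ tailGL n F j, Φ y • ρ y u = 0) : TraceInvariant ρ j := by
  intro E hE hEw
  have hK : rowGroup n F j ≤ tailGL n F j := rowGroup_le_tailGL j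
  obtain ⟨θ, hθ⟩ : ∃ θ : GL (Fin n) F → ℂ, θ = fun y => LinearMap.trace ℂ V (ρ y * E) := ⟨_, rfl⟩
  have θapp : ∀ y, LinearMap.trace ℂ V (ρ y * E) = θ y := by
    intro y
    rw [hθ]
  have θcomm : ∀ x ∈ tailGL n F j, ∀ y, θ (x * y) = θ (y * x) := by
    intro x hx y
    rw [← θapp, ← θapp, map_mul ρ, mul_assoc, LinearMap.trace_mul_comm ℂ, mul_assoc,
      ← (hE x hx).eq, ← mul_assoc, map_mul ρ]
  have θsum : ∀ x ∈ tailGL n F j,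
      ∑ k with k ∈ rowGroup n F j, θ (k * x) = ∑ k with k ∈ rowGroup n F j, θ (k * x⁻¹) := by
    have hcomm := subgroupAverage_commute_of_forall (ρ := ρ) fun k hk => hE k (hK hk)
    have key : ∀ x, ∑ k with k ∈ rowGroup n F j, θ (k * x) =
        ((Finset.univ.filter (· ∈ rowGroup n F j)).card : ℂ) *
          LinearMap.trace ℂ V (ρ x * subgroupAverage ρ (rowGroup n F j) * E) := by
      intro x
      rw [mul_assoc, hcomm.eq, ← mul_assoc, LinearMap.trace_mul_comm ℂ, ← smul_eq_mul, ← map_smul,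
        ← smul_mul_assoc, ← sum_eq_card_smul_subgroupAverage, Finset.sum_mul, map_sum]
      refine Finset.sum_congr rfl fun k _ => ?_
      rw [← θapp, map_mul ρ, mul_assoc]
    intro x hx
    rw [key, key, h E _ hE (fun g hg => commute_subgroupAverage_rowGroup hg)
      (fun k hk => mul_subgroupAverage hk) (fun k hk => subgroupAverage_mul hk) ?_ x hx]
    exact fun w => subgroupAverage_apply_mem fun k hk => apply_mem_rowFixed (hK hk) (hEw w)
  have inv_sum : ∀ (M : Subgroup (GL (Fin n) F)) (f : GL (Fin n) F → ℂ),
      ∑ k with k ∈ M, f k⁻¹ = ∑ k with k ∈ M, f k := by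
    intro M f
    refine Finset.sum_filter_eq_of_inverse (fun x => x⁻¹) (fun x => x⁻¹) ?_ ?_ ?_ ?_ ?_
    · exact fun x hx => inv_mem hx
    · exact fun x hx => inv_mem hx
    · exact fun x _ => inv_inv x
    · exact fun x _ => inv_inv x
    · exact fun x _ => rfl
  obtain ⟨D, hD⟩ : ∃ D : GL (Fin n) F → ℂ, ∀ y, D y = θ y - θ y⁻¹ := ⟨_, fun _ => rfl⟩
  have Dinv : ∀ x, D x⁻¹ = -D x := by
    intro x
    rw [hD, hD, inv_inv, neg_sub]
  have hodd : IsOddCuspidal j fun y => starRingEnd ℂ (D y) := by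
    refine ⟨fun x hx y hy => ?_, fun x _ => ?_, fun x hx => ?_⟩
    · rw [hD, hD, θcomm x hx, _root_.mul_inv_rev, _root_.mul_inv_rev, θcomm _ (inv_mem hy)]
    · rw [Dinv, map_neg]
    · rw [← map_sum, map_eq_zero, Finset.sum_congr rfl fun k _ => hD (k * x),
        Finset.sum_sub_distrib, θsum x hx, sub_eq_zero,
        ← inv_sum (rowGroup n F j) fun k => θ (k * x⁻¹)]
      refine Finset.sum_congr rfl fun k hk => ?_
      rw [_root_.mul_inv_rev, θcomm _ (inv_mem hx)]
  have h0 : ∑ y with y ∈ tailGL n F j, starRingEnd ℂ (D y) * θ y = 0 := by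
    have h1 : ∑ y with y ∈ tailGL n F j, starRingEnd ℂ (D y) • (ρ y * E) = 0 := by
      refine LinearMap.ext fun w => ?_
      rw [LinearMap.sum_apply, LinearMap.zero_apply, ← hρ _ hodd (E w) (hEw w)]
      rfl
    have h2 := congrArg (LinearMap.trace ℂ V) h1
    rw [map_sum, map_zero] at h2
    rw [← h2]
    refine Finset.sum_congr rfl fun y _ => ?_
    rw [map_smul, θapp, smul_eq_mul]
  have h1 : ∑ y with y ∈ tailGL n F j, (Complex.normSq (D y) : ℂ) = 0 := by
    have h2 := inv_sum (tailGL n F j) fun y => starRingEnd ℂ (D y) * θ y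
    rw [h0] at h2
    calc ∑ y with y ∈ tailGL n F j, (Complex.normSq (D y) : ℂ)
        = ∑ y with y ∈ tailGL n F j, (starRingEnd ℂ (D y) * θ y +
            starRingEnd ℂ (D y⁻¹) * θ y⁻¹) := by
          refine Finset.sum_congr rfl fun y _ => ?_
          rw [Complex.normSq_eq_conj_mul_self, Dinv, map_neg, hD]
          ring
      _ = 0 := by rw [Finset.sum_add_distrib, h0, h2, add_zero]
  intro y hy
  rw [θapp, θapp, ← sub_eq_zero, ← hD]
  rw [← Complex.ofReal_sum, Complex.ofReal_eq_zero,
    Finset.sum_eq_zero_iff_of_nonneg fun y _ => Complex.normSq_nonneg _] at h1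
  exact Complex.normSq_eq_zero.mp (h1 y (by simpa using hy))

theorem traceInvariant_and_twistedTraceInvariant
    (hρ : ∀ j, ∀ Φ : GL (Fin n) F → ℂ, IsOddCuspidal j Φ → ∀ u ∈ rowFixed ρ j,
      ∑ y with y ∈ tailGL n F j, Φ y • ρ y u = 0) (j : ℕ) :
    TraceInvariant ρ j ∧ TwistedTraceInvariant ρ j := by
  rcases le_or_gt n j with h | h
  · exact ⟨traceInvariant_of_le h, twistedTraceInvariant_of_le h⟩
  · obtain ⟨h₁, h₂⟩ := traceInvariant_and_twistedTraceInvariant hρ (j + 1)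
    have h₃ := TwistedTraceInvariant.of_succ h₁ h₂
    exact ⟨.of_twisted h₃ (hρ j), h₃⟩
termination_by n - j

end lead

end Involution

/-- Let `q` be an odd prime power, `n ≥ 1`, and `A ∈ GL_n(𝔽_q)` with `A²`
a scalar matrix.  Let `H` be the centralizer of `A` (the fixed points of the involution
`X ↦ A X A⁻¹`).  If an irreducible complex representation `ρ` of `GL_n(𝔽_q)` has a
nonzero `H`-fixed vector, then `ρ` is self-dual: its character `χ` satisfies
`χ(g) = χ(g⁻¹)` for all `g`. -/
theorem stmt0 (q : ℕ) (hq : Odd q) (hq' : IsPrimePow q)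
    (F : Type) [Field F] [Fintype F] (hF : Fintype.card F = q)
    (n : ℕ) (hn : 1 ≤ n)
    (A : GL (Fin n) F) (c : F)
    (hA : (A : Matrix (Fin n) (Fin n) F) * (A : Matrix (Fin n) (Fin n) F) =
      c • (1 : Matrix (Fin n) (Fin n) F))
    (V : Type) [AddCommGroup V] [Module ℂ V] [FiniteDimensional ℂ V]
    (ρ : Representation ℂ (GL (Fin n) F) V) (hirr : IsIrred ρ)
    (v : V) (hv : v ≠ 0)
    (hfix : ∀ g : GL (Fin n) F, g * A = A * g → ρ g v = v) :
    ∀ g : GL (Fin n) F, LinearMap.trace ℂ V (ρ g) = LinearMap.trace ℂ V (ρ g⁻¹) := by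
  have h2 : (2 : F) ≠ 0 := by
    refine Ring.two_ne_zero fun h => ?_
    have := FiniteField.even_card_of_char_two h
    rw [hF, ← Nat.even_iff] at this
    exact Nat.not_even_iff_odd.mpr hq this
  have hc : c ≠ 0 := by
    rintro rfl
    have : Nonempty (Fin n) := ⟨⟨0, hn⟩⟩
    rw [zero_smul, ← Units.val_mul] at hA
    exact (A * A).ne_zero hA
  intro g
  have h := (traceInvariant_and_twistedTraceInvariant (ρ := ρ)
    (fun j Φ hΦ u hu => hΦ.sum_smul_apply_eq_zero h2 hc hA hirr hv hfix hu) 0).1 1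
    (fun g _ => Commute.one_right _) (fun w i hi => absurd hi (Nat.not_lt_zero i)) g
    (by rw [tailGL_zero]; exact Subgroup.mem_top g)
  rwa [mul_one, mul_one] at h
end

section
/- Let q be an odd prime power and n ≥ 1. Let Fr denote the Frobenius x ↦ x^q of 𝔽_{q²}, applied entrywise to matrices. Let B ∈ GL_n(𝔽_{q²}) be such that the map σ(X) := B·Fr(X)·B⁻¹ satisfies σ∘σ = id (an involutive automorphism of GL_n(𝔽_{q²})), and let H = {g ∈ GL_n(𝔽_{q²}) : σ(g) = g}. If π is an irreducible complex representation of GL_n(𝔽_{q²}) with a nonzero H-fixed vector, then χ_π(σ(g)) = χ_π(g⁻¹) for all g ∈ GL_n(𝔽_{q²}), i.e. π ≅ π* ∘ σ where π* is the contragredient. -/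
open Matrix

namespace FrobeniusDistinguished

section Cancellation

variable {R : Type*} [Ring R]

/-- Linear maps with kernel `K` correspond to injective maps out of the quotient by `K`. -/
noncomputable def kerEquivQuotient {L M : Type*} [AddCommGroup L] [Module R L]
    [AddCommGroup M] [Module R M] (K : Submodule R L) :
    {f : L →ₗ[R] M // LinearMap.ker f = K} ≃
      {f : (L ⧸ K) →ₗ[R] M // LinearMap.ker f = ⊥} where
  toFun f := ⟨K.liftQ f.1 f.2.ge, by
    rw [Submodule.ker_liftQ, f.2, Submodule.mkQ_map_self]⟩
  invFun f := ⟨f.1 ∘ₗ K.mkQ, by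
    rw [LinearMap.ker_comp, f.2, ← LinearMap.ker, Submodule.ker_mkQ]⟩
  left_inv f := by ext; simp
  right_inv f := by
    apply Subtype.ext
    apply Submodule.linearMap_qext
    ext; simp

theorem card_linearMap_eq_sum {L M : Type*} [AddCommGroup L] [Module R L]
    [AddCommGroup M] [Module R M] [Finite L] [Finite M] [Fintype (Submodule R L)] :
    Nat.card (L →ₗ[R] M) =
      ∑ K : Submodule R L, Nat.card {f : L →ₗ[R] M // LinearMap.ker f = K} := by
  have : Finite (L →ₗ[R] M) := Finite.of_injective _ DFunLike.coe_injective
  rw [← Nat.card_sigma]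
  exact Nat.card_congr (Equiv.sigmaFiberEquiv fun f : L →ₗ[R] M => LinearMap.ker f).symm

universe u

theorem card_injective_eq_of_card_eq {M N : Type u} [AddCommGroup M] [Module R M]
    [AddCommGroup N] [Module R N] [Finite M] [Finite N]
    (h : ∀ (L : Type u) [AddCommGroup L] [Module R L] [Finite L],
      Nat.card (L →ₗ[R] M) = Nat.card (L →ₗ[R] N)) (m : ℕ) :
    ∀ (L : Type u) [AddCommGroup L] [Module R L] [Finite L], Nat.card L = m →
      Nat.card {f : L →ₗ[R] M // LinearMap.ker f = ⊥} =
        Nat.card {f : L →ₗ[R] N // LinearMap.ker f = ⊥} := by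
  classical
  induction m using Nat.strong_induction_on with
  | _ m ih =>
    intro L _ _ _ hL
    have : Finite (Submodule R L) := Finite.of_injective _ SetLike.coe_injective
    have := Fintype.ofFinite (Submodule R L)
    have key := h L
    rw [card_linearMap_eq_sum, card_linearMap_eq_sum,
      ← Finset.add_sum_erase _ _ (Finset.mem_univ ⊥),
      ← Finset.add_sum_erase _ _ (Finset.mem_univ ⊥)] at key
    refine Nat.add_right_cancel (key.trans (congrArg _ ?_))
    refine (Finset.sum_congr rfl fun K hK => ?_).symm
    rw [Nat.card_congr (kerEquivQuotient K), Nat.card_congr (kerEquivQuotient K)]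
    have : Finite (L ⧸ K) := Quotient.finite _
    refine ih _ ?_ (L ⧸ K) rfl
    have hK' : K ≠ ⊥ := Finset.ne_of_mem_erase hK
    have : Nontrivial K := Submodule.nontrivial_iff_ne_bot.mpr hK'
    rw [← hL, Submodule.card_eq_card_quotient_mul_card K]
    have h1 : 1 < Nat.card K := Finite.one_lt_card
    have h0 : 0 < Nat.card (L ⧸ K) := Nat.card_pos
    nlinarith

/-- Finite modules whose squares are isomorphic are isomorphic. -/
theorem nonempty_linearEquiv_of_prod {M N : Type u} [AddCommGroup M] [Module R M]
    [AddCommGroup N] [Module R N] [Finite M] [Finite N]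
    (e : (M × M) ≃ₗ[R] (N × N)) : Nonempty (M ≃ₗ[R] N) := by
  have sq (P L : Type u) [AddCommGroup P] [Module R P] [AddCommGroup L] [Module R L] :
      Nat.card (L →ₗ[R] P × P) = Nat.card (L →ₗ[R] P) ^ 2 := by
    rw [← Nat.card_congr (LinearMap.prodEquiv ℕ (R := R) (M := L) (M₂ := P) (M₃ := P)).toEquiv,
      Nat.card_prod, pow_two]
  have hcard : Nat.card M = Nat.card N := by
    have := Nat.card_congr e.toEquiv
    rw [Nat.card_prod, Nat.card_prod, ← pow_two, ← pow_two] at this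
    exact Nat.pow_left_injective two_ne_zero this
  have hinj := card_injective_eq_of_card_eq (R := R) (M := M) (N := N) (fun L _ _ _ => by
    refine Nat.pow_left_injective two_ne_zero ?_
    change _ ^ 2 = _ ^ 2
    rw [← sq, ← sq]
    exact Nat.card_congr ⟨fun f => e.toLinearMap ∘ₗ f, fun f => e.symm.toLinearMap ∘ₗ f,
      fun f => by ext <;> simp, fun f => by ext <;> simp⟩) _ M rfl
  have : Finite (M →ₗ[R] M) := Finite.of_injective _ DFunLike.coe_injective
  have : Nonempty {f : M →ₗ[R] M // LinearMap.ker f = ⊥} := ⟨⟨LinearMap.id, by simp⟩⟩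
  have hpos : 0 < Nat.card {f : M →ₗ[R] M // LinearMap.ker f = ⊥} := Nat.card_pos
  rw [hinj] at hpos
  obtain ⟨⟨f, hf⟩⟩ := (Nat.card_pos_iff.mp hpos).1
  exact ⟨LinearEquiv.ofBijective f
    ((Nat.bijective_iff_injective_and_card f).mpr ⟨LinearMap.ker_eq_bot.mp hf, hcard⟩)⟩

end Cancellation

section HilbertNinety

variable {A : Type*} [Ring A]

/-- The subring of fixed points of a ring endomorphism. -/
def fixedSubring (τ : A →+* A) : Subring A := τ.eqLocus (RingHom.id A)

/-- The fixed points of the twist of `τ` by right multiplication by `z`. -/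
def twistedFixed (τ : A →+* A) (z : A) : Submodule (fixedSubring τ) A where
  carrier := {w | τ w * z = w}
  add_mem' {a b} ha hb := by
    simp only [Set.mem_ofPred_eq] at *
    rw [map_add, add_mul, ha, hb]
  zero_mem' := by simp
  smul_mem' c x hx := by
    have hc : τ c = c := c.2
    simp only [Set.mem_ofPred_eq] at *
    rw [Subring.smul_def, smul_eq_mul, map_mul, hc, mul_assoc, hx]

theorem mem_twistedFixed {τ : A →+* A} {z w : A} : w ∈ twistedFixed τ z ↔ τ w * z = w :=
  Iff.rfl

/-- If `τ` negates a central unit, then `A` is two copies of the `τ`-twisted fixed points. -/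
theorem bijective_twistedFixed_prod {τ : A →+* A} (hτ : ∀ a, τ (τ a) = a) {ε ε' t : A}
    (hc : ∀ a, ε * a = a * ε) (hε : ε * ε' = 1) (hτε : τ ε = -ε) (ht : t + t = 1)
    {z : A} (hz : τ z * z = 1) :
    Function.Bijective (LinearMap.coprod (twistedFixed τ z).subtype
      ((LinearMap.mulRight (fixedSubring τ) ε) ∘ₗ (twistedFixed τ z).subtype)) := by
  have hε' : ε' * ε = 1 := by rw [← hc, hε]
  have hc' : ∀ a, ε' * a = a * ε' := fun a => by
    calc ε' * a = ε' * (a * ε) * ε' := by rw [mul_assoc, mul_assoc, hε, mul_one]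
      _ = a * ε' := by rw [← hc, ← mul_assoc, hε', one_mul]
  have htc : ∀ a, t * a = a * t := fun a => by
    have h2 : ∀ x : A, t * (x + x) = x := fun x => by
      rw [mul_add, ← add_mul, ht, one_mul]
    calc t * a = t * (a * (t + t)) := by rw [ht, mul_one]
      _ = a * t := by rw [mul_add, h2]
  have hτt : τ t = t := by
    have h1 : τ t + τ t = 1 := by rw [← map_add, ht, map_one]
    calc τ t = (t + t) * τ t := by rw [ht, one_mul]
      _ = t * (τ t + τ t) := by rw [add_mul, mul_add]
      _ = t := by rw [h1, mul_one]
  have hτε' : τ ε' = -ε' := by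
    have h1 : -ε * τ ε' = 1 := by rw [← hτε, ← map_mul, hε, map_one]
    calc τ ε' = ε' * ε * τ ε' := by rw [hε', one_mul]
      _ = -(ε' * (-ε * τ ε')) := by noncomm_ring
      _ = -ε' := by rw [h1, mul_one]
  constructor
  · rw [← LinearMap.ker_eq_bot, LinearMap.ker_eq_bot']
    rintro ⟨⟨a, ha⟩, ⟨b, hb⟩⟩ h
    rw [mem_twistedFixed] at ha hb
    have h1 : a + b * ε = 0 := by simpa using h
    have h2 : a - b * ε = 0 := by
      have := congrArg (fun x => τ x * z) h1
      simp only [map_add, map_mul, map_zero, zero_mul, add_mul, ha, hτε] at this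
      rw [mul_neg, neg_mul, mul_assoc, hc, ← mul_assoc, hb] at this
      rw [sub_eq_add_neg]; exact this
    have ha0 : a = 0 := by
      calc a = t * ((a + b * ε) + (a - b * ε)) := by
            rw [add_add_sub_cancel, mul_add, ← add_mul, ht, one_mul]
        _ = 0 := by rw [h1, h2]; simp
    have hb0 : b = 0 := by
      rw [ha0, zero_add] at h1
      rw [← mul_one b, ← hε, ← mul_assoc, h1, zero_mul]
    simp [ha0, hb0]
  · intro w
    refine ⟨(⟨t * (w + τ w * z), ?_⟩, ⟨t * (w - τ w * z) * ε', ?_⟩), ?_⟩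
    · rw [mem_twistedFixed, map_mul, hτt, map_add, map_mul, hτ, mul_assoc, add_mul, mul_assoc w,
        hz, mul_one, add_comm]
    · rw [mem_twistedFixed, map_mul, map_mul, hτt, map_sub, map_mul, hτ, hτε', mul_assoc, neg_mul,
        hc', mul_neg, ← mul_assoc, mul_assoc t, sub_mul, mul_assoc w, hz, mul_one, ← neg_mul,
        ← mul_neg, neg_sub]
    · simp only [LinearMap.coprod_apply, Submodule.subtype_apply, LinearMap.comp_apply,
        LinearMap.mulRight_apply, mul_assoc, hε', mul_one]
      rw [← mul_add, add_add_sub_cancel, mul_add, ← add_mul, ht, one_mul]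

/-- Hilbert 90 for a finite ring with an involution that negates a central unit. -/
theorem exists_unit_of_norm_one [Finite A] {τ : A →+* A} (hτ : ∀ a, τ (τ a) = a) {ε ε' t : A}
    (hc : ∀ a, ε * a = a * ε) (hε : ε * ε' = 1) (hτε : τ ε = -ε) (ht : t + t = 1)
    {z : A} (hz : τ z * z = 1) : ∃ w : Aˣ, τ w * z = w := by
  have h1 := bijective_twistedFixed_prod hτ hc hε hτε ht (z := 1) (by simp)
  have h2 := bijective_twistedFixed_prod hτ hc hε hτε ht hz
  obtain ⟨e⟩ := nonempty_linearEquiv_of_prod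
    ((LinearEquiv.ofBijective _ h1).trans (LinearEquiv.ofBijective _ h2).symm)
  let one : twistedFixed τ (1 : A) := ⟨1, by rw [mem_twistedFixed]; simp⟩
  have gen (x : twistedFixed τ z) : ∃ c : A, (x : A) = c * (e one : A) := by
    have hr : τ (e.symm x : A) = (e.symm x : A) := by
      have := mem_twistedFixed.mp (e.symm x).2
      rwa [mul_one] at this
    refine ⟨(e.symm x : A), ?_⟩
    have h3 : e.symm x = (⟨(e.symm x : A), hr⟩ : fixedSubring τ) • one := by
      apply Subtype.ext
      simp [one, Subring.smul_def]
    have h4 := congrArg e h3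
    rw [LinearEquiv.apply_symm_apply, map_smul] at h4
    exact congrArg Subtype.val h4
  obtain ⟨⟨x, y⟩, hxy⟩ := h2.2 1
  obtain ⟨c, hx⟩ := gen x
  obtain ⟨d, hy⟩ := gen y
  have hinv : (c + d * ε) * (e one : A) = 1 := by
    refine Eq.trans ?_ hxy
    simp only [LinearMap.coprod_apply, Submodule.subtype_apply, LinearMap.comp_apply,
      LinearMap.mulRight_apply, hx, hy]
    rw [add_mul, mul_assoc, hc, mul_assoc]
  have hu : IsUnit (e one : A) := IsUnit.of_mul_eq_one_right _ hinv
  exact ⟨hu.unit, mem_twistedFixed.mp (e one).2⟩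

/-- The map `g ↦ (τ g)⁻¹` preserves the double cosets of the `τ`-fixed units. -/
theorem exists_fixed_mul_mul [Finite A] {τ : A →+* A} (hτ : ∀ a, τ (τ a) = a) {ε ε' t : A}
    (hc : ∀ a, ε * a = a * ε) (hε : ε * ε' = 1) (hτε : τ ε = -ε) (ht : t + t = 1)
    (htc : ∀ a, t * a = a * t)
    {g g' : A} (hg : g * g' = 1) (hg' : g' * g = 1) :
    ∃ k k' p p' : A, τ k = k ∧ τ p = p ∧ k * k' = 1 ∧ k' * k = 1 ∧ p * p' = 1 ∧ p' * p = 1 ∧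
      k * τ g' = g * p := by
  have hτg : τ g * τ g' = 1 := by rw [← map_mul, hg, map_one]
  have hτg' : τ g' * τ g = 1 := by rw [← map_mul, hg', map_one]
  set z := g' * τ g with hz
  have hτz : τ z = τ g' * g := by rw [hz, map_mul, hτ]
  have hzz : τ z * z = 1 := by
    rw [hτz, hz, mul_assoc, ← mul_assoc g, hg, one_mul, hτg']
  have hzz' : z * τ z = 1 := by
    rw [hτz, hz, mul_assoc, ← mul_assoc (τ g), hτg, one_mul, hg']
  let C : Subring A := Subring.centralizer {z}
  have memC {a : A} : a ∈ C ↔ z * a = a * z := by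
    simp [C, Subring.mem_centralizer_iff]
  have hstab : ∀ a ∈ C, τ a ∈ C := fun a ha => by
    rw [memC] at ha ⊢
    have h1 := congrArg τ ha
    rw [τ.map_mul z a, τ.map_mul a z] at h1
    calc z * τ a = z * (τ a * τ z) * z := by simp only [mul_assoc, hzz, mul_one]
      _ = τ a * z := by rw [← h1, ← mul_assoc z, hzz', one_mul]
  let τC : C →+* C := τ.restrict C C hstab
  have hε' : ε' * ε = 1 := by rw [← hc, hε]
  have hc' : ∀ a, ε' * a = a * ε' := fun a => by
    calc ε' * a = ε' * (a * ε) * ε' := by rw [mul_assoc, mul_assoc, hε, mul_one]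
      _ = a * ε' := by rw [← hc, ← mul_assoc, hε', one_mul]
  obtain ⟨w, hw⟩ := exists_unit_of_norm_one (A := C) (τ := τC)
    (ε := ⟨ε, memC.mpr (hc z).symm⟩) (ε' := ⟨ε', memC.mpr (hc' z).symm⟩)
    (t := ⟨t, memC.mpr (htc z).symm⟩) (z := ⟨z, memC.mpr rfl⟩)
    (fun a => Subtype.ext (hτ a)) (fun a => Subtype.ext (hc a)) (Subtype.ext hε)
    (Subtype.ext hτε) (Subtype.ext ht) (Subtype.ext hzz)
  obtain ⟨u, hu⟩ : ∃ u : A, u = (w : C) := ⟨_, rfl⟩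
  obtain ⟨u', hu'⟩ : ∃ u : A, u = ((w⁻¹ : Cˣ) : C) := ⟨_, rfl⟩
  have huu : u * u' = 1 := by rw [hu, hu']; exact congrArg Subtype.val w.mul_inv
  have huu' : u' * u = 1 := by rw [hu, hu']; exact congrArg Subtype.val w.inv_mul
  have h1 : τ u * z = u := by rw [hu]; exact congrArg Subtype.val hw
  have h2 : z * τ u = τ u * z := by
    rw [hu]; exact memC.mp (hstab _ (w : C).2)
  refine ⟨g * u, u' * g', u * τ g', τ g * u', ?_, ?_, ?_, ?_, ?_, ?_, ?_⟩
  · calc τ (g * u) = (g * g') * τ g * τ u := by rw [map_mul, hg, one_mul]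
      _ = g * (z * τ u) := by rw [hz]; simp only [mul_assoc]
      _ = g * u := by rw [h2, h1]
  · calc τ (u * τ g') = τ u * (g' * (τ g * τ g')) := by rw [map_mul, hτ, hτg, mul_one]
      _ = (τ u * z) * τ g' := by rw [hz]; simp only [mul_assoc]
      _ = u * τ g' := by rw [h1]
  · rw [mul_assoc, ← mul_assoc u, huu, one_mul, hg]
  · rw [mul_assoc, ← mul_assoc g', hg', one_mul, huu']
  · rw [mul_assoc, ← mul_assoc (τ g'), hτg', one_mul, huu]
  · rw [mul_assoc, ← mul_assoc u', huu', one_mul, hτg]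
  · rw [mul_assoc]

end HilbertNinety

section Representation

/-- If `g ↦ (σ g)⁻¹` preserves the double cosets of the fixed points of an involution `σ`, then a
distinguished irreducible representation is isomorphic to the `σ`-twist of its dual. -/
theorem trace_eq_of_distinguished {G V : Type*} [Group G] [Finite G]
    [AddCommGroup V] [Module ℂ V] [FiniteDimensional ℂ V] (σ : G →* G)
    (hσ : ∀ g, σ (σ g) = g)
    (hd : ∀ g, ∃ k p, σ k = k ∧ σ p = p ∧ (σ g)⁻¹ = k * g * p)
    (ρ : Representation ℂ G V) (hirr : IsIrred ρ) (v : V) (hv : v ≠ 0)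
    (hfix : ∀ g, σ g = g → ρ g v = v) (g : G) :
    LinearMap.trace ℂ V (ρ (σ g)) = LinearMap.trace ℂ V (ρ g⁻¹) := by
  classical
  let H : Subgroup G := σ.eqLocus (MonoidHom.id G)
  have := Fintype.ofFinite H
  obtain ⟨lam, hlam⟩ : ∃ lam : Module.Dual ℂ V, lam v ≠ 0 := by
    by_contra! h
    exact hv ((Module.forall_dual_apply_eq_zero_iff ℂ v).mp h)
  let l : Module.Dual ℂ V := ∑ h : H, lam ∘ₗ ρ h
  have l_apply (x : V) : l x = ∑ h : H, lam (ρ h x) := by simp [l]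
  have hlv : l v ≠ 0 := by
    have : l v = Fintype.card H * lam v := by
      rw [l_apply, Finset.sum_congr rfl fun h _ => by rw [hfix h h.2]]
      simp
    rw [this]
    exact mul_ne_zero (by simp) hlam
  have hl (k : G) (hk : σ k = k) (x : V) : l (ρ k x) = l x := by
    rw [l_apply, l_apply]
    refine Fintype.sum_equiv (Equiv.mulRight (⟨k, hk⟩ : H)) _ _ fun h => ?_
    simp
  have hf (x : G) : l (ρ (σ x)⁻¹ v) = l (ρ x v) := by
    obtain ⟨k, p, hk, hp, h⟩ := hd x
    rw [h, map_mul, map_mul, Module.End.mul_apply, Module.End.mul_apply, hl k hk, hfix p hp]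
  let P : (G →₀ ℂ) →ₗ[ℂ] V := Finsupp.linearCombination ℂ fun x => ρ x v
  let Q : (G →₀ ℂ) →ₗ[ℂ] Module.Dual ℂ V :=
    Finsupp.linearCombination ℂ fun x => l ∘ₗ ρ (σ x)⁻¹
  let S (x : G) : (G →₀ ℂ) →ₗ[ℂ] (G →₀ ℂ) := Finsupp.lmapDomain ℂ ℂ (x * ·)
  have hPS (x : G) : P ∘ₗ S x = ρ x ∘ₗ P := by
    ext y; simp [P, S]
  have hQS (x : G) : Q ∘ₗ S x = (ρ (σ x)⁻¹).dualMap ∘ₗ Q := by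
    ext y; simp [Q, S]
  have hP : Function.Surjective P := by
    rw [← LinearMap.range_eq_top]
    refine (hirr.2 (LinearMap.range P) ?_).resolve_left ?_
    · rintro x _ ⟨c, rfl⟩
      exact ⟨S x c, LinearMap.congr_fun (hPS x) c⟩
    · intro h
      have : v ∈ LinearMap.range P := ⟨Finsupp.single 1 1, by simp [P]⟩
      rw [h] at this
      exact hv ((Submodule.mem_bot ℂ).mp this)
  have hsymm (c d : G →₀ ℂ) : Q c (P d) = Q d (P c) := by
    have : Q.compl₂ P = (Q.compl₂ P).flip := by
      ext x y
      have := hf ((σ x)⁻¹ * y)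
      rw [σ.map_mul, σ.map_inv, hσ, _root_.mul_inv_rev, inv_inv] at this
      simpa [P, Q, ← Module.End.mul_apply, ← map_mul] using this.symm
    exact LinearMap.congr_fun₂ this c d
  obtain ⟨r, hr⟩ := P.exists_rightInverse_of_surjective (LinearMap.range_eq_top.mpr hP)
  let T : V →ₗ[ℂ] Module.Dual ℂ V := Q ∘ₗ r
  have hTP (c : G →₀ ℂ) : T (P c) = Q c := by
    ext x
    obtain ⟨d, rfl⟩ := hP x
    have : P (r (P c)) = P c := LinearMap.congr_fun hr (P c)
    change Q (r (P c)) (P d) = _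
    rw [hsymm, this, hsymm]
  have hTρ (x : G) (y : V) : T (ρ x y) = (ρ (σ x)⁻¹).dualMap (T y) := by
    obtain ⟨c, rfl⟩ := hP y
    have h1 : P (S x c) = ρ x (P c) := LinearMap.congr_fun (hPS x) c
    have h2 : Q (S x c) = _ := LinearMap.congr_fun (hQS x) c
    rw [← h1, hTP, h2, LinearMap.comp_apply, hTP]
  have hker : LinearMap.ker T = ⊥ := by
    refine (hirr.2 _ fun x y hy => ?_).resolve_right fun h => ?_
    · rw [LinearMap.mem_ker] at hy ⊢
      rw [hTρ, hy, map_zero]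
    · have h1 : T v = 0 := LinearMap.mem_ker.mp (h ▸ Submodule.mem_top)
      have h2 : T v = l := by
        have : P (Finsupp.single 1 1) = v := by simp [P]
        rw [← this, hTP]
        ext y
        simp [Q]
      exact hlv (by rw [← h2, h1]; rfl)
  let e : V ≃ₗ[ℂ] Module.Dual ℂ V := LinearEquiv.ofInjectiveOfFinrankEq T
    (LinearMap.ker_eq_bot.mp hker) Subspace.dual_finrank_eq.symm
  have he : e.conj (ρ g⁻¹) = (ρ (σ g)).dualMap := by
    refine LinearMap.ext fun y => ?_
    rw [LinearEquiv.conj_apply_apply]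
    have := hTρ g⁻¹ (e.symm y)
    rw [σ.map_inv, inv_inv] at this
    refine this.trans (congrArg _ ?_)
    exact e.apply_symm_apply y
  rw [← LinearMap.trace_conj' (ρ g⁻¹) e, he]
  exact (LinearMap.trace_transpose' (ρ (σ g))).symm

end Representation

section Frobenius

theorem exists_frobenius_ringHom {E : Type*} [Field E] [Fintype E] {q : ℕ} (hq : IsPrimePow q)
    (hE : Fintype.card E = q ^ 2) : ∃ F : E →+* E, ∀ a, F a = a ^ q := by
  obtain ⟨p, k, hp, hk, rfl⟩ := hq
  have hp' : Fact p.Prime := ⟨hp.nat_prime⟩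
  have : CharP E p := charP_of_card_eq_prime_pow (f := k * 2) (by rw [hE, pow_mul])
  exact ⟨iterateFrobenius E p k, fun a => iterateFrobenius_def p k a⟩

theorem two_ne_zero_of_card {E : Type*} [Field E] [Fintype E] {q : ℕ} (hq : Odd q)
    (hE : Fintype.card E = q ^ 2) : (2 : E) ≠ 0 := by
  intro h
  have h1 : (q : E) = 0 := by
    have : ((q ^ 2 : ℕ) : E) = 0 := by rw [← hE, FiniteField.cast_card_eq_zero]
    simpa using this
  obtain ⟨m, rfl⟩ := hq
  simp [h] at h1

theorem exists_ne_zero_pow_eq_neg {E : Type*} [Field E] [Fintype E] {q : ℕ} (hq : 1 < q)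
    (hE : Fintype.card E = q ^ 2) (F : E →+* E) (hF : ∀ a, F a = a ^ q) :
    ∃ ε : E, ε ≠ 0 ∧ F ε = -ε := by
  classical
  obtain ⟨x, hx⟩ : ∃ x : E, x ^ q ≠ x := by
    by_contra! h
    have h1 := Finset.card_le_card (s := (Finset.univ : Finset E))
      (t := (Polynomial.X ^ q - Polynomial.X : Polynomial E).roots.toFinset) fun x _ => by
        simp [FiniteField.X_pow_card_sub_X_ne_zero E hq, h x]
    have h2 := (h1.trans (Multiset.toFinset_card_le _)).trans (Polynomial.card_roots' _)
    rw [FiniteField.X_pow_card_sub_X_natDegree_eq E hq, Finset.card_univ, hE] at h2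
    nlinarith
  refine ⟨x ^ q - x, sub_ne_zero.mpr hx, ?_⟩
  have h : (x ^ q) ^ q = x := by rw [← pow_mul, ← pow_two, ← hE, FiniteField.pow_card]
  rw [map_sub, hF, hF, h, neg_sub]

/-- The ring endomorphism of matrices given by `F` entrywise, followed by conjugation by `B`. -/
def twistedMap {E : Type*} [Field E] {n : ℕ} (F : E →+* E) (B : GL (Fin n) E) :
    Matrix (Fin n) (Fin n) E →+* Matrix (Fin n) (Fin n) E where
  toFun X := B.val * F.mapMatrix X * (B⁻¹).val
  map_one' := by rw [map_one, mul_one, Units.mul_inv]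
  map_zero' := by simp
  map_add' X Y := by rw [map_add, mul_add, add_mul]
  map_mul' X Y := by
    simp only [map_mul, mul_assoc]
    rw [← mul_assoc (B⁻¹).val, Units.inv_mul, one_mul]

theorem twistedMap_apply {E : Type*} [Field E] {n : ℕ} (F : E →+* E) (B : GL (Fin n) E)
    (X : Matrix (Fin n) (Fin n) E) :
    twistedMap F B X = B.val * F.mapMatrix X * (B⁻¹).val := rfl

theorem twistedMap_scalar {E : Type*} [Field E] {n : ℕ} (F : E →+* E) (B : GL (Fin n) E) (a : E) :
    twistedMap F B (Matrix.scalar (Fin n) a) = Matrix.scalar (Fin n) (F a) := by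
  have h : F.mapMatrix (Matrix.scalar (Fin n) a) = Matrix.scalar (Fin n) (F a) := by
    ext i j
    simp only [RingHom.mapMatrix_apply, Matrix.map_apply, Matrix.scalar_apply,
      Matrix.diagonal_apply]
    split_ifs <;> simp
  rw [twistedMap_apply, h, ← (Matrix.scalar_commute (F a) (Commute.all _) B.val).eq, mul_assoc,
    Units.mul_inv, mul_one]

/-- If `twistedMap F B` is an involution on invertible matrices, it is one on all matrices. -/
theorem twistedMap_twistedMap {E : Type*} [Field E] {n : ℕ} {F : E →+* E}
    (hF : ∀ a, F (F a) = a) (B : GL (Fin n) E)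
    (h : ∀ g : GL (Fin n) E, twistedMap F B (twistedMap F B g.val) = g.val)
    (X : Matrix (Fin n) (Fin n) E) : twistedMap F B (twistedMap F B X) = X := by
  let D : GL (Fin n) E := B * Units.map F.mapMatrix.toMonoidHom B
  have key (Y : Matrix (Fin n) (Fin n) E) :
      twistedMap F B (twistedMap F B Y) = D.val * Y * (D⁻¹).val := by
    have hFF : F.mapMatrix (F.mapMatrix Y) = Y := by ext; simp [hF]
    simp only [twistedMap_apply, map_mul, hFF, D, _root_.mul_inv_rev, Units.val_mul, mul_assoc,
      Units.inv_mul_cancel_left]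
    rfl
  have hcomm : D ∈ Subgroup.center (GL (Fin n) E) := by
    rw [Subgroup.mem_center_iff]
    intro g
    have h1 : D * g * D⁻¹ = g := Units.ext ((key g.val).symm.trans (h g))
    exact (mul_inv_eq_iff_eq_mul.mp h1).symm
  rw [Matrix.GeneralLinearGroup.mem_center_iff_val_mem_range_scalar] at hcomm
  obtain ⟨c, hc⟩ := hcomm
  rw [key, ← hc, (Matrix.scalar_commute c (Commute.all _) X).eq, mul_assoc, hc, Units.mul_inv,
    mul_one]

end Frobenius

end FrobeniusDistinguished

/-- Let `q` be an odd prime power, `Fr` the entrywise Frobenius `x ↦ x^q`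
of `𝔽_{q²}` and `B ∈ GL_n(𝔽_{q²})` such that `σ(X) = B · Fr(X) · B⁻¹` is an involutive
automorphism of `GL_n(𝔽_{q²})`, with fixed-point subgroup `H`.  If an irreducible
complex representation `ρ` of `GL_n(𝔽_{q²})` has a nonzero `H`-fixed vector, then
`χ_ρ(σ(g)) = χ_ρ(g⁻¹)` for all `g`, i.e. `ρ ≅ ρ* ∘ σ`. -/
theorem stmt1 (q : ℕ) (hq : Odd q) (hq' : IsPrimePow q)
    (E : Type) [Field E] [Fintype E] (hE : Fintype.card E = q ^ 2)
    (n : ℕ) (hn : 1 ≤ n)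
    (B : GL (Fin n) E)
    (σ : GL (Fin n) E → GL (Fin n) E)
    (hform : ∀ g : GL (Fin n) E, (σ g : Matrix (Fin n) (Fin n) E) =
      (B : Matrix (Fin n) (Fin n) E) *
        ((g : Matrix (Fin n) (Fin n) E).map fun a => a ^ q) *
        ((B⁻¹ : GL (Fin n) E) : Matrix (Fin n) (Fin n) E))
    (hmul : ∀ a b : GL (Fin n) E, σ (a * b) = σ a * σ b)
    (hinvol : ∀ g : GL (Fin n) E, σ (σ g) = g)
    (V : Type) [AddCommGroup V] [Module ℂ V] [FiniteDimensional ℂ V]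
    (ρ : Representation ℂ (GL (Fin n) E) V) (hirr : IsIrred ρ)
    (v : V) (hv : v ≠ 0)
    (hfix : ∀ g : GL (Fin n) E, σ g = g → ρ g v = v) :
    ∀ g : GL (Fin n) E,
      LinearMap.trace ℂ V (ρ (σ g)) = LinearMap.trace ℂ V (ρ g⁻¹) := by
  classical
  obtain ⟨F, hF⟩ := FrobeniusDistinguished.exists_frobenius_ringHom hq' hE
  have h2 := FrobeniusDistinguished.two_ne_zero_of_card hq hE
  obtain ⟨ε, hε0, hFε⟩ :=
    FrobeniusDistinguished.exists_ne_zero_pow_eq_neg hq'.one_lt hE F hF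
  have hFF (a : E) : F (F a) = a := by
    rw [hF, hF, ← pow_mul, ← pow_two, ← hE, FiniteField.pow_card]
  have hστ (g : GL (Fin n) E) :
      (σ g).val = FrobeniusDistinguished.twistedMap F B g.val := by
    rw [hform, FrobeniusDistinguished.twistedMap_apply]
    congr 2
    ext i j
    simp [hF]
  have hτ := FrobeniusDistinguished.twistedMap_twistedMap hFF B fun g => by
    rw [← hστ, ← hστ, hinvol]
  have hsc (a : E) (X : Matrix (Fin n) (Fin n) E) :
      Matrix.scalar (Fin n) a * X = X * Matrix.scalar (Fin n) a :=
    (Matrix.scalar_commute a (Commute.all _) X).eq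
  let σ' : GL (Fin n) E →* GL (Fin n) E := MonoidHom.mk' σ hmul
  refine FrobeniusDistinguished.trace_eq_of_distinguished σ' hinvol (fun g => ?_)
    ρ hirr v hv hfix
  obtain ⟨k, k', p, p', hk, hp, hkk, hkk', hpp, hpp', h⟩ :=
    FrobeniusDistinguished.exists_fixed_mul_mul hτ (hsc ε) (ε' := Matrix.scalar (Fin n) ε⁻¹)
      (t := Matrix.scalar (Fin n) 2⁻¹)
      (by rw [← map_mul, mul_inv_cancel₀ hε0, map_one])
      (by rw [FrobeniusDistinguished.twistedMap_scalar, hFε, map_neg])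
      (by rw [← map_add, ← two_mul, mul_inv_cancel₀ h2, map_one])
      (hsc 2⁻¹) g.mul_inv g.inv_mul
  let K : GL (Fin n) E := ⟨k, k', hkk, hkk'⟩
  let P : GL (Fin n) E := ⟨p, p', hpp, hpp'⟩
  have hK : σ K = K := Units.ext ((hστ K).trans hk)
  have hP : σ P = P := Units.ext ((hστ P).trans hp)
  have h' : K * σ' g⁻¹ = g * P := by
    refine Units.ext ?_
    rw [Units.val_mul, Units.val_mul]
    change k * (σ g⁻¹).val = _
    rw [hστ, h]
  have hK' : σ' K⁻¹ = K⁻¹ := by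
    rw [map_inv]
    exact congrArg _ hK
  refine ⟨K⁻¹, P, hK', hP, ?_⟩
  rw [← map_inv, mul_assoc, ← h', inv_mul_cancel_left]
end

section
/- Let q be an odd prime power and n ≥ 1. Let Fr denote the Frobenius x ↦ x^q of 𝔽_{q²}, applied entrywise to matrices. Let B ∈ GL_n(𝔽_{q²}) be such that the map σ(X) := B·Fr((X⁻¹)ᵀ)·B⁻¹ satisfies σ∘σ = id (an involutive automorphism of GL_n(𝔽_{q²})), and let H = {g ∈ GL_n(𝔽_{q²}) : σ(g) = g} (a unitary group). If π is an irreducible complex representation of GL_n(𝔽_{q²}) with a nonzero H-fixed vector, then χ_π(σ(g)) = χ_π(g⁻¹) for all g ∈ GL_n(𝔽_{q²}), i.e. π ≅ π* ∘ σ. -/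
open Matrix

/-- In a finite field of odd characteristic, the form `a² - d b²` represents every element. -/
theorem FiniteField.exists_sq_sub_mul_sq_eq {K : Type*} [Field K] [Finite K]
    (h2 : (2 : K) ≠ 0) (u d : K) (hd : d ≠ 0) : ∃ a b : K, a ^ 2 - d * b ^ 2 = u := by
  have := Fintype.ofFinite K
  have hdeg : (Polynomial.X ^ 2 - Polynomial.C u).degree = 2 :=
    Polynomial.degree_X_pow_sub_C two_pos u
  have hdeg' : (Polynomial.C (-d) * Polynomial.X ^ 2).degree = 2 :=
    Polynomial.degree_C_mul_X_pow 2 (neg_ne_zero.mpr hd)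
  have hcard : Fintype.card K % 2 = 1 := by
    refine FiniteField.odd_card_of_char_ne_two fun h => h2 ?_
    have := ringChar.Nat.cast_ringChar (R := K)
    rw [h] at this
    exact_mod_cast this
  obtain ⟨a, b, hab⟩ := FiniteField.exists_root_sum_quadratic hdeg hdeg' hcard
  refine ⟨a, b, ?_⟩
  simp at hab
  linear_combination hab

theorem exists_sq_sub_mul_sq_eq_of_isReduced {R : Type*} [CommRing R] [Finite R] [IsReduced R]
    (h2 : IsUnit (2 : R)) (u d : R) (hd : IsUnit d) : ∃ a b : R, a ^ 2 - d * b ^ 2 = u := by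
  let e := IsArtinianRing.equivPi R
  have key : ∀ I : MaximalSpectrum R, ∃ a b : R ⧸ I.asIdeal,
      a ^ 2 - e d I * b ^ 2 = e u I := by
    intro I
    have : Finite (R ⧸ I.asIdeal) := Finite.of_surjective _ Ideal.Quotient.mk_surjective
    let _ : Field (R ⧸ I.asIdeal) := Ideal.Quotient.field I.asIdeal
    refine FiniteField.exists_sq_sub_mul_sq_eq ?_ (e u I) (e d I) ?_
    · rw [← map_ofNat (Ideal.Quotient.mk I.asIdeal) 2]
      exact (h2.map _).ne_zero
    · exact (hd.map ((Pi.evalRingHom _ I).comp e.toRingHom)).ne_zero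
  choose a b hab using key
  refine ⟨e.symm a, e.symm b, e.injective ?_⟩
  ext I
  simpa using hab I

/-- In a finite commutative ring of odd characteristic `p`, the form `a² - d b²` with `d` a unit
represents every unit. -/
theorem exists_sq_sub_mul_sq_eq_of_isUnit {R : Type*} [CommRing R] [Finite R] (p : ℕ)
    [Fact p.Prime] [CharP R p] (hp : Odd p) {u d : R} (hu : IsUnit u) (hd : IsUnit d) :
    ∃ a b : R, a ^ 2 - d * b ^ 2 = u := by
  have h2 : IsUnit (2 : R) := by
    obtain ⟨k, hk⟩ := hp
    have h := CharP.cast_eq_zero R p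
    rw [hk] at h
    push_cast at h
    exact IsUnit.of_mul_eq_one (-k : R) (by linear_combination -h)
  let π := Ideal.Quotient.mk (nilradical R)
  have hred : IsReduced (R ⧸ nilradical R) :=
    (Ideal.isRadical_iff_quotient_reduced _).mp (Ideal.radical_isRadical _)
  have hfin : Finite (R ⧸ nilradical R) := Finite.of_surjective _ Ideal.Quotient.mk_surjective
  obtain ⟨a', b', hab⟩ := exists_sq_sub_mul_sq_eq_of_isReduced
    (map_ofNat π 2 ▸ h2.map π) (π u) (π d) (hd.map π)
  obtain ⟨a, rfl⟩ := Ideal.Quotient.mk_surjective a'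
  obtain ⟨b, rfl⟩ := Ideal.Quotient.mk_surjective b'
  obtain ⟨w, rfl⟩ := hu
  obtain ⟨N, hN⟩ : IsNilpotent ((a ^ 2 - d * b ^ 2) * (↑w⁻¹ : R) - 1) := by
    rw [← mem_nilradical, ← Ideal.Quotient.eq_zero_iff_mem]
    have : π (w : R) * π (↑w⁻¹ : R) = 1 := by rw [← map_mul]; simp
    change π _ = 0
    simp only [map_sub, map_mul, map_pow, map_one]
    linear_combination π (↑w⁻¹ : R) * hab + this
  set s := (a ^ 2 - d * b ^ 2) * (↑w⁻¹ : R) with hs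
  have hspow : s ^ p ^ N = 1 := by
    have h0 : (s - 1) ^ p ^ N = 0 :=
      pow_eq_zero_of_le (Nat.lt_pow_self (Fact.out : p.Prime).one_lt).le hN
    rw [sub_pow_char_pow, one_pow] at h0
    linear_combination h0
  obtain ⟨k, hk⟩ := hp.pow (n := N)
  have hsw : s * w = a ^ 2 - d * b ^ 2 := by simp [hs, mul_assoc]
  refine ⟨a * s ^ k, b * s ^ k, ?_⟩
  have : s ^ k * s ^ k * s = 1 := by rw [← hspow, hk]; ring
  linear_combination (-(s ^ k) ^ 2) * hsw + (w : R) * this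

/-- If `θ` is an involutive anti-automorphism such that `θ g` and `g` lie in
the same double coset of the subgroup `{g | θ g = g⁻¹}`, an irreducible representation with a
nonzero vector fixed by this subgroup has a `θ`-invariant character. -/
theorem IsIrred.trace_antiInvolution {G V : Type*} [Group G] [Finite G] [AddCommGroup V]
    [Module ℂ V] [FiniteDimensional ℂ V] {ρ : Representation ℂ G V} (hirr : IsIrred ρ)
    (θ : G → G) (hmul : ∀ a b, θ (a * b) = θ b * θ a) (hinv : ∀ g, θ (θ g) = g)
    (hdouble : ∀ g, ∃ h k, θ h = h⁻¹ ∧ θ k = k⁻¹ ∧ θ g = h * g * k)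
    {v : V} (hv : v ≠ 0) (hfix : ∀ g, θ g = g⁻¹ → ρ g v = v) (g : G) :
    LinearMap.trace ℂ V (ρ (θ g)) = LinearMap.trace ℂ V (ρ g) := by
  have hθ1 : θ 1 = 1 := by simpa using hmul 1 1
  have hθinv : ∀ g, θ g⁻¹ = (θ g)⁻¹ := fun g =>
    eq_inv_of_mul_eq_one_left (by rw [← hmul, mul_inv_cancel, hθ1])
  let H : Subgroup G :=
    { carrier := {g | θ g = g⁻¹}
      one_mem' := by simp [hθ1]
      mul_mem' := fun {a b} ha hb => by
        simp only [Set.mem_ofPred_eq] at *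
        rw [hmul, ha, hb, _root_.mul_inv_rev]
      inv_mem' := fun {a} ha => by
        simp only [Set.mem_ofPred_eq] at *
        rw [hθinv, ha] }
  have := Fintype.ofFinite G
  have := Fintype.ofFinite H
  obtain ⟨l, hl⟩ : ∃ l : Module.Dual ℂ V, l v ≠ 0 := by
    by_contra! h
    exact hv ((Module.forall_dual_apply_eq_zero_iff ℂ v).mp h)
  let ℓ : Module.Dual ℂ V := ∑ h : H, l ∘ₗ ρ h
  have hℓv : ℓ v ≠ 0 := by
    have : ℓ v = Fintype.card H * l v := by
      simp only [ℓ, LinearMap.sum_apply, LinearMap.comp_apply]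
      rw [Finset.sum_congr rfl fun h _ => by rw [hfix h h.2]]
      simp
    rw [this]
    exact mul_ne_zero (Nat.cast_ne_zero.mpr Fintype.card_ne_zero) hl
  have hℓ : ∀ h : G, θ h = h⁻¹ → ∀ w, ℓ (ρ h w) = ℓ w := by
    intro h hh w
    simp only [ℓ, LinearMap.sum_apply, LinearMap.comp_apply]
    refine Fintype.sum_equiv (Equiv.mulRight (⟨h, hh⟩ : H)) _ _ fun k => ?_
    simp [map_mul]
  have hφ : ∀ g, ℓ (ρ (θ g) v) = ℓ (ρ g v) := by
    intro g
    obtain ⟨h, k, hh, hk, e⟩ := hdouble g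
    rw [e, map_mul, map_mul, Module.End.mul_apply, Module.End.mul_apply, hℓ h hh, hfix k hk]
  let A : (G → ℂ) →ₗ[ℂ] V := Fintype.linearCombination ℂ fun g => ρ g v
  let L : (G → ℂ) →ₗ[ℂ] Module.Dual ℂ V := Fintype.linearCombination ℂ fun g => ℓ ∘ₗ ρ (θ g)
  have hA : ∀ g, ρ g v ∈ LinearMap.range A := fun g => by
    classical exact ⟨Pi.single g 1, by simp [A, Fintype.linearCombination_apply_single]⟩
  have hspan : LinearMap.range A = Submodule.span ℂ (Set.range fun g => ρ g v) :=
    Fintype.range_linearCombination ℂ _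
  have htop : Submodule.span ℂ (Set.range fun g => ρ g v) = ⊤ := by
    refine (hirr.2 _ fun g w hw => ?_).resolve_left fun h => hv ?_
    · induction hw using Submodule.span_induction with
      | mem x hx =>
        obtain ⟨k, rfl⟩ := hx
        exact Submodule.subset_span ⟨g * k, by simp [map_mul]⟩
      | zero => simp
      | add x y _ _ hx hy => rw [map_add]; exact add_mem hx hy
      | smul c x _ hx => rw [map_smul]; exact Submodule.smul_mem _ c hx
    · rw [← Submodule.mem_bot ℂ, ← h]
      exact Submodule.subset_span ⟨1, by simp⟩
  have hker : ∀ b, A b = 0 → L b = 0 := by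
    intro b hb
    refine LinearMap.ext_on_range htop fun k => ?_
    have h1 : L b (ρ k v) = ℓ (ρ (θ k) (A b)) := by
      simp only [L, A, Fintype.linearCombination_apply, map_sum, map_smul, LinearMap.sum_apply,
        LinearMap.smul_apply, LinearMap.comp_apply]
      refine Finset.sum_congr rfl fun g _ => ?_
      congr 1
      rw [← Module.End.mul_apply, ← Module.End.mul_apply, ← map_mul, ← map_mul, ← hφ, hmul, hinv]
    rw [h1, hb]
    simp
  obtain ⟨S, hS⟩ := A.exists_rightInverse_of_surjective (hspan.trans htop)
  let T : V →ₗ[ℂ] Module.Dual ℂ V := L ∘ₗ S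
  have hT : ∀ g, T (ρ g v) = ℓ ∘ₗ ρ (θ g) := by
    classical
    intro g
    have hAg : A (Pi.single g 1) = ρ g v := by simp [A, Fintype.linearCombination_apply_single]
    have hLg : L (Pi.single g 1) = ℓ ∘ₗ ρ (θ g) := by
      simp [L, Fintype.linearCombination_apply_single]
    rw [← hLg, ← sub_eq_zero]
    change L (S _) - _ = 0
    rw [← map_sub]
    refine hker _ ?_
    rw [map_sub, hAg, sub_eq_zero]
    exact LinearMap.congr_fun hS _
  have hTρ : ∀ g, T ∘ₗ ρ g = (ρ (θ g)).dualMap ∘ₗ T := by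
    intro g
    refine LinearMap.ext_on_range htop fun k => ?_
    simp only [LinearMap.comp_apply]
    rw [← Module.End.mul_apply, ← map_mul, hT, hT, hmul, map_mul]
    rfl
  have hTinj : LinearMap.ker T = ⊥ := by
    refine (hirr.2 _ fun g w hw => ?_).resolve_right fun h => hℓv ?_
    · rw [LinearMap.mem_ker] at hw ⊢
      rw [← LinearMap.comp_apply, hTρ, LinearMap.comp_apply, hw, map_zero]
    · have h1 : T v = 0 := by rw [← LinearMap.mem_ker, h]; trivial
      have h2 := hT 1
      simp only [map_one, Module.End.one_apply, hθ1] at h2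
      rw [h1] at h2
      simpa using (LinearMap.congr_fun h2 v).symm
  let e : V ≃ₗ[ℂ] Module.Dual ℂ V :=
    LinearEquiv.ofInjectiveOfFinrankEq T (LinearMap.ker_eq_bot.mp hTinj)
      Subspace.dual_finrank_eq.symm
  have he : (ρ (θ g)).dualMap = e.conj (ρ g) := by
    ext1 w
    obtain ⟨w, rfl⟩ := e.surjective w
    rw [LinearEquiv.conj_apply_apply, e.symm_apply_apply]
    exact (LinearMap.congr_fun (hTρ g) w).symm
  rw [← LinearMap.trace_conj' (ρ g) e, ← he]
  exact (LinearMap.trace_transpose' _).symm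

open scoped IsMulCommutative in
/-- Every unit `u` fixed by an anti-endomorphism `θ` of a finite ring of odd characteristic is of
the form `c * θ c`, provided `θ` negates some central unit. -/
theorem exists_mul_antiHom_eq {A : Type*} [Ring A] [Finite A] (p : ℕ) [Fact p.Prime] [CharP A p]
    (hp : Odd p) (θ : A →+ A) (hθ1 : θ 1 = 1) (hθ : ∀ a b, θ (a * b) = θ b * θ a)
    {u ε : A} (hu : IsUnit u) (hθu : θ u = u) (hε : IsUnit ε) (hεc : ∀ a, Commute ε a)
    (hθε : θ ε = -ε) : ∃ c, c * θ c = u ∧ Commute c (θ c) := by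
  let s : Set A := {u, ε ^ 2}
  have hs : ∀ x ∈ s, ∀ y ∈ s, x * y = y * x := by
    have h := ((hεc u).pow_left 2).eq
    rintro x (rfl | rfl) y (rfl | rfl)
    exacts [rfl, h.symm, h, rfl]
  let R := Subring.closure s
  have hR : IsMulCommutative R := Subring.isMulCommutative_closure hs
  have hunit : ∀ x : R, IsUnit (x : A) → IsUnit x := by
    rintro x ⟨w, hw⟩
    refine IsUnit.of_pow_eq_one (n := orderOf w) (Subtype.ext ?_) (orderOf_pos w).ne'
    have := congrArg Units.val (pow_orderOf_eq_one w)
    rw [Units.val_pow_eq_pow_val, hw] at this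
    exact this
  have hfixed : ∀ x : R, θ x = x := by
    rintro ⟨x, hx⟩
    change θ x = x
    induction hx using Subring.closure_induction with
    | mem x hx =>
      rcases hx with rfl | rfl
      · exact hθu
      · rw [sq, hθ, hθε, neg_mul_neg]
    | zero => exact map_zero θ
    | one => exact hθ1
    | add x y _ _ hx hy => rw [map_add, hx, hy]
    | neg x _ hx => rw [map_neg, hx]
    | mul x y hx' hy' hx hy =>
      rw [hθ, hx, hy]
      exact congrArg Subtype.val (mul_comm (⟨y, hy'⟩ : R) ⟨x, hx'⟩)
  let u' : R := ⟨u, Subring.subset_closure (Or.inl rfl)⟩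
  let d : R := ⟨ε ^ 2, Subring.subset_closure (Or.inr rfl)⟩
  obtain ⟨a, b, hab⟩ := exists_sq_sub_mul_sq_eq_of_isUnit p hp (hunit u' hu) (hunit d (hε.pow 2))
  have hcomm : Commute (a : A) b := congrArg Subtype.val (mul_comm a b)
  have hθc : θ (a + ε * b) = a - ε * b := by
    rw [map_add, hθ, hθε, hfixed, hfixed, mul_neg, ← (hεc b).eq, sub_eq_add_neg]
  have hab' : (a : A) ^ 2 - ε ^ 2 * (b : A) ^ 2 = u := congrArg Subtype.val hab
  have hcε : Commute (a : A) (ε * b) := (hεc a).symm.mul_right hcomm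
  refine ⟨a + ε * b, ?_, ?_⟩
  · rw [hθc, ← hcε.sq_sub_sq, (hεc b).mul_pow, hab']
  · rw [hθc]
    exact ((Commute.refl _).add_left hcε.symm).sub_right (hcε.add_left (Commute.refl _))

/-- The field with `(p ^ k) ^ 2` elements contains a nonzero element negated by `x ↦ x ^ p ^ k`. -/
theorem FiniteField.exists_pow_eq_neg {E : Type*} [Field E] [Fintype E] {p k : ℕ}
    [Fact p.Prime] [CharP E p] (hk : k ≠ 0) (hE : Fintype.card E = (p ^ k) ^ 2) :
    ∃ ε : E, ε ≠ 0 ∧ ε ^ p ^ k = -ε := by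
  have hq : 1 < p ^ k := Nat.one_lt_pow hk (Fact.out : p.Prime).one_lt
  obtain ⟨t, ht⟩ : ∃ t : E, t ^ p ^ k ≠ t := by
    by_contra! h
    have hcard : Fintype.card E ≤ p ^ k := by
      classical
      have hne := FiniteField.X_pow_card_sub_X_ne_zero E hq
      calc Fintype.card E = (Finset.univ : Finset E).card := rfl
        _ ≤ (Polynomial.X ^ p ^ k - Polynomial.X : Polynomial E).natDegree :=
            Polynomial.card_le_degree_of_subset_roots fun x _ => by
              simp [Polynomial.mem_roots hne, h]
        _ = p ^ k := FiniteField.X_pow_card_sub_X_natDegree_eq E hq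
    rw [hE] at hcard
    nlinarith
  refine ⟨t - t ^ p ^ k, sub_ne_zero.mpr ht.symm, ?_⟩
  rw [sub_pow_char_pow, ← pow_mul, ← sq, ← hE, FiniteField.pow_card, neg_sub]

/-- A polar decomposition of `g` with normal factor `c` puts `θ g` and `g` in the same double coset
of `{g | θ g = g⁻¹}`. -/
theorem exists_doubleCoset_of_mul_eq {G : Type*} [Group G] (θ : G → G)
    (hmul : ∀ a b, θ (a * b) = θ b * θ a) (hinv : ∀ g, θ (θ g) = g) {g c : G}
    (hc : c * θ c = g * θ g) (hcomm : Commute c (θ c)) :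
    ∃ h k, θ h = h⁻¹ ∧ θ k = k⁻¹ ∧ θ g = h * g * k := by
  have hθ1 : θ 1 = 1 := by
    have h := hmul 1 1
    rwa [mul_one, left_eq_mul] at h
  have hθinv : ∀ g, θ g⁻¹ = (θ g)⁻¹ := fun g =>
    eq_inv_of_mul_eq_one_left (by rw [← hmul, mul_inv_cancel, hθ1])
  have hg : θ g = g⁻¹ * (c * θ c) := by rw [hc, inv_mul_cancel_left]
  refine ⟨g⁻¹ * c, g⁻¹ * θ c, ?_, ?_, ?_⟩
  · rw [hmul, hθinv, hg]
    group
  · rw [hmul, hinv, hθinv, hg, hcomm.eq]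
    group
  · rw [hg]
    group

/-- Let `q` be an odd prime power, `Fr` the entrywise Frobenius `x ↦ x^q`
of `𝔽_{q²}` and `B ∈ GL_n(𝔽_{q²})` such that `σ(X) = B · Fr((X⁻¹)ᵀ) · B⁻¹` is an
involutive automorphism of `GL_n(𝔽_{q²})`, with fixed-point subgroup `H` (a unitary
group).  If an irreducible
complex representation `ρ` of `GL_n(𝔽_{q²})` has a nonzero `H`-fixed vector, then
`χ_ρ(σ(g)) = χ_ρ(g⁻¹)` for all `g`, i.e. `ρ ≅ ρ* ∘ σ`. -/
theorem stmt2 (q : ℕ) (hq : Odd q) (hq' : IsPrimePow q)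
    (E : Type) [Field E] [Fintype E] (hE : Fintype.card E = q ^ 2)
    (n : ℕ) (hn : 1 ≤ n)
    (B : GL (Fin n) E)
    (σ : GL (Fin n) E → GL (Fin n) E)
    (hform : ∀ g : GL (Fin n) E, (σ g : Matrix (Fin n) (Fin n) E) =
      (B : Matrix (Fin n) (Fin n) E) *
        ((((g⁻¹ : GL (Fin n) E) : Matrix (Fin n) (Fin n) E)ᵀ).map fun a => a ^ q) *
        ((B⁻¹ : GL (Fin n) E) : Matrix (Fin n) (Fin n) E))
    (hmul : ∀ a b : GL (Fin n) E, σ (a * b) = σ a * σ b)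
    (hinvol : ∀ g : GL (Fin n) E, σ (σ g) = g)
    (V : Type) [AddCommGroup V] [Module ℂ V] [FiniteDimensional ℂ V]
    (ρ : Representation ℂ (GL (Fin n) E) V) (hirr : IsIrred ρ)
    (v : V) (hv : v ≠ 0)
    (hfix : ∀ g : GL (Fin n) E, σ g = g → ρ g v = v) :
    ∀ g : GL (Fin n) E,
      LinearMap.trace ℂ V (ρ (σ g)) = LinearMap.trace ℂ V (ρ g⁻¹) := by
  obtain ⟨p, k, hp, hk, rfl⟩ := hq'
  have hpf : Fact p.Prime := ⟨hp.nat_prime⟩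
  have hchar : CharP E p := charP_of_card_eq_prime_pow (f := k * 2) (by rw [hE, pow_mul])
  have hpodd : Odd p := Nat.Odd.of_mul_left (n := p ^ (k - 1)) (by rwa [mul_pow_sub_one hk.ne'])
  have hne : Nonempty (Fin n) := ⟨⟨0, hn⟩⟩
  obtain ⟨ε, hε0, hε⟩ := FiniteField.exists_pow_eq_neg (E := E) hk.ne' hE
  let φ : E →+* E := iterateFrobenius E p k
  let θ : GL (Fin n) E → GL (Fin n) E := fun g => σ g⁻¹
  let θM : Matrix (Fin n) (Fin n) E →+ Matrix (Fin n) (Fin n) E :=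
    { toFun X := (B : Matrix (Fin n) (Fin n) E) * (Xᵀ.map φ) *
        ((B⁻¹ : GL (Fin n) E) : Matrix (Fin n) (Fin n) E)
      map_zero' := by simp
      map_add' X Y := by
        rw [transpose_add, Matrix.map_add φ (map_add φ), mul_add, add_mul] }
  have hθM_apply : ∀ X, θM X = (B : Matrix (Fin n) (Fin n) E) * (Xᵀ.map φ) *
      ((B⁻¹ : GL (Fin n) E) : Matrix (Fin n) (Fin n) E) := fun _ => rfl
  have hBB : ((B⁻¹ : GL (Fin n) E) : Matrix (Fin n) (Fin n) E) * B = 1 := B.inv_mul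
  have hBB' : (B : Matrix (Fin n) (Fin n) E) * ((B⁻¹ : GL (Fin n) E) : Matrix _ _ E) = 1 :=
    B.mul_inv
  have hθM_coe : ∀ g : GL (Fin n) E, θM g = θ g := by
    intro g
    rw [hform, inv_inv, hθM_apply]
    rfl
  have hθM_mul : ∀ X Y, θM (X * Y) = θM Y * θM X := by
    intro X Y
    simp only [hθM_apply, transpose_mul, Matrix.map_mul]
    simp only [Matrix.mul_assoc]
    rw [← Matrix.mul_assoc _ (B : Matrix (Fin n) (Fin n) E), hBB, Matrix.one_mul]
  have hθM_scalar : ∀ a : E, θM (scalar (Fin n) a) = scalar (Fin n) (φ a) := by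
    intro a
    have : (scalar (Fin n) a)ᵀ.map φ = scalar (Fin n) (φ a) := by
      simp [scalar_apply, diagonal_map]
    rw [hθM_apply, this, ← (scalar_commute (φ a) (Commute.all _) _).eq, Matrix.mul_assoc, hBB',
      Matrix.mul_one]
  have hθM_one : θM 1 = 1 := by simpa using hθM_scalar 1
  have hσinv : ∀ g, σ g⁻¹ = (σ g)⁻¹ := by
    have h1 : σ 1 = 1 := by
      have h := hmul 1 1
      rwa [mul_one, left_eq_mul] at h
    exact fun g => eq_inv_of_mul_eq_one_left (by rw [← hmul, inv_mul_cancel, h1])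
  have hθ_mul : ∀ a b, θ (a * b) = θ b * θ a := fun a b => by
    change σ _ = σ _ * σ _
    rw [_root_.mul_inv_rev, hmul]
  have hθ_inv : ∀ g, θ (θ g) = g := fun g => by
    change σ (σ _)⁻¹ = g
    rw [← hσinv, inv_inv, hinvol]
  have hdouble : ∀ g, ∃ h k, θ h = h⁻¹ ∧ θ k = k⁻¹ ∧ θ g = h * g * k := by
    intro g
    have hx : θ (g * θ g) = g * θ g := by rw [hθ_mul, hθ_inv]
    obtain ⟨c, hc, hcomm⟩ := exists_mul_antiHom_eq p hpodd θM hθM_one hθM_mul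
      (u := (g * θ g : GL (Fin n) E)) (ε := scalar (Fin n) ε) (Units.isUnit _)
      (by rw [hθM_coe, hx]) ((IsUnit.mk0 ε hε0).map _)
      (fun a => scalar_commute ε (Commute.all _) a)
      (by rw [hθM_scalar, ← map_neg, ← hε]; rfl)
    obtain ⟨γ, rfl⟩ : IsUnit c := by
      have : IsUnit (c * θM c) := hc ▸ Units.isUnit _
      exact (hcomm.isUnit_mul_iff.mp this).1
    refine exists_doubleCoset_of_mul_eq θ hθ_mul hθ_inv (c := γ) (Units.ext ?_) (Units.ext ?_)
    · rw [← hc, hθM_coe]; rfl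
    · rw [Units.val_mul, Units.val_mul, ← hθM_coe]; exact hcomm
  intro g
  have := hirr.trace_antiInvolution θ hθ_mul hθ_inv hdouble hv
    (fun g hg => hfix g (by rw [← _root_.inv_inj, ← hσinv]; exact hg)) g⁻¹
  rw [← this]
  simp [θ]
end
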